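/- arXiv:1412.8621 — 4 statements merged into one kernel-verified Lean document; each statement's English description precedes it below -/
import Mathlib

section
/- Let n ≥ 1 and suppose the unit cube [0,1]^n ⊆ ℝ^n is covered by a finite family {X_i}_{i∈I} of closed sets with covering multiplicity at most n (no point of the cube belongs to more than n of the sets). Then there exist an index i ∈ I and a coordinate j ∈ {1,…,n} such that X_i intersects both opposite facets {x ∈ [0,1]^n : x_j = 0} and {x ∈ [0,1]^n : x_j = 1}. -/
open Set

/-- The unit cube `[0,1]^n` in `ℝ^n`. -/
def Cube (n : ℕ) : Set (EuclideanSpace ℝ (Fin n)) :=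
  {x | ∀ j, x j ∈ Set.Icc (0 : ℝ) 1}

open Classical in
/-- Label lemma -/
lemma label_parity (N : ℕ) (c : Fin (N+1) → ℕ) (hc : ∀ k, c k ≤ N) :
    (∑ i : Fin (N+1), if (∀ l, 1 ≤ l → l ≤ N → ∃ k, k ≠ i ∧ c k = l) then (1 : ZMod 2) else 0)
      = if (∀ l, l ≤ N → ∃ k, c k = l) then 1 else 0 := by
  let d : Fin (N+1) → Fin (N+1) := fun k => ⟨c k, Nat.lt_succ_of_le (hc k)⟩
  have hd : ∀ k, (d k : ℕ) = c k := fun k => rfl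
  by_cases hs : Function.Surjective d
  · have hinj : Function.Injective d := Finite.injective_iff_surjective.2 hs
    have hR : ∀ l, l ≤ N → ∃ k, c k = l := by
      intro l hl
      obtain ⟨k, hk⟩ := hs ⟨l, Nat.lt_succ_of_le hl⟩
      exact ⟨k, by rw [← hd, hk]⟩
    rw [if_pos hR]
    obtain ⟨i0, hi0⟩ := hR 0 (Nat.zero_le _)
    rw [Finset.sum_eq_single i0]
    · rw [if_pos]
      intro l h1 h2
      obtain ⟨k, hk⟩ := hR l h2
      refine ⟨k, ?_, hk⟩
      rintro rfl
      omega
    · intro b _ hb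
      rw [if_neg]
      intro h
      have hcb : c b ≠ 0 := by
        intro h0
        apply hb
        apply hinj
        apply Fin.ext
        rw [hd, hd, h0, hi0]
      obtain ⟨k, hk, hk2⟩ := h (c b) (by omega) (hc b)
      exact hk (hinj (Fin.ext (by rw [hd, hd, hk2])))
    · simp
  · have hR : ¬ ∀ l, l ≤ N → ∃ k, c k = l := by
      intro h
      apply hs
      intro b
      obtain ⟨k, hk⟩ := h b (Nat.le_of_lt_succ b.2)
      exact ⟨k, Fin.ext (by rw [hd, hk])⟩
    rw [if_neg hR]
    by_cases hB : ∀ l, 1 ≤ l → l ≤ N → ∃ k, c k = l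
    · have hni : ¬ Function.Injective d := fun h => hs (Finite.injective_iff_surjective.1 h)
      have h0 : ∀ k, c k ≠ 0 := by
        intro k hk
        apply hR
        intro l hl
        rcases Nat.eq_zero_or_pos l with rfl | h
        · exact ⟨k, hk⟩
        · exact hB l h hl
      simp only [Function.Injective, not_forall] at hni
      obtain ⟨a, b, hab, hne⟩ := hni
      have hcab : c a = c b := by rw [← hd, ← hd, hab]
      have key : ∀ i, (∀ l, 1 ≤ l → l ≤ N → ∃ k, k ≠ i ∧ c k = l) ↔ (i = a ∨ i = b) := by
        intro i
        constructor
        · intro h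
          by_contra hcon
          push Not at hcon
          have hsub : Finset.Icc 1 N ⊆ ((Finset.univ.erase i).erase a).image c := by
            intro l hl
            rw [Finset.mem_Icc] at hl
            obtain ⟨k, hk, hk2⟩ := h l hl.1 hl.2
            rw [Finset.mem_image]
            by_cases hka : k = a
            · refine ⟨b, ?_, ?_⟩
              · simp [Ne.symm hne, hcon.2.symm]
              · rw [← hcab, ← hka, hk2]
            · exact ⟨k, by simp [hka, hk], hk2⟩
          have h1 := Finset.card_le_card hsub
          have h2 := h1.trans Finset.card_image_le
          rw [Finset.card_erase_of_mem (by simp [hcon.1.symm]), Finset.card_erase_of_mem (by simp)] at h2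
          simp at h2
          have : 1 ≤ N := (Nat.pos_of_ne_zero (h0 a)).trans_le (hc a)
          omega
        · rintro (rfl | rfl) l h1 h2
          · obtain ⟨k, hk⟩ := hB l h1 h2
            by_cases hka : k = i
            · exact ⟨b, Ne.symm hne, by rw [← hcab, ← hka, hk]⟩
            · exact ⟨k, hka, hk⟩
          · obtain ⟨k, hk⟩ := hB l h1 h2
            by_cases hka : k = i
            · exact ⟨a, hne, by rw [hcab, ← hka, hk]⟩
            · exact ⟨k, hka, hk⟩
      simp only [key]
      rw [Finset.sum_ite, Finset.sum_const_zero, add_zero, Finset.sum_const]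
      have : (Finset.univ.filter fun i => i = a ∨ i = b) = {a, b} := by
        ext; simp
      rw [this, Finset.card_pair hne]
      decide
    · apply Finset.sum_eq_zero
      intro i _
      rw [if_neg]
      intro h
      apply hB
      intro l h1 h2
      obtain ⟨k, _, hk⟩ := h l h1 h2
      exact ⟨k, hk⟩


/-- Indicator mod 2. -/
noncomputable def ind2 (P : Prop) : ZMod 2 := by
  classical exact if P then 1 else 0

lemma ind2_true {P : Prop} (h : P) : ind2 P = 1 := by simp [ind2, h]
lemma ind2_false {P : Prop} (h : ¬ P) : ind2 P = 0 := by simp [ind2, h]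

lemma label_parity2 (N : ℕ) (c : Fin (N+1) → ℕ) (hc : ∀ k, c k ≤ N) :
    (∑ i : Fin (N+1), ind2 (∀ l, 1 ≤ l → l ≤ N → ∃ k, k ≠ i ∧ c k = l))
      = ind2 (∀ l, l ≤ N → ∃ k, c k = l) := by
  have := label_parity N c hc
  unfold ind2
  convert this

/-- The vertices of the Kuhn simplex with base `v` and (inverse) permutation `τ`. -/
def kpt {n : ℕ} (v : Fin n → ℕ) (τ : Equiv.Perm (Fin n)) (k : ℕ) : Fin n → ℕ :=
  fun j => v j + if (τ j : ℕ) < k then 1 else 0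

/-- The indicator of a door. -/
noncomputable def door {n : ℕ} (c : (Fin (n+1) → ℕ) → ℕ) (v : Fin (n+1) → ℕ)
    (τ : Equiv.Perm (Fin (n+1))) (i : Fin (n+2)) : ZMod 2 :=
  ind2 (∀ l, 1 ≤ l → l ≤ n+1 → ∃ k : Fin (n+2), k ≠ i ∧ c (kpt v τ k) = l)

lemma zmod2_add_self (a : ZMod 2) : a + a = 0 := by revert a; decide

/-- middle facets cancel -/
lemma door_mid {n : ℕ} (c : (Fin (n+1) → ℕ) → ℕ) (v : Fin (n+1) → ℕ) (i : Fin n) :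
    ∑ τ : Equiv.Perm (Fin (n+1)), door c v τ i.succ.castSucc = 0 := by
  have hne : i.castSucc ≠ i.succ := by
    intro h; have := congrArg Fin.val h; simp at this
  refine Finset.sum_involution
    (fun τ _ => τ.trans (Equiv.swap i.castSucc i.succ)) ?_ ?_ ?_ ?_
  · intro τ _
    have : door c v (τ.trans (Equiv.swap i.castSucc i.succ)) i.succ.castSucc
        = door c v τ i.succ.castSucc := by
      unfold door
      have hk : ∀ k : Fin (n+2), k ≠ i.succ.castSucc →
          kpt v (τ.trans (Equiv.swap i.castSucc i.succ)) k = kpt v τ k := by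
        intro k hk
        have hk' : (k : ℕ) ≠ i + 1 := by
          intro h; apply hk; apply Fin.ext; simp [h]
        funext j
        unfold kpt
        congr 1
        have : (((τ.trans (Equiv.swap i.castSucc i.succ)) j : Fin (n+1)) : ℕ) < k
            ↔ (τ j : ℕ) < k := by
          rw [Equiv.trans_apply, Equiv.swap_apply_def]
          split_ifs with h1 h2
          · rw [h1]; simp; omega
          · rw [h2]; simp; omega
          · rfl
        simp only [this]
      congr 1
      apply propext
      refine forall_congr' fun l => forall_congr' fun _ => forall_congr' fun _ =>
        exists_congr fun k => and_congr_right fun h => ?_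
      rw [hk k h]
    rw [this, zmod2_add_self]
  · intro τ _ _ h
    have := congrArg (fun e => e (τ.symm i.castSucc)) h
    simp at this
    exact hne this.symm
  · intro τ _; simp
  · intro τ _
    ext j
    simp

/-- The facet indicator. -/
noncomputable def facet {n : ℕ} (c : (Fin (n+1) → ℕ) → ℕ) (τ : Equiv.Perm (Fin (n+1)))
    (w : Fin (n+1) → ℕ) : ZMod 2 :=
  ind2 (∀ l, 1 ≤ l → l ≤ n+1 → ∃ k : Fin (n+1), c (kpt w τ k) = l)

lemma door_last {n : ℕ} (c : (Fin (n+1) → ℕ) → ℕ) (v : Fin (n+1) → ℕ)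
    (τ : Equiv.Perm (Fin (n+1))) : door c v τ (Fin.last (n+1)) = facet c τ v := by
  unfold door facet
  congr 1
  apply propext
  refine forall_congr' fun l => forall_congr' fun _ => forall_congr' fun _ => ?_
  constructor
  · rintro ⟨k, hk, h⟩
    exact ⟨k.castPred hk, by simpa using h⟩
  · rintro ⟨k, h⟩
    exact ⟨k.castSucc, Fin.castSucc_ne_last k, by simpa using h⟩

/-- rotation -/
def rot {n : ℕ} (τ : Equiv.Perm (Fin (n+1))) : Equiv.Perm (Fin (n+1)) :=
  τ.trans (finRotate (n+1)).symm

lemma rot_zero {n : ℕ} (τ : Equiv.Perm (Fin (n+1))) (j : Fin (n+1)) (h : τ j = 0) :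
    rot τ j = Fin.last n := by
  unfold rot
  rw [Equiv.trans_apply, Equiv.symm_apply_eq, h, finRotate_last]

lemma rot_ne {n : ℕ} (τ : Equiv.Perm (Fin (n+1))) (j : Fin (n+1)) (h : τ j ≠ 0) :
    ((rot τ j : Fin (n+1)) : ℕ) + 1 = τ j := by
  have h1 : finRotate (n+1) (rot τ j) = τ j := by simp [rot]
  have h2 : rot τ j ≠ Fin.last n := by
    intro h3; rw [h3, finRotate_last] at h1; exact h h1.symm
  rw [← coe_finRotate_of_ne_last h2, h1]

lemma kpt_rot {n : ℕ} (v : Fin (n+1) → ℕ) (τ : Equiv.Perm (Fin (n+1))) (j : Fin (n+1))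
    (h : τ j = 0) (k : ℕ) (hk : k ≤ n) :
    kpt v τ (k+1) = kpt (Function.update v j (v j + 1)) (rot τ) k := by
  funext i
  unfold kpt
  by_cases hi : i = j
  · subst hi
    rw [rot_zero τ i h, h]
    simp [hk]
  · have h1 : τ i ≠ 0 := by
      intro h2; apply hi; apply τ.injective; rw [h2, h]
    have := rot_ne τ i h1
    rw [Function.update_of_ne hi, ← this]
    simp

lemma door_zero {n : ℕ} (c : (Fin (n+1) → ℕ) → ℕ) (v : Fin (n+1) → ℕ)
    (τ : Equiv.Perm (Fin (n+1))) (j : Fin (n+1)) (hj : τ j = 0) :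
    door c v τ 0 = facet c (rot τ) (Function.update v j (v j + 1)) := by
  unfold door facet
  congr 1
  apply propext
  refine forall_congr' fun l => forall_congr' fun _ => forall_congr' fun _ => ?_
  constructor
  · rintro ⟨k, hk, h⟩
    refine ⟨k.pred hk, ?_⟩
    rw [← kpt_rot v τ j hj _ (Nat.le_of_lt_succ (k.pred hk).2)]
    have : ((k.pred hk : Fin (n+1)) : ℕ) + 1 = k := by
      rw [← Fin.val_succ, Fin.succ_pred]
    rw [this, h]
  · rintro ⟨k, h⟩
    refine ⟨k.succ, Fin.succ_ne_zero k, ?_⟩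
    rw [Fin.val_succ, kpt_rot v τ j hj _ (Nat.le_of_lt_succ k.2), h]

/-- telescoping -/
lemma telescope {n m : ℕ} (G : (Fin (n+1) → ℕ) → ZMod 2) (j : Fin (n+1)) :
    ∑ v : Fin (n+1) → Fin m, (G (Function.update (fun i => (v i : ℕ)) j (v j + 1))
        + G (fun i => (v i : ℕ)))
      = ∑ w : Fin n → Fin m, (G (Fin.insertNth j m (fun i => (w i : ℕ)))
        + G (Fin.insertNth j 0 (fun i => (w i : ℕ)))) := by
  rw [← (Fin.insertNthEquiv (fun _ => Fin m) j).sum_comp, Fintype.sum_prod_type,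
    Finset.sum_comm]
  refine Finset.sum_congr rfl fun w _ => ?_
  have h1 : ∀ a : Fin m, (fun i => (((Fin.insertNthEquiv (fun _ => Fin m) j) (a, w) i : Fin m) : ℕ))
      = Fin.insertNth j (a : ℕ) (fun i => (w i : ℕ)) := by
    intro a
    funext i
    refine Fin.succAboveCases j ?_ (fun i => ?_) i <;> simp
  simp only [h1]
  simp only [Fin.insertNthEquiv_apply, Fin.insertNth_apply_same, Fin.update_insertNth]
  have := Fin.sum_univ_eq_sum_range (fun a => G (Fin.insertNth j (a+1) (fun i => (w i : ℕ)))
        + G (Fin.insertNth j a (fun i => (w i : ℕ)))) m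
  refine this.trans ?_
  clear this h1
  generalize hg : (fun a => G (Fin.insertNth j a (fun i => (w i : ℕ)))) = g
  have hg' : ∀ a, G (Fin.insertNth j a (fun i => (w i : ℕ))) = g a := fun a => by rw [← hg]
  simp only [hg']
  have := Finset.sum_range_sub g m
  have hs : ∀ a b : ZMod 2, a - b = a + b := by decide
  simpa only [hs] using this

/-- **Kuhn's lemma**, parity version. -/
theorem kuhn (n m : ℕ) (c : (Fin n → ℕ) → ℕ) (hm : 1 ≤ m)
    (hc : ∀ x, (∀ j, x j ≤ m) → c x ≤ n)
    (h0 : ∀ x, (∀ j, x j ≤ m) → ∀ j : Fin n, x j = 0 → (j : ℕ) + 1 ≤ c x)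
    (h1 : ∀ x, (∀ j, x j ≤ m) → ∀ j : Fin n, x j = m → c x ≠ j + 1) :
    ∑ v : Fin n → Fin m, ∑ τ : Equiv.Perm (Fin n),
      ind2 (∀ l, l ≤ n → ∃ k : Fin (n+1), c (kpt (fun i => (v i : ℕ)) τ k) = l) = 1 := by
  induction n with
  | zero =>
    have : ∀ x, c x = 0 := by
      intro x
      have := hc x (fun j => j.elim0)
      omega
    simp [this, ind2]
  | succ n ih =>
    have hk : ∀ (v : Fin (n+1) → Fin m) (τ : Equiv.Perm (Fin (n+1))) (k : ℕ) (j),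
        kpt (fun i => (v i : ℕ)) τ k j ≤ m := by
      intro v τ k j
      have := (v j).2
      simp only [kpt]
      split_ifs <;> omega
    have step1 : ∀ (v : Fin (n+1) → Fin m) (τ : Equiv.Perm (Fin (n+1))),
        ind2 (∀ l, l ≤ n+1 → ∃ k : Fin (n+1+1), c (kpt (fun i => (v i : ℕ)) τ k) = l)
          = ∑ i, door c (fun i => (v i : ℕ)) τ i := by
      intro v τ
      rw [← label_parity2 (n+1) (fun k => c (kpt (fun i => (v i : ℕ)) τ k))
        (fun k => hc _ (hk v τ k))]
      rfl
    have step2 : ∀ v : Fin (n+1) → Fin m,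
        ∑ τ, ∑ i, door c (fun i => (v i : ℕ)) τ i
        = ∑ τ : Equiv.Perm (Fin (n+1)),
          (facet c (rot τ) (Function.update (fun i => (v i : ℕ)) (τ.symm 0) (v (τ.symm 0) + 1))
            + facet c (rot τ) (fun i => (v i : ℕ))) := by
      intro v
      rw [Finset.sum_comm, Fin.sum_univ_succ, Fin.sum_univ_castSucc]
      have : ∀ i : Fin n, ∑ τ : Equiv.Perm (Fin (n+1)),
          door c (fun i => (v i : ℕ)) τ i.castSucc.succ = 0 := by
        intro i
        rw [Fin.succ_castSucc]
        exact door_mid c _ i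
      rw [Finset.sum_eq_zero (fun i _ => this i), zero_add, Finset.sum_add_distrib]
      congr 1
      · refine Finset.sum_congr rfl fun τ _ => ?_
        exact door_zero c _ τ _ (by simp)
      · rw [Fin.succ_last]
        simp only [door_last]
        let e : Equiv.Perm (Fin (n+1)) ≃ Equiv.Perm (Fin (n+1)) :=
          (Equiv.mulLeft (finRotate (n+1))⁻¹)
        rw [← e.sum_comp]
        rfl
    simp only [step1, step2]
    rw [Finset.sum_comm]
    have step3 : ∀ τ : Equiv.Perm (Fin (n+1)), _ := fun τ =>
      telescope (m := m) (facet c (rot τ)) (τ.symm 0)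
    simp only [step3]
    have hle : ∀ (τ : Equiv.Perm (Fin (n+1))) (w : Fin n → Fin m) (a k : ℕ), a ≤ m → k ≤ n →
        (∀ j, kpt (Fin.insertNth (τ.symm 0) a (fun i => (w i : ℕ))) (rot τ) k j ≤ m) ∧
        kpt (Fin.insertNth (τ.symm 0) a (fun i => (w i : ℕ))) (rot τ) k (τ.symm 0) = a := by
      intro τ w a k ha hkn
      have hA : kpt (Fin.insertNth (τ.symm 0) a (fun i => (w i : ℕ))) (rot τ) k (τ.symm 0) = a := by
        unfold kpt
        rw [rot_zero τ _ (by simp)]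
        simp [hkn]
      refine ⟨?_, hA⟩
      intro j
      rcases Fin.eq_self_or_eq_succAbove (τ.symm 0) j with rfl | ⟨i, rfl⟩
      · rw [hA]; exact ha
      · unfold kpt
        rw [Fin.insertNth_apply_succAbove]
        have := (w i).2
        split_ifs <;> omega
    have up : ∀ (τ : Equiv.Perm (Fin (n+1))) (w : Fin n → Fin m),
        facet c (rot τ) (Fin.insertNth (τ.symm 0) m (fun i => (w i : ℕ))) = 0 := by
      intro τ w
      apply ind2_false
      intro h
      obtain ⟨k, hk⟩ := h ((τ.symm 0 : Fin (n+1)) + 1) (by omega) (by omega)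
      obtain ⟨hA, hB⟩ := hle τ w m k le_rfl (by omega)
      exact h1 _ hA _ hB hk
    have down : ∀ (τ : Equiv.Perm (Fin (n+1))) (w : Fin n → Fin m), τ.symm 0 ≠ 0 →
        facet c (rot τ) (Fin.insertNth (τ.symm 0) 0 (fun i => (w i : ℕ))) = 0 := by
      intro τ w hne
      apply ind2_false
      intro h
      obtain ⟨k, hk⟩ := h 1 (by omega) (by omega)
      obtain ⟨hA, hB⟩ := hle τ w 0 k (by omega) (by omega)
      have := h0 _ hA _ hB
      have h3 : ((τ.symm 0 : Fin (n+1)) : ℕ) ≠ 0 := fun h => hne (Fin.ext h)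
      omega
    simp only [up, zero_add]
    rw [← Equiv.Perm.decomposeFin.symm.sum_comp, Fintype.sum_prod_type,
      Finset.sum_eq_single 0]
    · have hcons : ∀ (x : Fin n → ℕ), (∀ j, x j ≤ m) →
          ∀ j, (Fin.cons 0 x : Fin (n+1) → ℕ) j ≤ m := by
        intro x hx j
        refine Fin.cases ?_ (fun i => ?_) j
        · simp
        · simpa using hx i
      have IH := ih (fun x => c (Fin.cons 0 x) - 1) ?_ ?_ ?_
      · rw [← IH, Finset.sum_comm]
        refine Finset.sum_congr rfl fun w _ => Finset.sum_congr rfl fun e _ => ?_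
        set τ := Equiv.Perm.decomposeFin.symm ((0 : Fin (n+1)), e) with hτ
        have hτ0 : τ 0 = 0 := by simp [hτ]
        have hτs : ∀ i : Fin n, τ i.succ = (e i).succ := by simp [hτ]
        have hs0 : τ.symm 0 = 0 := by rw [Equiv.symm_apply_eq, hτ0]
        have hpt : ∀ k : Fin (n+1), kpt (Fin.insertNth (τ.symm 0) 0 (fun i => (w i : ℕ))) (rot τ) k
            = Fin.cons 0 (kpt (fun i => (w i : ℕ)) e k) := by
          intro k
          funext j
          refine Fin.cases ?_ (fun i => ?_) j
          · have := (hle τ w 0 k (by omega) (by omega)).2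
            rw [hs0] at this ⊢
            rw [this]; simp
          · have h3 := rot_ne τ i.succ (by rw [hτs]; exact Fin.succ_ne_zero _)
            rw [hτs, Fin.val_succ] at h3
            have h4 : ((rot τ i.succ : Fin (n+1)) : ℕ) = e i := by omega
            rw [hs0]
            simp [kpt, h4]
        unfold facet
        simp only [hpt]
        have hpos : ∀ k : Fin (n+1), 1 ≤ c (Fin.cons 0 (kpt (fun i => (w i : ℕ)) e k)) := by
          intro k
          have := hle τ w 0 k (by omega) (by omega)
          rw [hpt] at this
          have h5 := h0 _ this.1 0 (by simp)
          omega
        congr 1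
        apply propext
        constructor
        · intro h l hl
          obtain ⟨k, hk⟩ := h (l+1) (by omega) (by omega)
          exact ⟨k, by omega⟩
        · intro h l hl1 hl2
          obtain ⟨k, hk⟩ := h (l-1) (by omega)
          have := hpos k
          exact ⟨k, by omega⟩
      · intro x hx
        have := hc _ (hcons x hx)
        omega
      · intro x hx j hj
        have := h0 _ (hcons x hx) j.succ (by simpa using hj)
        simp at this
        omega
      · intro x hx j hj
        have := h1 _ (hcons x hx) j.succ (by simpa using hj)
        simp at this
        omega
    · intro p _ hp
      refine Finset.sum_eq_zero fun e _ => Finset.sum_eq_zero fun w _ => ?_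
      apply down
      intro h
      rw [Equiv.symm_apply_eq] at h
      simp at h
      exact hp h.symm
    · simp

theorem cube_aux {n : ℕ} {ι : Type*} [Finite ι]
    (Y : ι → Set (Fin n → ℝ))
    (hclosed : ∀ i, IsClosed (Y i))
    (hcover : ∀ p ∈ Set.Icc (0 : Fin n → ℝ) 1, ∃ i, p ∈ Y i)
    (hmult : ∀ p ∈ Set.Icc (0 : Fin n → ℝ) 1, {i | p ∈ Y i}.ncard ≤ n)
    (hno : ∀ i j, ∀ x ∈ Set.Icc (0 : Fin n → ℝ) 1, ∀ y ∈ Set.Icc (0 : Fin n → ℝ) 1,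
      x ∈ Y i → y ∈ Y i → x j = 0 → y j = 1 → False) : False := by
  classical
  let U : (Set.Icc (0 : Fin n → ℝ) 1) → Set (Fin n → ℝ) := fun p => ⋂ i ∈ {i | p.1 ∉ Y i}, (Y i)ᶜ
  have hU : ∀ p, IsOpen (U p) := fun p =>
    (Set.toFinite _).isOpen_biInter fun i _ => (hclosed i).isOpen_compl
  obtain ⟨δ, hδ, hL⟩ := lebesgue_number_lemma_of_metric (s := Set.Icc (0 : Fin n → ℝ) 1)
    isCompact_Icc hU (by
      intro p hp
      rw [Set.mem_iUnion]
      exact ⟨⟨p, hp⟩, by simp [U]⟩)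
  obtain ⟨m', hm'⟩ := exists_nat_one_div_lt hδ
  let m := m' + 1
  have hmpos : (0 : ℝ) < m := by positivity
  have hmδ : 1 / (m : ℝ) < δ := by simpa [m] using hm'
  let q : (Fin n → ℕ) → (Fin n → ℝ) := fun x j => (x j : ℝ) / m
  have hq : ∀ x, (∀ j, x j ≤ m) → q x ∈ Set.Icc (0 : Fin n → ℝ) 1 := by
    intro x hx
    refine ⟨fun j => by simp only [q, Pi.zero_apply]; positivity, fun j => ?_⟩
    simp only [q, Pi.one_apply]
    rw [div_le_one hmpos]
    exact_mod_cast hx j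
  have hcov' : ∀ x, ∃ i, (∀ j, x j ≤ m) → q x ∈ Y i := by
    intro x
    by_cases h : ∀ j, x j ≤ m
    · obtain ⟨i, hi⟩ := hcover _ (hq x h)
      exact ⟨i, fun _ => hi⟩
    · obtain ⟨i, hi⟩ := hcover 0 (by simp)
      exact ⟨i, fun h' => absurd h' h⟩
  choose f hf using hcov'
  let T : ι → Finset (Fin n) := fun i =>
    Finset.univ.filter fun j => ∃ x ∈ Set.Icc (0 : Fin n → ℝ) 1, x ∈ Y i ∧ x j = 0
  let lab : ι → ℕ := fun i => (T i).sup fun j => (j : ℕ) + 1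
  have hlab : ∀ i, lab i ≤ n := fun i => Finset.sup_le fun j _ => j.2
  have hlab2 : ∀ i (j : Fin n), lab i = j + 1 → j ∈ T i := by
    intro i j h
    have hne : (T i).Nonempty := by
      rw [Finset.nonempty_iff_ne_empty]
      intro h'
      simp [lab, h'] at h
    obtain ⟨j', hj', he⟩ := Finset.exists_mem_eq_sup (T i) hne (fun j => (j : ℕ) + 1)
    have : j' = j := by
      apply Fin.ext
      change lab i = _ at he
      omega
    rwa [← this]
  have K := kuhn n m (fun x => lab (f x)) (by omega) (fun x _ => hlab _)
    (by
      intro x hx j hj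
      refine Finset.le_sup (f := fun j : Fin n => (j : ℕ) + 1) ?_
      simp only [T, Finset.mem_filter, Finset.mem_univ, true_and]
      exact ⟨q x, hq x hx, hf x hx, by simp [q, hj]⟩)
    (by
      intro x hx j hj h
      have := hlab2 _ _ h
      simp only [T, Finset.mem_filter, Finset.mem_univ, true_and] at this
      obtain ⟨y, hy, hyY, hy0⟩ := this
      refine hno _ j y hy (q x) (hq x hx) hyY (hf x hx) hy0 ?_
      simp only [q, hj]
      exact div_self hmpos.ne')
  have hex : ∃ (v : Fin n → Fin m) (τ : Equiv.Perm (Fin n)),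
      ∀ l, l ≤ n → ∃ k : Fin (n+1), lab (f (kpt (fun i => (v i : ℕ)) τ k)) = l := by
    by_contra hcon
    push Not at hcon
    rw [Finset.sum_eq_zero] at K
    · exact zero_ne_one K
    · intro v _
      refine Finset.sum_eq_zero fun τ _ => ind2_false ?_
      intro h
      obtain ⟨l, hl, h'⟩ := hcon v τ
      obtain ⟨k, hk⟩ := h l hl
      exact h' k hk
  obtain ⟨v, τ, h⟩ := hex
  have hin : ∀ k : ℕ, ∀ j, kpt (fun i => (v i : ℕ)) τ k j ≤ m := by
    intro k j
    have := (v j).2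
    simp only [kpt]
    split_ifs <;> omega
  obtain ⟨p, hp⟩ := hL _ (hq _ (hin 0))
  have hmem : ∀ k : ℕ, p.1 ∈ Y (f (kpt (fun i => (v i : ℕ)) τ k)) := by
    intro k
    have hb : q (kpt (fun i => (v i : ℕ)) τ k) ∈ U p := by
      apply hp
      rw [Metric.mem_ball]
      refine lt_of_le_of_lt ?_ hmδ
      rw [dist_pi_le_iff (by positivity)]
      intro j
      simp only [q, kpt]
      rw [Real.dist_eq, ← sub_div, abs_div, abs_of_pos hmpos]
      gcongr
      simp
      split_ifs <;> simp
    by_contra hcon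
    simp only [U, Set.mem_iInter] at hb
    exact hb _ hcon (hf _ (hin k))
  choose! g hg using h
  have hM := hmult p.1 p.2
  have : (Finset.range (n+1)).card ≤ {i | p.1 ∈ Y i}.ncard := by
    rw [← Set.ncard_coe_finset]
    refine Set.ncard_le_ncard_of_injOn
      (fun l => f (kpt (fun i => (v i : ℕ)) τ (g l))) ?_ ?_ (Set.toFinite _)
    · intro l hl
      exact hmem _
    · intro a ha b hb hab
      simp at ha hb
      rw [← hg a (by omega), ← hg b (by omega)]
      exact congrArg lab hab
  simp at this
  omega

/-- **Lebesgue's theorem.** If the unit cube `[0,1]^n` (with `n ≥ 1`) is covered by a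
finite family of closed sets with covering multiplicity at most `n`, then one of the
sets intersects two opposite facets of the cube. -/
theorem lebesgue_cube {n : ℕ} (hn : 1 ≤ n) {ι : Type*} [Finite ι]
    (X : ι → Set (EuclideanSpace ℝ (Fin n)))
    (hclosed : ∀ i, IsClosed (X i))
    (hcover : Cube n ⊆ ⋃ i, X i)
    (hmult : ∀ p ∈ Cube n, {i | p ∈ X i}.ncard ≤ n) :
    ∃ (i : ι) (j : Fin n),
      (X i ∩ {x ∈ Cube n | x j = 0}).Nonempty ∧
      (X i ∩ {x ∈ Cube n | x j = 1}).Nonempty := by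
  by_contra hcon
  push Not at hcon
  have hC : ∀ p : Fin n → ℝ, p ∈ Set.Icc (0 : Fin n → ℝ) 1 → WithLp.toLp 2 p ∈ Cube n := by
    intro p hp j
    exact ⟨hp.1 j, hp.2 j⟩
  refine cube_aux (fun i => {p | WithLp.toLp 2 p ∈ X i}) ?_ ?_ ?_ ?_
  · intro i
    exact (hclosed i).preimage (PiLp.continuous_toLp 2 _)
  · intro p hp
    have h := hcover (hC p hp)
    rw [Set.mem_iUnion] at h
    exact h
  · intro p hp
    exact hmult _ (hC p hp)
  · intro i j x hx y hy hxi hyi hx0 hy1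
    have h := hcon i j ⟨_, hxi, hC x hx, hx0⟩
    have hmem : WithLp.toLp 2 y ∈ X i ∩ {x ∈ Cube n | x j = 1} := ⟨hyi, hC y hy, hy1⟩
    rw [h] at hmem
    exact hmem
end

section
/- Let p_0, p_1, …, p_n be affinely independent points of ℝ^n and let Δ^n be their convex hull (a non-degenerate n-simplex). If Δ^n is covered by a finite family {F_i}_{i∈I} of closed sets with covering multiplicity at most n, then some F_i intersects all n+1 facets of Δ^n. -/
open Set

/-- `S` dominates: no point beats the minimum of `S` in every ordering. -/
def ScDom {X I : Type*} (u : I → X → ℕ) (S : Finset X) : Prop :=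
  ∀ y, ∃ i, ∀ x ∈ S, u i y ≤ u i x

lemma door_two {X I : Type*} [Fintype X] [DecidableEq X] [Fintype I] [DecidableEq I]
    (u : I → X → ℕ) (hu : ∀ i, Function.Injective (u i)) (τ : Finset X)
    (hcard : τ.card + 1 = Fintype.card I) (hne : τ.Nonempty) (hD : ScDom u τ)
    (hM : ∀ k, ∃ y, ∀ l, l ≠ k → ∃ x ∈ τ, u l x < u l y) :
    ∃ a b, a ≠ b ∧ ∀ x, (x ∉ τ ∧ ScDom u (insert x τ)) ↔ (x = a ∨ x = b) := by
  have hm0 : ∀ i, ∃ x ∈ τ, ∀ z ∈ τ, u i x ≤ u i z := fun i =>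
    Finset.exists_min_image τ (u i) hne
  choose m hmτ hmin using hm0
  have hmuniq : ∀ i, ∀ y ∈ τ, (∀ z ∈ τ, u i y ≤ u i z) → m i = y := fun i y hy h =>
    hu i (le_antisymm (hmin i y hy) (h _ (hmτ i)))
  have hsurj : ∀ y ∈ τ, ∃ i, m i = y := by
    intro y hy
    obtain ⟨i, hi⟩ := hD y
    exact ⟨i, hmuniq i y hy hi⟩
  obtain ⟨i, -, j, -, hij, hmij⟩ : ∃ i ∈ (Finset.univ : Finset I), ∃ j ∈ (Finset.univ : Finset I),
      i ≠ j ∧ m i = m j :=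
    Finset.exists_ne_map_eq_of_card_lt_of_maps_to (t := τ)
      (by rw [Finset.card_univ]; omega) (fun i _ => hmτ i)
  have huniq : ∀ l, l ≠ i → l ≠ j → ∀ l', m l' = m l → l' = l := by
    intro l hli hlj l' hl'
    by_contra hne'
    have hsub : τ ⊆ ((Finset.univ.erase i).erase l).image m := by
      intro y hy
      obtain ⟨k, rfl⟩ := hsurj y hy
      simp only [Finset.mem_image, Finset.mem_erase, Finset.mem_univ, and_true]
      by_cases hki : k = i
      · exact ⟨j, ⟨fun h => hlj h.symm, hij.symm⟩, by rw [hki, hmij]⟩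
      · by_cases hkl : k = l
        · by_cases hl'i : l' = i
          · exact ⟨j, ⟨fun h => hlj h.symm, hij.symm⟩, by rw [hkl, ← hl', hl'i, hmij]⟩
          · exact ⟨l', ⟨hne', hl'i⟩, by rw [hkl, hl']⟩
        · exact ⟨k, ⟨hkl, hki⟩, rfl⟩
    have h1 := (Finset.card_le_card hsub).trans Finset.card_image_le
    rw [Finset.card_erase_of_mem (by simp [hli]), Finset.card_erase_of_mem (by simp),
      Finset.card_univ] at h1
    have : 0 < τ.card := hne.card_pos
    omega
  have key : ∀ i j, i ≠ j → m i = m j → ∃ a, a ∉ τ ∧ ScDom u (insert a τ) ∧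
      (∀ l, l ≠ i → u l (m l) < u l a) ∧
      ∀ x, ScDom u (insert x τ) → (∀ l, l ≠ i → u l (m l) < u l x) → x = a := by
    intro i j hij hmij
    obtain ⟨y0, hy0⟩ := hM i
    obtain ⟨a, ha, hmax⟩ := Finset.exists_max_image
      (Finset.univ.filter fun y => ∀ l, l ≠ i → u l (m l) < u l y) (u i)
      ⟨y0, by
        simp only [Finset.mem_filter, Finset.mem_univ, true_and]
        intro l hl
        obtain ⟨x, hx, h⟩ := hy0 l hl
        exact (hmin l x hx).trans_lt h⟩
    simp only [Finset.mem_filter, Finset.mem_univ, true_and] at ha hmax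
    refine ⟨a, ?_, ?_, ha, ?_⟩
    · intro haτ
      obtain ⟨l, hl⟩ := hsurj a haτ
      by_cases hli : l = i
      · have := ha j hij.symm
        rw [← hmij, ← hli, hl] at this
        exact lt_irrefl _ this
      · have := ha l hli
        rw [hl] at this
        exact lt_irrefl _ this
    · intro y
      by_cases hy : ∀ l, l ≠ i → u l (m l) < u l y
      · refine ⟨i, ?_⟩
        obtain ⟨k, hk⟩ := hD y
        have hki : k = i := by
          by_contra hki
          exact absurd (hk _ (hmτ k)) (not_le.mpr (hy k hki))
        subst hki
        intro x hx
        rcases Finset.mem_insert.mp hx with rfl | hx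
        · exact hmax y hy
        · exact hk x hx
      · push Not at hy
        obtain ⟨k, hki, hk⟩ := hy
        refine ⟨k, fun x hx => hk.trans ?_⟩
        rcases Finset.mem_insert.mp hx with rfl | hx
        · exact (ha k hki).le
        · exact hmin k x hx
    · intro x hx hxM
      apply hu i
      apply le_antisymm (hmax x hxM)
      obtain ⟨k, hk⟩ := hx a
      have hki : k = i := by
        by_contra hki
        exact absurd (hk _ (Finset.mem_insert_of_mem (hmτ k))) (not_le.mpr (ha k hki))
      subst hki
      exact hk x (Finset.mem_insert_self _ _)
  obtain ⟨a, haτ, haD, haM, hau⟩ := key i j hij hmij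
  obtain ⟨b, hbτ, hbD, hbM, hbu⟩ := key j i hij.symm hmij.symm
  refine ⟨a, b, ?_, ?_⟩
  · rintro rfl
    obtain ⟨k, hk⟩ := hD a
    have hk' := hk _ (hmτ k)
    by_cases hki : k = i
    · exact absurd hk' (not_le.mpr (hbM k (hki ▸ hij)))
    · exact absurd hk' (not_le.mpr (haM k hki))
  · intro x
    constructor
    · rintro ⟨hxτ, hxD⟩
      have hxne : ∀ l, u l x ≠ u l (m l) := fun l h => hxτ (hu l h ▸ hmτ l)
      have hmem : ∀ y ∈ τ, ∃ k, m k = y ∧ u k (m k) < u k x := by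
        intro y hy
        obtain ⟨k, hk⟩ := hxD y
        have h1 := hmuniq k y hy fun z hz => hk z (Finset.mem_insert_of_mem hz)
        refine ⟨k, h1, lt_of_le_of_ne ?_ (hxne k).symm⟩
        rw [h1]
        exact hk x (Finset.mem_insert_self _ _)
      have hB : ∀ l, l ≠ i → l ≠ j → u l (m l) < u l x := by
        intro l hli hlj
        obtain ⟨k, hk, hlt⟩ := hmem (m l) (hmτ l)
        rw [huniq l hli hlj k hk] at hlt
        exact hlt
      obtain ⟨k, hk, hlt⟩ := hmem (m i) (hmτ i)
      have hkij : k = i ∨ k = j := by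
        by_contra h
        push Not at h
        exact h.1 (huniq k h.1 h.2 i hk.symm).symm
      rcases hkij with rfl | rfl
      · right
        apply hbu x hxD
        intro l hl
        by_cases hlk : l = k
        · rw [hlk]; exact hlt
        · exact hB l hlk hl
      · left
        apply hau x hxD
        intro l hl
        by_cases hlk : l = k
        · rw [hlk]; exact hlt
        · exact hB l hl hlk
    · rintro (rfl | rfl)
      · exact ⟨haτ, haD⟩
      · exact ⟨hbτ, hbD⟩

lemma ScDom.mono {X I : Type*} {u : I → X → ℕ} {S S' : Finset X} (h : S' ⊆ S)
    (hS : ScDom u S) : ScDom u S' := fun y => by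
  obtain ⟨i, hi⟩ := hS y
  exact ⟨i, fun x hx => hi x (h hx)⟩

lemma scarf_inj {T I : Type*} [Fintype T] [DecidableEq T] [Fintype I] [DecidableEq I]
    [Nonempty T] (w : I → T → ℕ) (hw : ∀ i, Function.Injective (w i)) (c : T → I) :
    ∃ σ : Finset T, ∀ y, ∃ z ∈ σ, ∀ x ∈ σ, w (c z) y ≤ w (c z) x := by
  classical
  obtain ⟨B, hB⟩ : ∃ B : ℕ, ∀ i t, w i t + 1 < B := by
    refine ⟨∑ i, ∑ t, w i t + 2, fun i t => ?_⟩
    have h1 : w i t ≤ ∑ t, w i t :=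
      Finset.single_le_sum (f := fun t => w i t) (fun _ _ => Nat.zero_le _) (Finset.mem_univ t)
    have h2 : ∑ t, w i t ≤ ∑ i, ∑ t, w i t :=
      Finset.single_le_sum (f := fun i => ∑ t, w i t) (fun _ _ => Nat.zero_le _)
        (Finset.mem_univ i)
    omega
  let e := Fintype.equivFin I
  let u : I → T ⊕ I → ℕ := fun i =>
    Sum.elim (fun t => w i t + 1) (fun j => if j = i then 0 else B + (e j : ℕ))
  have ul : ∀ i t, u i (Sum.inl t) = w i t + 1 := fun i t => rfl
  have urs : ∀ i, u i (Sum.inr i) = 0 := fun i => by simp [u]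
  have urn : ∀ i j, j ≠ i → u i (Sum.inr j) = B + (e j : ℕ) := fun i j h => by simp [u, h]
  have ulr : ∀ i j t, j ≠ i → u i (Sum.inl t) < u i (Sum.inr j) := fun i j t h => by
    rw [ul, urn i j h]; have := hB i t; omega
  have hu : ∀ i, Function.Injective (u i) := by
    rintro i (t | j) (t' | j') h
    · rw [ul, ul] at h
      rw [hw i (Nat.succ_injective h)]
    · exfalso
      by_cases hj : j' = i
      · rw [hj, ul, urs] at h; omega
      · exact absurd h (ulr i j' t hj).ne
    · exfalso
      by_cases hj : j = i
      · rw [hj, ul, urs] at h; omega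
      · exact absurd h (ulr i j t' hj).ne'
    · by_cases hj : j = i <;> by_cases hj' : j' = i
      · rw [hj, hj']
      · rw [hj, urs, urn i j' hj'] at h
        have := hB i (Classical.arbitrary T); omega
      · rw [hj', urs, urn i j hj] at h
        have := hB i (Classical.arbitrary T); omega
      · rw [urn i j hj, urn i j' hj'] at h
        have : e j = e j' := Fin.ext (by omega)
        rw [e.injective this]
  let col : T ⊕ I → I := Sum.elim c id
  -- it suffices to find a colourful dominating set
  suffices hS : ∃ S : Finset (T ⊕ I), ScDom u S ∧ S.image col = Finset.univ by
    obtain ⟨S, hSD, hSc⟩ := hS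
    refine ⟨Finset.univ.filter fun t => Sum.inl t ∈ S, fun y => ?_⟩
    obtain ⟨i, hi⟩ := hSD (Sum.inl y)
    have hi' : i ∈ S.image col := hSc ▸ Finset.mem_univ i
    obtain ⟨x, hxS, hx⟩ := Finset.mem_image.mp hi'
    rcases x with z | k
    · refine ⟨z, by simpa using hxS, fun x hx' => ?_⟩
      have hz : c z = i := hx
      have h1 := hi (Sum.inl x) (by simpa using hx')
      rw [ul, ul] at h1
      rw [hz]; omega
    · have hk : k = i := hx
      have h1 := hi _ hxS
      rw [hk, urs, ul] at h1
      omega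
  by_contra hno
  push Not at hno
  obtain ⟨i0⟩ : Nonempty I := ⟨c (Classical.arbitrary T)⟩
  let P : Finset (Finset (T ⊕ I) × (T ⊕ I)) := Finset.univ.filter fun q =>
    q.1.card + 1 = Fintype.card I ∧ q.1.image col = Finset.univ.erase i0 ∧
      q.2 ∉ q.1 ∧ ScDom u (insert q.2 q.1)
  have memP : ∀ τ x, (τ, x) ∈ P ↔ (τ.card + 1 = Fintype.card I ∧
      τ.image col = Finset.univ.erase i0 ∧ x ∉ τ ∧ ScDom u (insert x τ)) := by
    intro τ x; simp [P]
  have hcolinj : ∀ τ : Finset (T ⊕ I), τ.card + 1 = Fintype.card I →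
      τ.image col = Finset.univ.erase i0 → Set.InjOn col τ := by
    intro τ h1 h2
    apply Finset.card_image_iff.mp
    rw [h2, Finset.card_erase_of_mem (Finset.mem_univ _), Finset.card_univ]
    omega
  -- counting by rooms
  have even1 : Even P.card := by
    rw [Finset.card_eq_sum_card_fiberwise (f := fun q => insert q.2 q.1) (t := Finset.univ)
      (fun _ _ => Finset.mem_coe.mpr (Finset.mem_univ _))]
    apply Finset.even_sum
    intro S _
    rcases (P.filter fun q => insert q.2 q.1 = S).eq_empty_or_nonempty with h | ⟨⟨τ, x⟩, hq⟩
    · simp [h]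
    · obtain ⟨hqP, hqS⟩ := Finset.mem_filter.mp hq
      obtain ⟨hc, hcol, hxτ, hdom⟩ := (memP τ x).mp hqP
      simp only at hqS
      have hx0 : col x ≠ i0 := by
        intro h
        apply hno _ hdom
        rw [Finset.image_insert, hcol, h]
        exact Finset.insert_erase (Finset.mem_univ _)
      have : col x ∈ τ.image col := by rw [hcol]; simp [hx0]
      obtain ⟨x', hx'τ, hx'⟩ := Finset.mem_image.mp this
      have hxx' : x ≠ x' := fun h => hxτ (h ▸ hx'τ)
      have hfib : (P.filter fun q => insert q.2 q.1 = S) = {(τ, x), (S.erase x', x')} := by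
        ext ⟨τ', x''⟩
        simp only [Finset.mem_filter, Finset.mem_insert, Finset.mem_singleton, Prod.mk.injEq]
        constructor
        · rintro ⟨h1, h2⟩
          obtain ⟨hc', hcol', hxτ', -⟩ := (memP _ _).mp h1
          have hτ' : τ' = S.erase x'' := by rw [← h2, Finset.erase_insert hxτ']
          by_cases ha : x'' = x
          · left
            refine ⟨?_, ha⟩
            rw [hτ', ha, ← hqS, Finset.erase_insert hxτ]
          · by_cases hb : x'' = x'
            · right; exact ⟨hb ▸ hτ', hb⟩
            · exfalso
              apply hxx'
              apply hcolinj τ' hc' hcol' _ _ hx'.symm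
              · rw [hτ', ← hqS]; simp [Ne.symm ha]
              · rw [hτ', ← hqS]; simp [Ne.symm hb, hx'τ]
        · rintro (⟨rfl, rfl⟩ | ⟨rfl, rfl⟩)
          · exact ⟨hqP, hqS⟩
          · have hx''S : x'' ∈ S := by rw [← hqS]; simp [hx'τ]
            have hins : insert x'' (S.erase x'') = S := Finset.insert_erase hx''S
            refine ⟨(memP _ _).mpr ⟨?_, ?_, ?_, ?_⟩, hins⟩
            · rw [Finset.card_erase_of_mem hx''S, ← hqS, Finset.card_insert_of_notMem hxτ]
              omega
            · rw [← hcol, ← hqS]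
              ext k
              simp only [Finset.mem_image, Finset.mem_erase, Finset.mem_insert]
              constructor
              · rintro ⟨z, ⟨hz1, rfl | hz2⟩, rfl⟩
                · exact ⟨x'', hx'τ, hx'⟩
                · exact ⟨z, hz2, rfl⟩
              · rintro ⟨z, hz, rfl⟩
                by_cases hzx : z = x''
                · exact ⟨x, ⟨hxx', Or.inl rfl⟩, by rw [hzx, hx']⟩
                · exact ⟨z, ⟨hzx, Or.inr hz⟩, rfl⟩
            · simp
            · rw [hins, ← hqS]; exact hdom
      rw [hfib, Finset.card_pair]
      · exact even_two
      · intro h; exact hxx' (Prod.ext_iff.mp h).2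
  -- the outer door
  let τ0 : Finset (T ⊕ I) := (Finset.univ.erase i0).image Sum.inr
  have memτ0 : ∀ k, Sum.inr k ∈ τ0 ↔ k ≠ i0 := by intro k; simp [τ0]
  have memτ0' : ∀ t, Sum.inl t ∉ τ0 := by intro k; simp [τ0]
  obtain ⟨tm, -, htm⟩ := Finset.exists_max_image (Finset.univ : Finset T) (w i0)
    Finset.univ_nonempty
  have hfib0 : ∀ x, (τ0, x) ∈ P ↔ x = Sum.inl tm := by
    intro x
    rw [memP]
    constructor
    · rintro ⟨-, -, hx, hdom⟩
      rcases x with t | k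
      · obtain ⟨i, hi⟩ := hdom (Sum.inl tm)
        have hii : i = i0 := by
          by_contra hii
          have := hi (Sum.inr i) (Finset.mem_insert_of_mem ((memτ0 i).mpr hii))
          rw [ul, urs] at this
          omega
        have h1 := hi _ (Finset.mem_insert_self _ _)
        rw [ul, ul, hii] at h1
        have h2 := htm t (Finset.mem_univ _)
        rw [hw i0 (le_antisymm h2 (by omega))]
      · exfalso
        have hk : k = i0 := by
          by_contra h; exact hx ((memτ0 k).mpr h)
        obtain ⟨i, hi⟩ := hdom (Sum.inl tm)
        have := hi (Sum.inr i) (by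
          by_cases h : i = i0
          · rw [h, hk]; exact Finset.mem_insert_self _ _
          · exact Finset.mem_insert_of_mem ((memτ0 i).mpr h))
        rw [ul, urs] at this
        omega
    · rintro rfl
      refine ⟨?_, ?_, memτ0' tm, ?_⟩
      · rw [Finset.card_image_of_injective _ Sum.inr_injective,
          Finset.card_erase_of_mem (Finset.mem_univ _), Finset.card_univ]
        have : 0 < Fintype.card I := Fintype.card_pos_iff.mpr ⟨i0⟩
        omega
      · rw [Finset.image_image]
        exact Finset.image_id
      · rintro (t | k)
        · refine ⟨i0, fun x hx => ?_⟩
          rcases Finset.mem_insert.mp hx with rfl | hx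
          · rw [ul, ul]; have := htm t (Finset.mem_univ _); omega
          · rcases x with t' | k
            · exact absurd hx (memτ0' t')
            · exact (ulr i0 k t ((memτ0 k).mp hx)).le
        · exact ⟨k, fun x _ => by rw [urs]; exact Nat.zero_le _⟩
  have even2 : Even (P.erase (τ0, Sum.inl tm)).card := by
    rw [Finset.card_eq_sum_card_fiberwise (f := fun q => q.1) (t := Finset.univ)
      (fun _ _ => Finset.mem_coe.mpr (Finset.mem_univ _))]
    apply Finset.even_sum
    intro τ _
    rcases ((P.erase (τ0, Sum.inl tm)).filter fun q => q.1 = τ).eq_empty_or_nonempty with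
      h | ⟨⟨τ', x⟩, hq⟩
    · simp [h]
    · simp only [Finset.mem_filter, Finset.mem_erase] at hq
      obtain ⟨⟨hq0, hqP⟩, rfl⟩ := hq
      have hne0 : τ' ≠ τ0 := by
        rintro rfl
        exact hq0 (by rw [(hfib0 x).mp hqP])
      obtain ⟨hc, hcol, hxτ, hdom⟩ := (memP τ' x).mp hqP
      obtain ⟨t, ht⟩ : ∃ t, Sum.inl t ∈ τ' := by
        by_contra hnt
        push Not at hnt
        apply hne0
        ext z
        rcases z with t | k
        · simp [hnt t, memτ0' t]
        · rw [memτ0]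
          have : k ∈ τ'.image col ↔ k ≠ i0 := by rw [hcol]; simp
          rw [← this, Finset.mem_image]
          constructor
          · intro h; exact ⟨_, h, rfl⟩
          · rintro ⟨z, hz, hzk⟩
            rcases z with t | k'
            · exact absurd hz (hnt t)
            · have : k' = k := hzk
              rw [← this]; exact hz
      obtain ⟨a, b, hab, hiff⟩ := door_two u hu τ' hc ⟨_, ht⟩
        (hdom.mono (Finset.subset_insert _ _))
        (fun k => ⟨Sum.inr k, fun l hl => ⟨Sum.inl t, ht, ulr l k t hl.symm⟩⟩)
      have hfib : ((P.erase (τ0, Sum.inl tm)).filter fun q => q.1 = τ') = {(τ', a), (τ', b)} := by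
        ext ⟨τ'', y⟩
        simp only [Finset.mem_filter, Finset.mem_erase, Finset.mem_insert, Finset.mem_singleton,
          Prod.mk.injEq, memP]
        constructor
        · rintro ⟨⟨-, -, -, h1, h2⟩, rfl⟩
          rcases (hiff y).mp ⟨h1, h2⟩ with h | h
          · exact Or.inl ⟨rfl, h⟩
          · exact Or.inr ⟨rfl, h⟩
        · intro h
          have h1 : τ'' = τ' := by rcases h with h | h <;> exact h.1
          have h2 : y = a ∨ y = b := by
            rcases h with h | h
            · exact Or.inl h.2
            · exact Or.inr h.2
          subst h1
          exact ⟨⟨Ne.symm (by simpa [Prod.ext_iff] using fun h => absurd h.symm hne0),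
            hc, hcol, (hiff y).mpr h2⟩, rfl⟩
      rw [hfib, Finset.card_pair]
      · exact even_two
      · intro h; exact hab (Prod.ext_iff.mp h).2
  have hmem : (τ0, Sum.inl tm) ∈ P := (hfib0 _).mpr rfl
  have := Finset.card_erase_add_one hmem
  rw [← this] at even1
  exact absurd even1 (by simpa [Nat.even_add_one] using even2)

lemma scarf {T I : Type*} [Fintype T] [Fintype I]
    [Nonempty T] (v : I → T → ℕ) (c : T → I) :
    ∃ σ : Finset T, ∀ y, ∃ z ∈ σ, ∀ x ∈ σ, v (c z) y ≤ v (c z) x := by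
  classical
  let e := Fintype.equivFin T
  have hlt : ∀ i x y, v i x * Fintype.card T + (e x : ℕ) ≤ v i y * Fintype.card T + (e y : ℕ) →
      v i x ≤ v i y := by
    intro i x y h
    by_contra hlt
    push Not at hlt
    have h1 : (v i y + 1) * Fintype.card T ≤ v i x * Fintype.card T := Nat.mul_le_mul_right _ hlt
    have := (e y).isLt
    rw [add_mul] at h1
    omega
  obtain ⟨σ, hσ⟩ := scarf_inj (fun i t => v i t * Fintype.card T + (e t : ℕ)) (by
    intro i x y h
    simp only at h
    have h1 := le_antisymm (hlt i x y h.le) (hlt i y x h.ge)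
    rw [h1] at h
    exact e.injective (Fin.ext (by omega))) c
  refine ⟨σ, fun y => ?_⟩
  obtain ⟨z, hz, h⟩ := hσ y
  exact ⟨z, hz, fun x hx => hlt _ _ _ (h x hx)⟩

lemma grid_scarf {I : Type*} [Fintype I] [Nonempty I] (N : ℕ) (c : (I → ℕ) → I) :
    ∃ σ : Finset (I → ℕ), σ.Nonempty ∧ (∀ x ∈ σ, ∑ i, x i = N) ∧
      (∀ x ∈ σ, ∀ y ∈ σ, ∀ i, x i ≤ y i + Fintype.card I) ∧
      ∀ i, (∃ z ∈ σ, c z = i) ∨ ∀ x ∈ σ, x i ≤ Fintype.card I := by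
  classical
  let T := {x : I → ℕ // x ∈ Finset.piAntidiag Finset.univ N}
  have hT : ∀ x : I → ℕ, x ∈ Finset.piAntidiag Finset.univ N ↔ ∑ i, x i = N := by
    intro x; simp [Finset.mem_piAntidiag]
  obtain ⟨j0⟩ := ‹Nonempty I›
  have : Fintype T := Finset.fintypeCoeSort _
  have : Nonempty T := ⟨⟨Pi.single j0 N, by rw [hT]; simp⟩⟩
  obtain ⟨σ, hσ⟩ := scarf (T := T) (fun i x => x.1 i) (fun x => c x.1)
  have hσne : σ.Nonempty := by
    obtain ⟨z, hz, -⟩ := hσ (Classical.arbitrary T)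
    exact ⟨z, hz⟩
  let C : Finset I := σ.image fun x => c x.1
  have hCne : C.Nonempty := hσne.image _
  have hm0 : ∀ i, ∃ x ∈ σ, ∀ z ∈ σ, x.1 i ≤ z.1 i := fun i =>
    Finset.exists_min_image σ (fun x => x.1 i) hσne
  choose m hmσ hmin using hm0
  let μ : I → ℕ := fun i => (m i).1 i
  have hsum : N < ∑ i ∈ C, (μ i + 1) := by
    by_contra hle
    push Not at hle
    obtain ⟨k, hk⟩ := hCne
    let y : I → ℕ := fun i => (if i ∈ C then μ i + 1 else 0) +
      Pi.single (M := fun _ => ℕ) k (N - ∑ i ∈ C, (μ i + 1)) i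
    have hy : ∑ i, y i = N := by
      simp only [y, Finset.sum_add_distrib, Finset.sum_ite_mem, Finset.univ_inter,
        Finset.sum_pi_single', Finset.mem_univ, if_true]
      simp only [Finset.sum_add_distrib] at hle
      omega
    obtain ⟨z, hz, h⟩ := hσ ⟨y, (hT y).mpr hy⟩
    have hzC : c z.1 ∈ C := Finset.mem_image_of_mem (fun x : T => c x.1) hz
    have h1 := h _ (hmσ (c z.1))
    simp only [y, hzC, if_true, μ] at h1
    omega
  rw [Finset.sum_add_distrib, Finset.sum_const, smul_eq_mul, mul_one] at hsum
  have hCcard : C.card ≤ Fintype.card I := Finset.card_le_univ C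
  have hsplit : ∀ x ∈ σ, ∑ i ∈ C, x.1 i + ∑ i ∈ Cᶜ, x.1 i = N := by
    intro x _
    rw [Finset.sum_add_sum_compl]; exact (hT _).mp x.2
  have hbig : ∀ x ∈ σ, ∀ i ∈ C, x.1 i ≤ μ i + Fintype.card I := by
    intro x hx i hi
    have h1 := hsplit x hx
    rw [← Finset.add_sum_erase C _ hi] at h1
    rw [← Finset.add_sum_erase C _ hi] at hsum
    have h2 : ∑ i ∈ C.erase i, μ i ≤ ∑ i ∈ C.erase i, x.1 i :=
      Finset.sum_le_sum fun k _ => hmin k x hx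
    omega
  have hsmall : ∀ x ∈ σ, ∀ i, i ∉ C → x.1 i ≤ Fintype.card I := by
    intro x hx i hi
    have h1 := hsplit x hx
    have h2 : ∑ i ∈ C, μ i ≤ ∑ i ∈ C, x.1 i := Finset.sum_le_sum fun k _ => hmin k x hx
    have h3 : x.1 i ≤ ∑ i ∈ Cᶜ, x.1 i :=
      Finset.single_le_sum (f := fun i => x.1 i) (fun _ _ => Nat.zero_le _)
        (Finset.mem_compl.mpr hi)
    omega
  refine ⟨σ.image Subtype.val, hσne.image _, ?_, ?_, ?_⟩
  · intro x hx
    obtain ⟨x, hx', rfl⟩ := Finset.mem_image.mp hx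
    exact (hT _).mp x.2
  · intro x hx y hy i
    obtain ⟨x, hx', rfl⟩ := Finset.mem_image.mp hx
    obtain ⟨y, hy', rfl⟩ := Finset.mem_image.mp hy
    by_cases hi : i ∈ C
    · exact (hbig x hx' i hi).trans (Nat.add_le_add_right (hmin i y hy') _)
    · exact (hsmall x hx' i hi).trans (Nat.le_add_left _ _)
  · intro i
    by_cases hi : i ∈ C
    · left
      obtain ⟨z, hz, h⟩ := Finset.mem_image.mp hi
      exact ⟨z.1, Finset.mem_image_of_mem _ hz, h⟩
    · right
      intro x hx
      obtain ⟨x, hx', rfl⟩ := Finset.mem_image.mp hx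
      exact hsmall x hx' i hi

lemma brouwer_approx {I : Type*} [Fintype I] [Nonempty I] (f : (I → ℝ) → (I → ℝ))
    (hmaps : ∀ x ∈ stdSimplex ℝ I, f x ∈ stdSimplex ℝ I) (N : ℕ) :
    ∃ x ∈ stdSimplex ℝ I, ∀ i,
      (∃ z ∈ stdSimplex ℝ I, (∀ k, |z k - x k| ≤ (Fintype.card I : ℝ) / ((N : ℝ) + 1)) ∧
        z i ≤ f z i) ∨ x i ≤ (Fintype.card I : ℝ) / ((N : ℝ) + 1) := by
  classical
  have hN : (0 : ℝ) < (N : ℝ) + 1 := by positivity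
  let s : (I → ℕ) → (I → ℝ) := fun g i => (g i : ℝ) / ((N : ℝ) + 1)
  have hs : ∀ g : I → ℕ, ∑ i, g i = N + 1 → s g ∈ stdSimplex ℝ I := by
    intro g hg
    refine ⟨fun i => by positivity, ?_⟩
    simp only [s]
    rw [← Finset.sum_div, ← Nat.cast_sum, hg]
    push_cast
    exact div_self hN.ne'
  have hex : ∀ g : I → ℕ, ∃ i, ∑ i, g i = N + 1 → s g i ≤ f (s g) i := by
    intro g
    by_cases hg : ∑ i, g i = N + 1
    · have h1 := (hs g hg).2
      have h2 := (hmaps _ (hs g hg)).2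
      obtain ⟨i, -, hi⟩ := Finset.exists_le_of_sum_le (s := Finset.univ) Finset.univ_nonempty
        (h1.trans h2.symm).le
      exact ⟨i, fun _ => hi⟩
    · exact ⟨Classical.arbitrary I, fun h => absurd h hg⟩
  choose c hc using hex
  obtain ⟨σ, ⟨x, hx⟩, hsum, hclose, hor⟩ := grid_scarf (N + 1) c
  refine ⟨s x, hs x (hsum x hx), fun i => ?_⟩
  rcases hor i with ⟨z, hz, rfl⟩ | h
  · left
    refine ⟨s z, hs z (hsum z hz), fun k => ?_, hc z (hsum z hz)⟩
    simp only [s]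
    rw [← sub_div, abs_div, abs_of_pos hN]
    apply div_le_div_of_nonneg_right _ hN.le
    have h1 : (z k : ℝ) ≤ x k + Fintype.card I := by exact_mod_cast hclose z hz x hx k
    have h2 : (x k : ℝ) ≤ z k + Fintype.card I := by exact_mod_cast hclose x hx z hz k
    rw [abs_le]
    constructor <;> linarith
  · right
    apply div_le_div_of_nonneg_right _ hN.le
    exact_mod_cast h x hx

lemma brouwer_simplex {I : Type*} [Fintype I] [Nonempty I] (f : (I → ℝ) → (I → ℝ))
    (hf : ContinuousOn f (stdSimplex ℝ I))
    (hmaps : ∀ x ∈ stdSimplex ℝ I, f x ∈ stdSimplex ℝ I) :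
    ∃ x ∈ stdSimplex ℝ I, f x = x := by
  choose x hx hxi using brouwer_approx f hmaps
  let U := Filter.hyperfilter ℕ
  have hU : (U : Filter ℕ) ≤ Filter.atTop := by
    rw [← Nat.cofinite_eq_atTop]; exact Filter.hyperfilter_le_cofinite
  obtain ⟨a, ha, hxa⟩ := (isCompact_stdSimplex ℝ I).ultrafilter_le_nhds (U.map x)
    (by
      rw [Filter.le_principal_iff]
      exact Filter.mem_map.mpr (Filter.univ_mem' hx))
  have hxa : Filter.Tendsto x U (nhds a) := hxa
  have hε : Filter.Tendsto (fun N : ℕ => (Fintype.card I : ℝ) / ((N : ℝ) + 1)) U (nhds 0) :=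
    (tendsto_const_div_atTop_nhds_zero_nat (Fintype.card I : ℝ)).comp
      (Filter.tendsto_add_atTop_nat 1) |>.mono_left hU |>.congr (fun N => by simp)
  have hle : ∀ i, a i ≤ f a i := by
    intro i
    have hev := Filter.Eventually.of_forall (f := (U : Filter ℕ)) fun N => hxi N i
    rw [Ultrafilter.eventually_or] at hev
    rcases hev with hev | hev
    · have hz : ∀ N, ∃ z ∈ stdSimplex ℝ I,
          (∀ k, |z k - x N k| ≤ (Fintype.card I : ℝ) / ((N : ℝ) + 1)) ∧
          ((∃ z ∈ stdSimplex ℝ I,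
            (∀ k, |z k - x N k| ≤ (Fintype.card I : ℝ) / ((N : ℝ) + 1)) ∧
            z i ≤ f z i) → z i ≤ f z i) := by
        intro N
        by_cases h : (∃ z ∈ stdSimplex ℝ I,
            (∀ k, |z k - x N k| ≤ (Fintype.card I : ℝ) / ((N : ℝ) + 1)) ∧ z i ≤ f z i)
        · obtain ⟨z, h1, h2, h3⟩ := h
          exact ⟨z, h1, h2, fun _ => h3⟩
        · refine ⟨x N, hx N, fun k => ?_, fun h' => absurd h' h⟩
          rw [sub_self, abs_zero]; positivity
      choose z hzΔ hzc hzf using hz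
      have hza : Filter.Tendsto z U (nhds a) := by
        rw [tendsto_pi_nhds] at hxa ⊢
        intro k
        have h0 : Filter.Tendsto (fun N => z N k - x N k) U (nhds 0) :=
          squeeze_zero_norm (fun N => hzc N k) hε
        simpa using h0.add (hxa k)
      have hza' : Filter.Tendsto z U (nhdsWithin a (stdSimplex ℝ I)) :=
        tendsto_nhdsWithin_iff.mpr ⟨hza, Filter.Eventually.of_forall hzΔ⟩
      have hfz : Filter.Tendsto (fun N => f (z N)) U (nhds (f a)) := (hf a ha).tendsto.comp hza'
      exact le_of_tendsto_of_tendsto (tendsto_pi_nhds.mp hza i) (tendsto_pi_nhds.mp hfz i)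
        (hev.mono fun N h => hzf N h)
    · have h0 : a i ≤ 0 := le_of_tendsto_of_tendsto (tendsto_pi_nhds.mp hxa i) hε hev
      exact h0.trans ((hmaps a ha).1 i)
  refine ⟨a, ha, ?_⟩
  have := (Finset.sum_eq_sum_iff_of_le (s := Finset.univ) fun i _ => hle i).mp
    (ha.2.trans (hmaps a ha).2.symm)
  funext i
  exact (this i (Finset.mem_univ i)).symm

lemma kkm_std {I : Type*} [Fintype I] [Nonempty I] (G : I → Set (I → ℝ))
    (hG : ∀ j, IsClosed (G j)) (hcov : ∀ x ∈ stdSimplex ℝ I, ∃ j, x ∈ G j)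
    (hpos : ∀ x ∈ stdSimplex ℝ I, ∀ j, x ∈ G j → x j ≠ 0) :
    ∃ x ∈ stdSimplex ℝ I, ∀ j, x ∈ G j := by
  classical
  have hne : ∀ j, (G j).Nonempty := by
    intro j
    obtain ⟨k, hk⟩ := hcov _ (single_mem_stdSimplex ℝ j)
    have := hpos _ (single_mem_stdSimplex ℝ j) k hk
    have hkj : k = j := by
      by_contra h
      exact this (by simp [h])
    exact ⟨_, hkj ▸ hk⟩
  let d : I → (I → ℝ) → ℝ := fun j x => Metric.infDist x (G j)
  have hd0 : ∀ j x, 0 ≤ d j x := fun j x => Metric.infDist_nonneg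
  have hdc : ∀ j, Continuous (d j) := fun j => Metric.continuous_infDist_pt _
  have hD : ∀ x, 0 < 1 + ∑ j, d j x := fun x =>
    add_pos_of_pos_of_nonneg one_pos (Finset.sum_nonneg fun j _ => hd0 j x)
  obtain ⟨x, hx, hfix⟩ := brouwer_simplex (fun x i => (x i + d i x) / (1 + ∑ j, d j x))
    (by
      apply Continuous.continuousOn
      refine continuous_pi fun i => Continuous.div ?_ ?_ fun x => (hD x).ne'
      · exact (continuous_apply i).add (hdc i)
      · exact continuous_const.add (continuous_finsetSum _ fun j _ => hdc j))
    (by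
      intro x hx
      refine ⟨fun i => div_nonneg (add_nonneg (hx.1 i) (hd0 i x)) (hD x).le, ?_⟩
      simp only
      rw [← Finset.sum_div, Finset.sum_add_distrib, hx.2]
      exact div_self (hD x).ne')
  refine ⟨x, hx, ?_⟩
  have hfix' : ∀ i, d i x = x i * ∑ j, d j x := by
    intro i
    have h := congrFun hfix i
    rw [div_eq_iff (hD x).ne'] at h
    linarith
  obtain ⟨k, hk⟩ := hcov x hx
  have hdk : d k x = 0 := Metric.infDist_zero_of_mem hk
  have hsum : ∑ j, d j x = 0 := by
    have h := hfix' k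
    rw [hdk] at h
    exact (mul_eq_zero.mp h.symm).resolve_left (hpos x hx k hk)
  intro j
  rw [(hG j).mem_iff_infDist_zero (hne j)]
  have h := hfix' j
  rw [hsum, mul_zero] at h
  exact h

/-- **Knaster–Kuratowski–Mazurkiewicz theorem.** If a non-degenerate simplex
`Δ^n ⊆ ℝ^n` (the convex hull of affinely independent points `p 0, …, p n`) is covered
by a finite family of closed sets with covering multiplicity at most `n`, then one of
the sets intersects all `n + 1` facets of the simplex. -/
theorem kkm {n : ℕ} (p : Fin (n + 1) → EuclideanSpace ℝ (Fin n))
    (hp : AffineIndependent ℝ p) {ι : Type*} [Finite ι]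
    (F : ι → Set (EuclideanSpace ℝ (Fin n)))
    (hclosed : ∀ i, IsClosed (F i))
    (hcover : convexHull ℝ (Set.range p) ⊆ ⋃ i, F i)
    (hmult : ∀ x ∈ convexHull ℝ (Set.range p), {i | x ∈ F i}.ncard ≤ n) :
    ∃ i, ∀ j : Fin (n + 1), (F i ∩ convexHull ℝ (p '' {j}ᶜ)).Nonempty := by
  classical
  by_contra hcon
  push Not at hcon
  choose J hJ using hcon
  let φ : (Fin (n + 1) → ℝ) → EuclideanSpace ℝ (Fin n) := fun x => ∑ i, x i • p i
  have hφc : Continuous φ :=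
    continuous_finsetSum _ fun i _ => (continuous_apply i).smul continuous_const
  have hφΔ : ∀ x ∈ stdSimplex ℝ (Fin (n + 1)), φ x ∈ convexHull ℝ (Set.range p) := fun x hx =>
    (convex_convexHull ℝ _).sum_mem (fun i _ => hx.1 i) hx.2
      (fun i _ => subset_convexHull ℝ _ ⟨i, rfl⟩)
  have hφf : ∀ x ∈ stdSimplex ℝ (Fin (n + 1)), ∀ j, x j = 0 →
      φ x ∈ convexHull ℝ (p '' {j}ᶜ) := by
    intro x hx j hj
    have h1 : φ x = ∑ i ∈ Finset.univ.erase j, x i • p i := by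
      simp only [φ]
      rw [← Finset.add_sum_erase _ _ (Finset.mem_univ j), hj, zero_smul, zero_add]
    have h2 : ∑ i ∈ Finset.univ.erase j, x i = 1 := by
      rw [← hx.2, ← Finset.add_sum_erase _ _ (Finset.mem_univ j), hj, zero_add]
    rw [h1]
    exact (convex_convexHull ℝ _).sum_mem (fun i _ => hx.1 i) h2
      (fun i hi => subset_convexHull ℝ _ ⟨i, by simpa using hi, rfl⟩)
  obtain ⟨x, hx, hxG⟩ := kkm_std (I := Fin (n + 1))
    (fun j => φ ⁻¹' ⋃ i ∈ {i | J i = j}, F i)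
    (fun j => IsClosed.preimage hφc
      ((Set.toFinite _).isClosed_biUnion fun i _ => hclosed i))
    (by
      intro x hx
      obtain ⟨i, hi⟩ := Set.mem_iUnion.mp (hcover (hφΔ x hx))
      exact ⟨J i, by simpa using ⟨i, rfl, hi⟩⟩)
    (by
      intro x hx j hxj h0
      simp only [Set.mem_preimage, Set.mem_iUnion, Set.mem_ofPred_eq] at hxj
      obtain ⟨i, rfl, hi⟩ := hxj
      have : φ x ∈ F i ∩ convexHull ℝ (p '' {J i}ᶜ) := ⟨hi, hφf x hx _ h0⟩
      rw [hJ i] at this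
      exact this)
  simp only [Set.mem_preimage, Set.mem_iUnion, Set.mem_ofPred_eq] at hxG
  choose g hgJ hgF using fun j => hxG j
  have hginj : Function.Injective g := fun a b h => by rw [← hgJ a, ← hgJ b, h]
  have h1 := hmult (φ x) (hφΔ x hx)
  have h2 : (Set.range g).ncard ≤ {i | φ x ∈ F i}.ncard :=
    Set.ncard_le_ncard (by rintro _ ⟨j, rfl⟩; exact hgF j) (Set.toFinite _)
  rw [← Set.image_univ, Set.ncard_image_of_injective _ hginj, Set.ncard_univ, Nat.card_fin] at h2
  omega
end

section
/- Let P ⊆ ℝ^n be a full-dimensional simple convex polytope covered by a finite family {X_i}_{i∈I} of closed sets with covering multiplicity at most n. Then for some i ∈ I the set X_i intersects at least n+1 facets of P. -/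
open Set

noncomputable section

/-- A full-dimensional convex polytope in `ℝ^d`: the convex hull of a finite
set of points, with nonempty interior. -/
def IsPolytope {d : ℕ} (P : Set (EuclideanSpace ℝ (Fin d))) : Prop :=
  (∃ S : Finset (EuclideanSpace ℝ (Fin d)),
    P = convexHull ℝ (S : Set (EuclideanSpace ℝ (Fin d)))) ∧ (interior P).Nonempty

/-- A face of `P` is an exposed face: the set of points of `P` at which some
linear functional attains its maximum over `P`. -/
def IsFaceOf {d : ℕ} (P F : Set (EuclideanSpace ℝ (Fin d))) : Prop :=
  ∃ l : EuclideanSpace ℝ (Fin d) →L[ℝ] ℝ, F = {x ∈ P | ∀ y ∈ P, l y ≤ l x}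

/-- The dimension of a subset of `ℝ^d`: the dimension of its affine span. -/
noncomputable def faceDim {d : ℕ} (F : Set (EuclideanSpace ℝ (Fin d))) : ℕ :=
  Module.finrank ℝ (affineSpan ℝ F).direction

/-- A facet is a face of dimension `d - 1`. -/
def IsFacetOf {d : ℕ} (P F : Set (EuclideanSpace ℝ (Fin d))) : Prop :=
  IsFaceOf P F ∧ faceDim F = d - 1

/-- A vertex is a (zero-dimensional) face consisting of a single point. -/
def IsVertexOf {d : ℕ} (P : Set (EuclideanSpace ℝ (Fin d)))
    (v : EuclideanSpace ℝ (Fin d)) : Prop :=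
  IsFaceOf P {v}

/-- A polytope is simple if every vertex is contained in exactly `d` facets. -/
def IsSimplePolytope {d : ℕ} (P : Set (EuclideanSpace ℝ (Fin d))) : Prop :=
  IsPolytope P ∧ ∀ v, IsVertexOf P v → {F | IsFacetOf P F ∧ v ∈ F}.ncard = d

/-- A proper coloring of the facets of `P` by `k` colors: distinct facets with
nonempty intersection receive different colors. -/
def IsProperColoring {d k : ℕ} (P : Set (EuclideanSpace ℝ (Fin d)))
    (h : Set (EuclideanSpace ℝ (Fin d)) → Fin k) : Prop :=
  ∀ F₁ F₂, IsFacetOf P F₁ → IsFacetOf P F₂ → F₁ ≠ F₂ → (F₁ ∩ F₂).Nonempty →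
    h F₁ ≠ h F₂


theorem exists_frontier_segment {E : Type*} [NormedAddCommGroup E] [NormedSpace ℝ E]
    {C : Set E} (hC : IsClosed C) {x z : E} (hx : x ∈ C) (hz : z ∉ C) :
    ∃ w ∈ segment ℝ x z, w ∈ frontier C := by
  by_contra! h
  have hpre : IsPreconnected (segment ℝ x z) := (convex_segment x z).isPreconnected
  have key : ∀ w ∈ segment ℝ x z, w ∈ C → w ∈ interior C := by
    intro w hw hwC
    by_contra hwi
    exact h w hw (by rw [hC.frontier_eq]; exact ⟨hwC, hwi⟩)
  obtain ⟨w, -, hw1, hw2⟩ := hpre (interior C) Cᶜ isOpen_interior hC.isOpen_compl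
    (fun w hw => by
      by_cases hwC : w ∈ C
      · exact Or.inl (key w hw hwC)
      · exact Or.inr hwC)
    ⟨x, left_mem_segment ℝ x z, key x (left_mem_segment ℝ x z) hx⟩
    ⟨z, right_mem_segment ℝ x z, hz⟩
  exact hw2 (interior_subset hw1)

theorem dist_le_of_mem_segment {E : Type*} [NormedAddCommGroup E] [NormedSpace ℝ E]
    {x z w : E} (hw : w ∈ segment ℝ x z) : dist x w ≤ dist x z ∧ dist z w ≤ dist z x := by
  have := mem_segment_iff_wbtw.1 hw
  have h := this.dist_add_dist
  constructor
  · linarith [dist_nonneg (x := w) (y := z)]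
  · rw [dist_comm z w, dist_comm z x]
    linarith [dist_nonneg (x := x) (y := w)]

/-- `det (1 + t A)` is a polynomial in `t` of degree at most `n`. -/
theorem exists_det_poly {n : ℕ} (A : EuclideanSpace ℝ (Fin n) →L[ℝ] EuclideanSpace ℝ (Fin n)) :
    ∃ p : Polynomial ℝ, p.natDegree ≤ n ∧
      ∀ t : ℝ, p.eval t = (ContinuousLinearMap.id ℝ _ + t • A).det := by
  let b := (EuclideanSpace.basisFun (Fin n) ℝ).toBasis
  let M := LinearMap.toMatrix b b (A : EuclideanSpace ℝ (Fin n) →ₗ[ℝ] EuclideanSpace ℝ (Fin n))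
  refine ⟨((Polynomial.X : Polynomial ℝ) • M.map Polynomial.C +
    (1 : Matrix (Fin n) (Fin n) ℝ).map Polynomial.C).det, ?_, ?_⟩
  · simpa using Polynomial.natDegree_det_X_add_C_le M 1
  · intro t
    have h1 : (ContinuousLinearMap.id ℝ _ + t • A).det = (1 + t • M).det := by
      rw [ContinuousLinearMap.det, ← LinearMap.det_toMatrix b]
      congr 1
      simp [M]
    rw [h1, ← Polynomial.coe_evalRingHom, RingHom.map_det]
    congr 1
    ext i j
    simp only [Matrix.one_apply, Matrix.add_apply, Matrix.smul_apply, RingHom.mapMatrix_apply,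
      Matrix.map_apply, smul_eq_mul, Polynomial.coe_evalRingHom, Polynomial.eval_add,
      Polynomial.eval_mul, Polynomial.eval_X, Polynomial.eval_C]
    ring

theorem no_retract {n : ℕ} {R : ℝ} (hR : 0 < R)
    (f : EuclideanSpace ℝ (Fin n) → EuclideanSpace ℝ (Fin n)) (hf : ContDiff ℝ 1 f)
    (hn : ∀ x, ‖f x‖ = R) (hid : ∀ x, ‖x‖ = R → f x = x) : False := by
  let B : Set (EuclideanSpace ℝ (Fin n)) := Metric.closedBall 0 R
  let u : (EuclideanSpace ℝ (Fin n)) → (EuclideanSpace ℝ (Fin n)) := fun x => f x - x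
  have hu : ContDiff ℝ 1 u := hf.sub contDiff_id
  have hBc : IsCompact B := isCompact_closedBall _ _
  have hBconv : Convex ℝ B := convex_closedBall _ _
  obtain ⟨K, hK⟩ := hu.contDiffOn.exists_lipschitzOnWith (s := B) one_ne_zero hBconv hBc
  classical
  let v : (EuclideanSpace ℝ (Fin n)) → (EuclideanSpace ℝ (Fin n)) := fun x => if x ∈ B then u x else 0
  have hvB : ∀ x ∈ B, v x = u x := fun x hx => if_pos hx
  have hvB' : ∀ x, x ∉ B → v x = 0 := fun x hx => if_neg hx
  have hcross : ∀ x ∈ B, ∀ z, z ∉ B → dist (v x) (v z) ≤ K * dist x z := by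
    intro x hx z hz
    obtain ⟨w, hw, hwf⟩ := exists_frontier_segment Metric.isClosed_closedBall hx hz
    rw [frontier_closedBall _ hR.ne'] at hwf
    have hwn : ‖w‖ = R := by simpa using hwf
    have hwB : w ∈ B := Metric.sphere_subset_closedBall hwf
    have h0 : u w = 0 := by simp [u, hid w hwn]
    rw [hvB x hx, hvB' z hz, ← h0]
    refine (hK.dist_le_mul x hx w hwB).trans ?_
    gcongr
    exact (dist_le_of_mem_segment hw).1
  have hv : LipschitzWith K v := by
    refine LipschitzWith.of_dist_le_mul fun x z => ?_
    by_cases hx : x ∈ B <;> by_cases hz : z ∈ B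
    · rw [hvB x hx, hvB z hz]; exact hK.dist_le_mul x hx z hz
    · exact hcross x hx z hz
    · rw [dist_comm, dist_comm x z]; exact hcross z hz x hx
    · rw [hvB' x hx, hvB' z hz]; simp; positivity
  let D : (EuclideanSpace ℝ (Fin n)) → (EuclideanSpace ℝ (Fin n)) →L[ℝ] (EuclideanSpace ℝ (Fin n)) := fun x => fderiv ℝ u x
  have hDc : Continuous D := hu.continuous_fderiv one_ne_zero
  have hdetc : Continuous fun q : ℝ × (EuclideanSpace ℝ (Fin n)) => (ContinuousLinearMap.id ℝ (EuclideanSpace ℝ (Fin n)) + q.1 • D q.2).det := by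
    refine ContinuousLinearMap.continuous_det.comp ?_
    fun_prop
  -- positivity for small t
  have hpos : ∀ᶠ t : ℝ in nhds 0, ∀ x ∈ B, 0 < (ContinuousLinearMap.id ℝ (EuclideanSpace ℝ (Fin n)) + t • D x).det := by
    refine hBc.eventually_forall_of_forall_eventually fun x _ => ?_
    refine (hdetc.continuousAt (x := ((0 : ℝ), x))).eventually (lt_mem_nhds ?_)
    simp [ContinuousLinearMap.det]
  have hKs : ∀ᶠ t : ℝ in nhds 0, |t| * K < 1 := by
    have : Continuous fun t : ℝ => |t| * K := by fun_prop
    refine (this.tendsto 0).eventually (gt_mem_nhds ?_)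
    simp
  obtain ⟨δ, hδ, hδ'⟩ := Metric.eventually_nhds_iff.1 (hpos.and hKs)
  -- volume identity for small t
  have hvol : ∀ t : ℝ, 0 ≤ t → t < δ → t ≤ 1 →
      ∫ x in B, (ContinuousLinearMap.id ℝ (EuclideanSpace ℝ (Fin n)) + t • D x).det = MeasureTheory.volume.real B := by
    intro t ht0 htδ ht1
    obtain ⟨hp, hk⟩ := hδ' (y := t) (by simpa [abs_of_nonneg ht0] using htδ)
    rw [abs_of_nonneg ht0] at hk
    let φ : (EuclideanSpace ℝ (Fin n)) → (EuclideanSpace ℝ (Fin n)) := fun x => x + t • u x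
    have hderiv : ∀ x ∈ B, HasFDerivWithinAt φ (ContinuousLinearMap.id ℝ (EuclideanSpace ℝ (Fin n)) + t • D x) B x := by
      intro x _
      have h1 : HasFDerivAt u (D x) x := (hu.differentiable one_ne_zero x).hasFDerivAt
      exact ((hasFDerivAt_id x).add (h1.const_smul t)).hasFDerivWithinAt
    have hinj : InjOn φ B := by
      intro x hx z hz hxz
      have h1 : x - z = t • (u z - u x) := by
        have : x + t • u x = z + t • u z := hxz
        rw [smul_sub, sub_eq_sub_iff_add_eq_add, this, add_comm]
      have h2 : dist x z ≤ t * K * dist x z := by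
        calc dist x z = ‖t • (u z - u x)‖ := by rw [dist_eq_norm, h1]
          _ = t * dist (u z) (u x) := by rw [norm_smul, Real.norm_of_nonneg ht0, dist_eq_norm]
          _ ≤ t * (K * dist z x) := by gcongr; exact hK.dist_le_mul z hz x hx
          _ = t * K * dist x z := by rw [dist_comm]; ring
      have h3 : dist x z ≤ 0 := by nlinarith [dist_nonneg (x := x) (y := z)]
      exact dist_le_zero.1 h3
    have himg : φ '' B = B := by
      apply Subset.antisymm
      · rintro _ ⟨x, hx, rfl⟩
        have hfx : f x ∈ B := by simp [B, hn x]
        have : φ x = (1 - t) • x + t • f x := by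
          simp only [φ, u, smul_sub, sub_smul, one_smul]; abel
        rw [this]
        exact hBconv hx hfx (by linarith) ht0 (by ring)
      · intro y hy
        let T : (EuclideanSpace ℝ (Fin n)) → (EuclideanSpace ℝ (Fin n)) := fun x => y - t • v x
        have hT : ContractingWith (t.toNNReal * K) T := by
          refine ⟨?_, ?_⟩
          · rw [← NNReal.coe_lt_coe]; simpa [Real.coe_toNNReal t ht0] using hk
          · refine LipschitzWith.of_dist_le_mul fun x z => ?_
            have : dist (T x) (T z) = t * dist (v x) (v z) := by
              rw [dist_eq_norm, dist_eq_norm]; simp only [T]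
              rw [sub_sub_sub_cancel_left, ← smul_sub, norm_smul, Real.norm_of_nonneg ht0,
                norm_sub_rev]
            rw [this, NNReal.coe_mul, Real.coe_toNNReal t ht0, mul_assoc]
            exact mul_le_mul_of_nonneg_left (hv.dist_le_mul x z) ht0
        obtain ⟨x, hx⟩ : ∃ x, T x = x := ⟨_, hT.fixedPoint_isFixedPt⟩
        have hxB : x ∈ B := by
          by_contra hxB
          have : T x = y := by simp [T, hvB' x hxB]
          exact hxB (by rw [← hx, this]; exact hy)
        refine ⟨x, hxB, ?_⟩
        have : y - t • u x = x := by rw [← hvB x hxB]; exact hx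
        simp only [φ]
        rw [← sub_eq_iff_eq_add.1 this]
    have hcv := MeasureTheory.integral_image_eq_integral_abs_det_fderiv_smul
      (MeasureTheory.volume : MeasureTheory.Measure (EuclideanSpace ℝ (Fin n))) hBc.measurableSet hderiv hinj
      (fun _ => (1 : ℝ))
    rw [himg] at hcv
    simp only [smul_eq_mul, mul_one, MeasureTheory.integral_const, MeasurableSet.univ,
      MeasureTheory.measureReal_restrict_apply, univ_inter] at hcv
    rw [hcv]
    refine MeasureTheory.setIntegral_congr_fun hBc.measurableSet fun x hx => ?_
    exact (abs_of_pos (hp x hx)).symm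
  -- interpolation
  let δ' := min δ 1
  have hδ'0 : 0 < δ' := lt_min hδ one_pos
  let s : Finset ℕ := Finset.range (n + 1)
  let τ : ℕ → ℝ := fun k => δ' / (k + 2)
  have hτinj : InjOn τ s := by
    intro a _ b _ hab
    have h1 : δ' / (a + 2) = δ' / (b + 2) := hab
    rw [div_eq_div_iff (by positivity) (by positivity)] at h1
    have h2 := mul_left_cancel₀ hδ'0.ne' h1
    have h3 : (a : ℝ) = b := by linarith
    exact_mod_cast h3
  have hτ0 : ∀ k, 0 ≤ τ k := fun k => by positivity
  have hτδ : ∀ k, τ k < δ' := fun k => by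
    apply div_lt_self hδ'0
    have : (0 : ℝ) ≤ k := by positivity
    linarith
  let lam : ℕ → ℝ := fun k => (Lagrange.basis s τ k).eval 1
  have hlam1 : ∑ k ∈ s, lam k = 1 := by
    have := congrArg (Polynomial.eval (1 : ℝ))
      (Lagrange.sum_basis (v := τ) hτinj (by simp [s]))
    simpa [Polynomial.eval_finsetSum] using this
  have hinterp : ∀ x, (ContinuousLinearMap.id ℝ (EuclideanSpace ℝ (Fin n)) + (1 : ℝ) • D x).det
      = ∑ k ∈ s, lam k * (ContinuousLinearMap.id ℝ (EuclideanSpace ℝ (Fin n)) + τ k • D x).det := by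
    intro x
    obtain ⟨p, hp, hpe⟩ := exists_det_poly (D x)
    have hdeg : p.degree < s.card := by
      refine (Polynomial.degree_le_natDegree).trans_lt ?_
      simp only [s, Finset.card_range]
      exact_mod_cast Nat.lt_succ_of_le hp
    have := congrArg (Polynomial.eval (1 : ℝ)) (Lagrange.eq_interpolate (v := τ) hτinj hdeg)
    rw [Lagrange.interpolate_apply, Polynomial.eval_finsetSum] at this
    rw [← hpe 1, this]
    refine Finset.sum_congr rfl fun k _ => ?_
    rw [Polynomial.eval_mul, Polynomial.eval_C, hpe, mul_comm]
  have hzero : ∀ x, (ContinuousLinearMap.id ℝ (EuclideanSpace ℝ (Fin n)) + (1 : ℝ) • D x).det = 0 := by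
    intro x
    have hfd : ContinuousLinearMap.id ℝ (EuclideanSpace ℝ (Fin n)) + (1 : ℝ) • D x = fderiv ℝ f x := by
      have h1 : HasFDerivAt f (fderiv ℝ f x) x := (hf.differentiable one_ne_zero x).hasFDerivAt
      have h2 : D x = fderiv ℝ f x - ContinuousLinearMap.id ℝ (EuclideanSpace ℝ (Fin n)) :=
        (h1.sub (hasFDerivAt_id x)).fderiv
      rw [one_smul, h2]; abel
    rw [hfd]
    have horth : ∀ w, inner ℝ (f x) (fderiv ℝ f x w) = 0 := by
      intro w
      have h1 : HasFDerivAt f (fderiv ℝ f x) x := (hf.differentiable one_ne_zero x).hasFDerivAt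
      have h2 := h1.inner ℝ h1
      have h3 : (fun t => inner ℝ (f t) (f t)) = fun _ => R ^ 2 := by
        funext t; rw [real_inner_self_eq_norm_sq, hn]
      rw [h3] at h2
      have h4 := h2.unique (hasFDerivAt_const (R ^ 2) x)
      have h5 := congrArg (fun L => L w) h4
      simp [fderivInnerCLM_apply] at h5
      rw [real_inner_comm (f x)] at h5
      linarith
    by_contra hdet
    have hsurj : Function.Surjective (fderiv ℝ f x) := by
      have := LinearEquiv.ofIsUnitDet (f := (fderiv ℝ f x : (EuclideanSpace ℝ (Fin n)) →ₗ[ℝ] (EuclideanSpace ℝ (Fin n))))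
        (v := (EuclideanSpace.basisFun (Fin n) ℝ).toBasis)
        (v' := (EuclideanSpace.basisFun (Fin n) ℝ).toBasis)
        (by rw [LinearMap.det_toMatrix]; exact isUnit_iff_ne_zero.2 hdet)
      have hu : IsUnit (fderiv ℝ f x : (EuclideanSpace ℝ (Fin n)) →ₗ[ℝ] (EuclideanSpace ℝ (Fin n))) :=
        (LinearMap.isUnit_iff_isUnit_det _).2 (isUnit_iff_ne_zero.2 hdet)
      exact ((Module.End.isUnit_iff _).1 hu).2
    obtain ⟨w, hw⟩ := hsurj (f x)
    have h6 := horth w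
    rw [hw, real_inner_self_eq_norm_sq, hn] at h6
    exact hR.ne' (by simpa using h6)
  have hintg : ∫ x in B, (ContinuousLinearMap.id ℝ (EuclideanSpace ℝ (Fin n)) + (1 : ℝ) • D x).det
      = MeasureTheory.volume.real B := by
    simp_rw [hinterp]
    rw [MeasureTheory.integral_finsetSum]
    · simp_rw [MeasureTheory.integral_const_mul]
      rw [Finset.sum_congr rfl fun k _ => by
        rw [hvol (τ k) (hτ0 k) ((hτδ k).trans_le (min_le_left _ _))
          ((hτδ k).le.trans (min_le_right _ _))], ← Finset.sum_mul, hlam1, one_mul]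
    · intro k _
      refine MeasureTheory.Integrable.const_mul ?_ _
      refine ContinuousOn.integrableOn_compact hBc ?_
      exact (hdetc.comp (Continuous.prodMk_right (τ k))).continuousOn
  simp_rw [hzero] at hintg
  have hpos : 0 < MeasureTheory.volume.real B := by
    rw [MeasureTheory.measureReal_def]
    exact ENNReal.toReal_pos (Metric.measure_closedBall_pos _ _ hR).ne'
      hBc.measure_lt_top.ne
  simp at hintg
  linarith

/-- A smooth map that is the identity off a bounded set is surjective. -/
theorem no_miss {n : ℕ} (G : EuclideanSpace ℝ (Fin n) → EuclideanSpace ℝ (Fin n))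
    (hG : ContDiff ℝ 1 G) (r : ℝ) (hr : ∀ x, r ≤ ‖x‖ → G x = x)
    (y : EuclideanSpace ℝ (Fin n)) (hy : ∀ x, G x ≠ y) : False := by
  let R := |r| + ‖y‖ + 1
  have hR : 0 < R := by positivity
  have hne : ∀ x, G (x + y) - y ≠ 0 := fun x h => hy (x + y) (sub_eq_zero.1 h)
  refine no_retract hR (fun x => (R / ‖G (x + y) - y‖) • (G (x + y) - y)) ?_ ?_ ?_
  · have h1 : ContDiff ℝ 1 fun x => G (x + y) - y :=
      (hG.comp (contDiff_id.add contDiff_const)).sub contDiff_const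
    exact (contDiff_const.div (h1.norm ℝ hne) fun x => norm_ne_zero_iff.2 (hne x)).smul h1
  · intro x
    rw [norm_smul, norm_div, norm_norm, Real.norm_of_nonneg hR.le,
      div_mul_cancel₀ _ (norm_ne_zero_iff.2 (hne x))]
  · intro x hx
    have h1 : G (x + y) = x + y := by
      apply hr
      have h2 : ‖x‖ ≤ ‖x + y‖ + ‖y‖ := by
        have := norm_sub_le (x + y) y
        simpa using this
      have := le_abs_self r
      simp only [R] at hx
      linarith
    simp [h1, hx, hR.ne']

theorem exists_notMem_affine {n : ℕ} {U : Set (EuclideanSpace ℝ (Fin n))} (hU : IsOpen U)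
    (hne : U.Nonempty) {𝒜 : Set (AffineSubspace ℝ (EuclideanSpace ℝ (Fin n)))}
    (hfin : 𝒜.Finite) (htop : ∀ s ∈ 𝒜, s ≠ ⊤) : ∃ y ∈ U, ∀ s ∈ 𝒜, y ∉ s := by
  by_contra! h
  have hsub : U ⊆ ⋃ s ∈ 𝒜, (s : Set (EuclideanSpace ℝ (Fin n))) := by
    intro y hy
    obtain ⟨s, hs, hys⟩ := h y hy
    exact mem_biUnion hs hys
  have h0 : MeasureTheory.volume (⋃ s ∈ 𝒜, (s : Set (EuclideanSpace ℝ (Fin n)))) = 0 :=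
    (MeasureTheory.measure_biUnion_null_iff hfin.countable).2 fun s hs =>
      MeasureTheory.Measure.addHaar_affineSubspace _ s (htop s hs)
  exact (hU.measure_pos MeasureTheory.volume hne).ne' (MeasureTheory.measure_mono_null hsub h0)

theorem exists_generic {n : ℕ} {J : Type*} [DecidableEq J]
    (U : J → Set (EuclideanSpace ℝ (Fin n))) (hU : ∀ j, IsOpen (U j)) (s : Finset J)
    (hne : ∀ j ∈ s, (U j).Nonempty) :
    ∃ a : J → EuclideanSpace ℝ (Fin n), (∀ j ∈ s, a j ∈ U j) ∧
      ∀ A : Finset J, A ⊆ s → A.card ≤ n → LinearIndepOn ℝ a (A : Set J) := by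
  induction s using Finset.induction_on with
  | empty =>
    refine ⟨fun _ => 0, by simp, fun A hA _ => ?_⟩
    rw [Finset.subset_empty.1 hA]
    simp
  | insert j s hj ih =>
    obtain ⟨a, ha, hli⟩ := ih fun k hk => hne k (Finset.mem_insert_of_mem hk)
    let 𝒜 : Set (AffineSubspace ℝ (EuclideanSpace ℝ (Fin n))) :=
      (fun A : Finset J => (Submodule.span ℝ (a '' (A : Set J))).toAffineSubspace) ''
        {A | A ⊆ s ∧ A.card < n}
    have hfin : 𝒜.Finite := by
      apply Set.Finite.image
      exact (Finset.finite_toSet s.powerset).subset fun A hA => by simpa using hA.1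
    obtain ⟨y, hyU, hy⟩ := exists_notMem_affine (hU j) (hne j (Finset.mem_insert_self j s)) hfin (by
      rintro _ ⟨A, ⟨-, hA⟩, rfl⟩ htop
      have h1 : Submodule.span ℝ (a '' (A : Set J)) = ⊤ := by
        rw [eq_top_iff]
        intro x _
        have : x ∈ (Submodule.span ℝ (a '' (A : Set J))).toAffineSubspace := by
          simp only at htop
          rw [htop]; exact AffineSubspace.mem_top _ _ _
        exact this
      have h2 : Module.finrank ℝ (Submodule.span ℝ (a '' (A : Set J))) ≤ A.card := by
        rw [← Finset.coe_image]
        exact (finrank_span_finset_le_card _).trans Finset.card_image_le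
      rw [h1, finrank_top, finrank_euclideanSpace, Fintype.card_fin] at h2
      omega)
    refine ⟨Function.update a j y, ?_, ?_⟩
    · intro k hk
      rcases Finset.mem_insert.1 hk with rfl | hk
      · simpa using hyU
      · rw [Function.update_of_ne (by intro h; rw [h] at hk; exact hj hk)]
        exact ha k hk
    · intro A hA hcard
      have hcongr : ∀ A' : Finset J, A' ⊆ s → EqOn a (Function.update a j y) (A' : Set J) := by
        intro A' hA' k hk
        rw [Function.update_of_ne (by intro h; rw [h] at hk; exact hj (hA' hk))]
      by_cases hjA : j ∈ A
      · have hsub : A.erase j ⊆ s := by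
          intro k hk
          rcases Finset.mem_insert.1 (hA (Finset.mem_of_mem_erase hk)) with rfl | h
          · simp at hk
          · exact h
        have hlt : (A.erase j).card < n := by
          rw [Finset.card_erase_of_mem hjA]
          have := Finset.card_pos.2 ⟨j, hjA⟩
          omega
        rw [← Finset.insert_erase hjA, Finset.coe_insert,
          linearIndepOn_insert (by simp)]
        refine ⟨(hli _ hsub hlt.le).congr (hcongr _ hsub), ?_⟩
        rw [← (hcongr _ hsub).image_eq, Function.update_self]
        intro hmem
        exact hy _ ⟨_, ⟨hsub, hlt⟩, rfl⟩ hmem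
      · have hsub : A ⊆ s := by
          intro k hk
          rcases Finset.mem_insert.1 (hA hk) with rfl | h
          · exact absurd hk hjA
          · exact h
        exact (hli A hsub hcard).congr (hcongr A hsub)

theorem exists_inner_eq_one {n : ℕ} {J : Type*} {a : J → EuclideanSpace ℝ (Fin n)} {A : Set J}
    (h : LinearIndepOn ℝ a A) : ∃ q, ∀ j ∈ A, inner ℝ (a j) q = 1 := by
  let b := Module.Basis.span (v := fun j : A => a j) h
  obtain ⟨l, hl⟩ := LinearMap.exists_extend (b.constr ℝ (fun _ => (1 : ℝ)))
  refine ⟨(InnerProductSpace.toDual ℝ _).symm (LinearMap.toContinuousLinearMap l), fun j hj => ?_⟩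
  rw [real_inner_comm, InnerProductSpace.toDual_symm_apply]
  have h1 := congrArg (fun L => L (b ⟨j, hj⟩)) hl
  simp only [LinearMap.comp_apply, Module.Basis.constr_basis, Submodule.subtype_apply] at h1
  rw [← h1]
  exact congrArg (fun z : Submodule.span ℝ (Set.range fun j : A => a j) =>
    l (z : EuclideanSpace ℝ (Fin n))) (Module.Basis.span_apply h ⟨j, hj⟩).symm

theorem thickening_inter_empty {n : ℕ} {κ : Type*} [Nonempty κ]
    (K : κ → Set (EuclideanSpace ℝ (Fin n))) (hK : ∀ k, IsCompact (K k))
    (hemp : ¬ (⋂ k, K k).Nonempty) :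
    ∃ ε > 0, ∀ δ ≤ ε, ¬ (⋂ k, Metric.thickening δ (K k)).Nonempty := by
  by_contra! hcon
  apply hemp
  have hne : ∀ δ : {δ : ℝ // 0 < δ}, (⋂ k, Metric.cthickening δ (K k)).Nonempty := by
    intro δ
    obtain ⟨δ', hδ', x, hx⟩ := hcon δ δ.2
    refine ⟨x, mem_iInter.2 fun k => ?_⟩
    exact Metric.thickening_subset_cthickening_of_le hδ' _ (mem_iInter.1 hx k)
  have : Nonempty {δ : ℝ // 0 < δ} := ⟨⟨1, one_pos⟩⟩
  have hclosed : ∀ δ : {δ : ℝ // 0 < δ}, IsClosed (⋂ k, Metric.cthickening (δ : ℝ) (K k)) :=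
    fun δ => isClosed_iInter fun k => Metric.isClosed_cthickening
  obtain ⟨x, hx⟩ := IsCompact.nonempty_iInter_of_directed_nonempty_isCompact_isClosed
    (fun δ : {δ : ℝ // 0 < δ} => ⋂ k, Metric.cthickening (δ : ℝ) (K k)) (by
      intro δ₁ δ₂
      refine ⟨⟨min δ₁.1 δ₂.1, lt_min δ₁.2 δ₂.2⟩, ?_, ?_⟩
      · exact iInter_mono fun k => Metric.cthickening_mono (min_le_left _ _) _
      · exact iInter_mono fun k => Metric.cthickening_mono (min_le_right _ _) _) hne
    (fun δ => (hK (Classical.arbitrary κ)).cthickening.of_isClosed_subset (hclosed δ)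
      (iInter_subset _ _)) hclosed
  refine ⟨x, mem_iInter.2 fun k => ?_⟩
  rw [← (hK k).isClosed.closure_eq, Metric.closure_eq_iInter_cthickening]
  refine mem_iInter₂.2 fun δ hδ => ?_
  exact mem_iInter.1 (mem_iInter.1 hx ⟨δ, hδ⟩) k

theorem face_eq {n : ℕ} {S : Set (EuclideanSpace ℝ (Fin n))} (hS : S.Finite)
    {F : Set (EuclideanSpace ℝ (Fin n))} (hF : IsFaceOf (convexHull ℝ S) F) :
    F = convexHull ℝ (S ∩ F) := by
  obtain ⟨l, hl⟩ := hF
  have hexp : IsExposed ℝ (convexHull ℝ S) F := fun _ => ⟨l, hl⟩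
  have hPc : IsCompact (convexHull ℝ S) := hS.isCompact_convexHull ℝ
  have hFc : IsCompact F := hexp.isCompact hPc
  have hFconv : Convex ℝ F := hexp.convex (convex_convexHull ℝ S)
  apply Subset.antisymm
  · have hsub : F.extremePoints ℝ ⊆ S ∩ F := fun x hx =>
      ⟨extremePoints_convexHull_subset (hexp.isExtreme.extremePoints_subset_extremePoints hx),
        extremePoints_subset hx⟩
    rw [← closure_convexHull_extremePoints hFc hFconv]
    refine closure_minimal ?_ ?_
    · rw [closure_convexHull_extremePoints hFc hFconv]
      exact convexHull_mono hsub
    · rw [closure_convexHull_extremePoints hFc hFconv]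
      exact ((hS.subset inter_subset_left).isCompact_convexHull ℝ).isClosed
  · exact convexHull_min inter_subset_right hFconv

theorem faces_finite {n : ℕ} {S : Set (EuclideanSpace ℝ (Fin n))} (hS : S.Finite) :
    {F | IsFaceOf (convexHull ℝ S) F}.Finite := by
  refine (hS.finite_subsets.image (fun T => convexHull ℝ T)).subset ?_
  intro F hF
  exact ⟨S ∩ F, inter_subset_left, (face_eq hS hF).symm⟩

theorem face_compact {n : ℕ} {S : Set (EuclideanSpace ℝ (Fin n))} (hS : S.Finite)
    {F : Set (EuclideanSpace ℝ (Fin n))} (hF : IsFaceOf (convexHull ℝ S) F) : IsCompact F := by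
  rw [face_eq hS hF]
  exact (hS.subset inter_subset_left).isCompact_convexHull ℝ

theorem frontier_subset_facets {n : ℕ} (hn : 0 < n) {S : Set (EuclideanSpace ℝ (Fin n))}
    (hS : S.Finite) (hintg : (interior (convexHull ℝ S)).Nonempty)
    {b : EuclideanSpace ℝ (Fin n)} (hb : b ∈ frontier (convexHull ℝ S)) :
    ∃ F, IsFacetOf (convexHull ℝ S) F ∧ b ∈ F := by
  set P := convexHull ℝ S with hP
  have hPc : IsCompact P := hS.isCompact_convexHull ℝ
  have hPconv : Convex ℝ P := convex_convexHull ℝ S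
  have hfin : {F | IsFacetOf P F}.Finite := (faces_finite hS).subset fun F hF => hF.1
  have hclosed : IsClosed (⋃ F ∈ {F | IsFacetOf P F}, F) :=
    hfin.isClosed_biUnion fun F hF => (face_compact hS hF.1).isClosed
  by_contra! hcon
  have hbU : b ∈ (⋃ F ∈ {F | IsFacetOf P F}, F)ᶜ := by
    intro h
    obtain ⟨F, hF, hbF⟩ := mem_iUnion₂.1 h
    exact hcon F hF hbF
  obtain ⟨r, hr, hball⟩ := Metric.isOpen_iff.1 hclosed.isOpen_compl b hbU
  -- a point of the interior near `b`
  have hbcl : b ∈ closure (interior P) := by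
    rw [hPconv.closure_interior_eq_closure_of_nonempty_interior hintg]
    exact hb.1
  obtain ⟨z, hzi, hzb⟩ := Metric.mem_closure_iff.1 hbcl r hr
  -- an exterior point near `b`
  have hbcl' : b ∈ closure Pᶜ := by
    rw [closure_compl]; exact hb.2
  obtain ⟨x₀, hx₀, hx₀b⟩ := Metric.mem_closure_iff.1 hbcl' r hr
  let 𝒜 : Set (AffineSubspace ℝ (EuclideanSpace ℝ (Fin n))) :=
    (fun T => affineSpan ℝ (insert z T)) ''
      {T | T ⊆ S ∧ Module.finrank ℝ (affineSpan ℝ T).direction < n - 1}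
  obtain ⟨x, ⟨hxP, hxb⟩, hx⟩ := exists_notMem_affine (U := Pᶜ ∩ Metric.ball b r) (𝒜 := 𝒜)
    (hPc.isClosed.isOpen_compl.inter Metric.isOpen_ball)
    ⟨x₀, hx₀, by rw [Metric.mem_ball, dist_comm]; exact hx₀b⟩
    ((hS.finite_subsets.subset fun T hT => hT.1).image _) (by
      rintro _ ⟨T, ⟨-, hT⟩, rfl⟩ htop
      simp only at htop
      have h1 := finrank_vectorSpan_insert_le_set ℝ T z
      rw [← direction_affineSpan, htop, AffineSubspace.direction_top, finrank_top,
        finrank_euclideanSpace, Fintype.card_fin] at h1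
      rw [direction_affineSpan] at hT
      omega)
  obtain ⟨w, hw, hwf⟩ := exists_frontier_segment hPc.isClosed (interior_subset hzi) hxP
  have hwball : w ∈ Metric.ball b r :=
    (convex_ball b r).segment_subset (by rw [Metric.mem_ball, dist_comm]; exact hzb) hxb hw
  have hwP : w ∈ P := by
    have := hwf.1
    rwa [hPc.isClosed.closure_eq] at this
  obtain ⟨l, hl⟩ := geometric_hahn_banach_open_point hPconv.interior isOpen_interior hwf.2
  have hlP : ∀ y ∈ P, l y ≤ l w := by
    intro y hy
    have hycl : y ∈ closure (interior P) := by
      rw [hPconv.closure_interior_eq_closure_of_nonempty_interior hintg]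
      exact subset_closure hy
    exact closure_minimal (s := interior P) (t := {y | l y ≤ l w}) (fun y hy => (hl y hy).le)
      (isClosed_le l.continuous continuous_const) hycl
  let F := {x ∈ P | ∀ y ∈ P, l y ≤ l x}
  have hFface : IsFaceOf P F := ⟨l, rfl⟩
  have hwF : w ∈ F := ⟨hwP, hlP⟩
  have hFeq := face_eq hS hFface
  have hspan : affineSpan ℝ F = affineSpan ℝ (S ∩ F) := by
    conv_lhs => rw [hFeq]
    exact affineSpan_convexHull _
  have hwz : w ≠ z := by rintro rfl; exact hwf.2 hzi
  have hge : ¬ Module.finrank ℝ (affineSpan ℝ (S ∩ F)).direction < n - 1 := by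
    intro hlt
    refine hx _ ⟨S ∩ F, ⟨inter_subset_left, hlt⟩, rfl⟩ ?_
    have hwA : w ∈ affineSpan ℝ (insert z (S ∩ F)) := by
      apply affineSpan_mono ℝ (subset_insert _ _)
      rw [← hspan]
      exact subset_affineSpan ℝ _ hwF
    have hzA : z ∈ affineSpan ℝ (insert z (S ∩ F)) :=
      subset_affineSpan ℝ _ (mem_insert _ _)
    obtain ⟨t, ht, rfl⟩ := (mem_segment_iff_wbtw.1 hw)
    have ht0 : t ≠ 0 := by rintro rfl; simp at hwz
    have hxe : x = AffineMap.lineMap z (AffineMap.lineMap z x t) t⁻¹ := by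
      simp [AffineMap.lineMap_apply, smul_smul, ht0]
    change x ∈ affineSpan ℝ (insert z (S ∩ F))
    rw [hxe]
    exact AffineMap.lineMap_mem _ hzA hwA
  have hle : Module.finrank ℝ (affineSpan ℝ F).direction ≤ n - 1 := by
    have hker : (affineSpan ℝ F).direction ≤ LinearMap.ker (l : EuclideanSpace ℝ (Fin n) →ₗ[ℝ] ℝ) := by
      rw [direction_affineSpan, vectorSpan_def, Submodule.span_le]
      rintro _ ⟨p, hp, q, hq, rfl⟩
      have : l p = l q := le_antisymm (hq.2 p hp.1) (hp.2 q hq.1)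
      simp [this]
    have hlt : LinearMap.ker (l : EuclideanSpace ℝ (Fin n) →ₗ[ℝ] ℝ) < ⊤ := by
      rw [lt_top_iff_ne_top]
      intro htop
      have h1 : (w - z) ∈ LinearMap.ker (l : EuclideanSpace ℝ (Fin n) →ₗ[ℝ] ℝ) := by
        rw [htop]; trivial
      have h2 := hl z hzi
      simp at h1
      linarith
    have h3 := Submodule.finrank_lt hlt.ne
    rw [finrank_euclideanSpace, Fintype.card_fin] at h3
    have h4 := Submodule.finrank_mono hker
    omega
  have hfacet : IsFacetOf P F := by
    refine ⟨hFface, le_antisymm hle ?_⟩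
    rw [faceDim, hspan]
    exact not_lt.1 hge
  exact hball hwball (mem_biUnion (show F ∈ {F | IsFacetOf P F} from hfacet) hwF)

/-- A facet has a functional that is positive on it relative to a given interior point. -/
theorem facet_functional {n : ℕ} (hn : 0 < n) {P : Set (EuclideanSpace ℝ (Fin n))}
    {c : EuclideanSpace ℝ (Fin n)} (hc : c ∈ interior P)
    {F : Set (EuclideanSpace ℝ (Fin n))} (hF : IsFacetOf P F) :
    ∃ a : EuclideanSpace ℝ (Fin n), ∀ x ∈ F, 0 < inner ℝ a (x - c) := by
  obtain ⟨⟨l, hl⟩, hdim⟩ := hF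
  have hl0 : l ≠ 0 := by
    rintro rfl
    have hFP : F = P := by rw [hl]; ext; simp
    have h1 : affineSpan ℝ P = ⊤ := by
      have h2 : affineSpan ℝ (interior P) = ⊤ := isOpen_interior.affineSpan_eq_top ⟨c, hc⟩
      exact top_le_iff.1 (h2 ▸ affineSpan_mono ℝ interior_subset)
    rw [faceDim, hFP, h1, AffineSubspace.direction_top, finrank_top, finrank_euclideanSpace,
      Fintype.card_fin] at hdim
    omega
  obtain ⟨v, hv⟩ : ∃ v, 0 < l v := by
    by_contra! h
    apply hl0
    ext v
    have h1 := h v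
    have h2 := h (-v)
    simp at h2 ⊢
    linarith
  refine ⟨(InnerProductSpace.toDual ℝ _).symm l, fun x hx => ?_⟩
  rw [InnerProductSpace.toDual_symm_apply, map_sub, sub_pos]
  rw [hl] at hx
  have hev : ∀ᶠ t : ℝ in nhds 0, c + t • v ∈ P := by
    have hcont : Continuous fun t : ℝ => c + t • v := by fun_prop
    have := (hcont.tendsto 0).eventually (isOpen_interior.mem_nhds (by simpa using hc))
    exact this.mono fun t ht => interior_subset ht
  obtain ⟨t, htP, ht⟩ := ((hev.filter_mono (nhdsWithin_le_nhds (s := Ioi 0))).and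
    self_mem_nhdsWithin).exists
  have h1 := hx.2 _ htP
  have h2 : 0 < t * l v := mul_pos ht hv
  simp at h1
  linarith

/-- **Karasev's theorem.** If a full-dimensional simple polytope `P ⊆ ℝ^n` is covered
by a finite family of closed sets with covering multiplicity at most `n`, then some
set of the family intersects at least `n + 1` facets of `P`. -/
theorem simple_polytope_lebesgue {n : ℕ} (P : Set (EuclideanSpace ℝ (Fin n)))
    (hP : IsSimplePolytope P) {ι : Type*} [Finite ι]
    (X : ι → Set (EuclideanSpace ℝ (Fin n)))
    (hclosed : ∀ i, IsClosed (X i))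
    (hcover : P ⊆ ⋃ i, X i)
    (hmult : ∀ p ∈ P, {i | p ∈ X i}.ncard ≤ n) :
    ∃ i, n + 1 ≤ {F | IsFacetOf P F ∧ (X i ∩ F).Nonempty}.ncard := by
  classical
  have _ := Fintype.ofFinite ι
  obtain ⟨⟨⟨S₀, hPS⟩, c, hc⟩, -⟩ := hP
  have hS : (S₀ : Set (EuclideanSpace ℝ (Fin n))).Finite := S₀.finite_toSet
  generalize (S₀ : Set (EuclideanSpace ℝ (Fin n))) = S at hPS hS
  have hcP : c ∈ P := interior_subset hc
  have hPc : IsCompact P := hPS ▸ hS.isCompact_convexHull ℝ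
  have hn : 0 < n := by
    obtain ⟨i, hi⟩ := mem_iUnion.1 (hcover hcP)
    have h1 : 0 < {i | c ∈ X i}.ncard := (Set.ncard_pos (Set.toFinite _)).2 ⟨i, hi⟩
    exact h1.trans_le (hmult c hcP)
  by_contra! hcon
  have hface : ∀ F, IsFacetOf P F → IsCompact F := fun F hF =>
    face_compact hS (hPS ▸ hF.1)
  have hFP : ∀ F, IsFacetOf P F → F ⊆ P := by
    rintro F ⟨⟨l, rfl⟩, -⟩ x hx
    exact hx.1
  have hfin : {F | IsFacetOf P F}.Finite := by
    refine Set.Finite.subset (s := {F | IsFaceOf P F}) ?_ fun F hF => hF.1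
    rw [hPS]; exact faces_finite hS
  let 𝓕 : Finset (Set (EuclideanSpace ℝ (Fin n))) := hfin.toFinset
  have h𝓕 : ∀ F, F ∈ 𝓕 ↔ IsFacetOf P F := fun F => by simp [𝓕]
  -- generic functionals
  let U : Set (EuclideanSpace ℝ (Fin n)) → Set (EuclideanSpace ℝ (Fin n)) := fun F =>
    interior {a | ∀ x ∈ F, 0 < inner ℝ a (x - c)}
  obtain ⟨a, haU, hgen⟩ := exists_generic U (fun F => isOpen_interior) 𝓕 (by
    intro F hF
    obtain ⟨a, ha⟩ := facet_functional hn hc ((h𝓕 F).1 hF)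
    refine ⟨a, mem_interior_iff_mem_nhds.2 ?_⟩
    refine (hface F ((h𝓕 F).1 hF)).eventually_forall_of_forall_eventually
      (P := fun a x => 0 < inner ℝ a (x - c)) fun x hx => ?_
    have hcont : Continuous fun z : EuclideanSpace ℝ (Fin n) × EuclideanSpace ℝ (Fin n) =>
      inner ℝ z.1 (z.2 - c) := by fun_prop
    exact (hcont.tendsto (a, x)).eventually (lt_mem_nhds (ha x hx)))
  have ha : ∀ F ∈ 𝓕, ∀ x ∈ F, 0 < inner ℝ (a F) (x - c) := fun F hF =>
    interior_subset (haU F hF)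
  -- the points
  let K : ι → Set (EuclideanSpace ℝ (Fin n)) := fun i => X i ∩ P
  have hK : ∀ i, IsCompact (K i) := fun i => hPc.inter_left (hclosed i)
  have hpts : ∀ i, ∃ q, ∀ F ∈ 𝓕, (K i ∩ F).Nonempty → inner ℝ (a F) q = 1 := by
    intro i
    let A : Finset (Set (EuclideanSpace ℝ (Fin n))) := 𝓕.filter fun F => (K i ∩ F).Nonempty
    have hA : A.card ≤ n := by
      have h1 := hcon i
      have h2 : (A : Set (Set (EuclideanSpace ℝ (Fin n)))) ⊆
          {F | IsFacetOf P F ∧ (X i ∩ F).Nonempty} := by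
        intro F hF
        have hF' := Finset.mem_filter.1 hF
        exact ⟨(h𝓕 F).1 hF'.1, hF'.2.mono (inter_subset_inter_left _ inter_subset_left)⟩
      have h3 := Set.ncard_le_ncard h2 (hfin.subset fun F hF => hF.1)
      rw [Set.ncard_coe_finset] at h3
      omega
    obtain ⟨q, hq⟩ := exists_inner_eq_one (hgen A (Finset.filter_subset _ _) hA)
    exact ⟨q, fun F hF hne => hq F (Finset.mem_filter.2 ⟨hF, hne⟩)⟩
  choose q hq using hpts
  let p : ι → EuclideanSpace ℝ (Fin n) := fun i => c + q i
  -- the missed point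
  have hVev : ∀ᶠ y in nhds c, (∀ F ∈ 𝓕, ∀ x ∈ F, 0 < inner ℝ (a F) (x - y)) ∧
      (∀ F ∈ 𝓕, inner ℝ (a F) (y - c) < 1) ∧ y ∈ interior P := by
    refine Filter.Eventually.and ?_ (Filter.Eventually.and ?_ (isOpen_interior.mem_nhds hc))
    · rw [Filter.eventually_all_finset]
      intro F hF
      refine (hface F ((h𝓕 F).1 hF)).eventually_forall_of_forall_eventually
        (P := fun y x => 0 < inner ℝ (a F) (x - y)) fun x hx => ?_
      have hcont : Continuous fun z : EuclideanSpace ℝ (Fin n) × EuclideanSpace ℝ (Fin n) =>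
        inner ℝ (a F) (z.2 - z.1) := by fun_prop
      exact (hcont.tendsto (c, x)).eventually (lt_mem_nhds (ha F hF x hx))
    · rw [Filter.eventually_all_finset]
      intro F hF
      have hcont : Continuous fun y : EuclideanSpace ℝ (Fin n) => inner ℝ (a F) (y - c) := by
        fun_prop
      refine (hcont.tendsto c).eventually (gt_mem_nhds ?_)
      simp
  obtain ⟨V, hVsub, hVo, hcV⟩ := eventually_nhds_iff.1 hVev
  let 𝒜 : Set (AffineSubspace ℝ (EuclideanSpace ℝ (Fin n))) :=
    (fun A : Finset ι => affineSpan ℝ (p '' (A : Set ι))) '' {A | A.card ≤ n}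
  obtain ⟨y, hyV, hy⟩ := exists_notMem_affine hVo ⟨c, hcV⟩ (𝒜 := 𝒜) (Set.toFinite _) (by
    rintro _ ⟨A, hA, rfl⟩ htop
    simp only [mem_setOf_eq] at hA htop
    rcases A.eq_empty_or_nonempty with rfl | hAne
    · simp only [Finset.coe_empty, image_empty, AffineSubspace.span_empty] at htop
      exact AffineSubspace.bot_ne_top ℝ _ _ htop
    · have hpos : 0 < A.card := Finset.card_pos.2 hAne
      have h1 := finrank_vectorSpan_image_finset_le ℝ p A (n := A.card - 1) (by omega)
      rw [Finset.coe_image, ← direction_affineSpan, htop, AffineSubspace.direction_top,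
        finrank_top, finrank_euclideanSpace, Fintype.card_fin] at h1
      omega)
  obtain ⟨hy1, hy2, hy3⟩ := hVsub y hyV
  have hyP : y ∈ P := interior_subset hy3
  -- the scale
  obtain ⟨ε, hε, hεm, hεF, hεa⟩ : ∃ ε > 0,
      (∀ A : Finset ι, n < A.card → ¬ (⋂ i : A, Metric.thickening ε (K i)).Nonempty) ∧
      (∀ i, ∀ F ∈ 𝓕, ∀ x, x ∈ Metric.thickening ε (K i) → x ∈ Metric.thickening ε F →
        (K i ∩ F).Nonempty) ∧
      (∀ F ∈ 𝓕, ∀ x ∈ Metric.thickening ε F, 0 < inner ℝ (a F) (x - y)) := by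
    have e1 : ∀ᶠ ε in nhdsWithin (0 : ℝ) (Ioi 0), ∀ A : Finset ι, n < A.card →
        ¬ (⋂ i : A, Metric.thickening ε (K i)).Nonempty := by
      rw [Filter.eventually_all]
      intro A
      by_cases hA : n < A.card
      · have hAne : A.Nonempty := Finset.card_pos.1 (by omega)
        have : Nonempty A := hAne.to_subtype
        obtain ⟨ε, hε, h⟩ := thickening_inter_empty (fun i : A => K i) (fun i => hK i) (by
          rintro ⟨x, hx⟩
          have hx' : ∀ i ∈ A, x ∈ K i := fun i hi => mem_iInter.1 hx ⟨i, hi⟩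
          obtain ⟨i, hi⟩ := hAne
          have h1 := hmult x (hx' i hi).2
          have h2 : (A : Set ι) ⊆ {i | x ∈ X i} := fun i hi => (hx' i hi).1
          have h3 := Set.ncard_le_ncard h2 (Set.toFinite _)
          rw [Set.ncard_coe_finset] at h3
          omega)
        filter_upwards [Ioc_mem_nhdsGT hε] with δ hδ _
        exact h δ hδ.2
      · exact Filter.Eventually.of_forall fun _ h => absurd h hA
    have e2 : ∀ᶠ ε in nhdsWithin (0 : ℝ) (Ioi 0), ∀ i, ∀ F ∈ 𝓕, ∀ x,
        x ∈ Metric.thickening ε (K i) → x ∈ Metric.thickening ε F → (K i ∩ F).Nonempty := by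
      rw [Filter.eventually_all]
      intro i
      rw [Filter.eventually_all_finset]
      intro F hF
      by_cases hne : (K i ∩ F).Nonempty
      · exact Filter.Eventually.of_forall fun _ _ _ _ => hne
      · obtain ⟨ε, hε, h⟩ := thickening_inter_empty (fun b : Bool => cond b (K i) F) (by
          rintro (_ | _)
          · exact hface F ((h𝓕 F).1 hF)
          · exact hK i) (by
          rintro ⟨x, hx⟩
          exact hne ⟨x, mem_iInter.1 hx true, mem_iInter.1 hx false⟩)
        filter_upwards [Ioc_mem_nhdsGT hε] with δ hδ x hx1 hx2
        refine absurd ⟨x, mem_iInter.2 ?_⟩ (h δ hδ.2)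
        rintro (_ | _)
        · exact hx2
        · exact hx1
    have e3 : ∀ᶠ ε in nhdsWithin (0 : ℝ) (Ioi 0), ∀ F ∈ 𝓕, ∀ x ∈ Metric.thickening ε F,
        0 < inner ℝ (a F) (x - y) := by
      rw [Filter.eventually_all_finset]
      intro F hF
      have hcont : Continuous fun x : EuclideanSpace ℝ (Fin n) => inner ℝ (a F) (x - y) := by
        fun_prop
      obtain ⟨ε, hε, h⟩ := (hface F ((h𝓕 F).1 hF)).exists_thickening_subset_open
        (isOpen_lt continuous_const hcont) (fun x hx => hy1 F hF x hx)
      filter_upwards [Ioc_mem_nhdsGT hε] with δ hδ x hx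
      exact h (Metric.thickening_mono hδ.2 _ hx)
    obtain ⟨ε, h, h1, h2, h3⟩ :=
      ((self_mem_nhdsWithin : Ioi (0 : ℝ) ∈ nhdsWithin (0 : ℝ) (Ioi 0)) |>
        fun h => (Filter.eventually_iff.2 h).and (e1.and (e2.and e3))).exists
    exact ⟨ε, h, h1, h2, h3⟩
  -- weights
  have hw : ∀ i, ∃ f : EuclideanSpace ℝ (Fin n) → ℝ,
      Function.support f = Metric.thickening ε (K i) ∧ ContDiff ℝ ((1 : ℕ∞) : WithTop ℕ∞) f ∧
        range f ⊆ Icc 0 1 := fun i => Metric.isOpen_thickening.exists_contDiff_support_eq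
  choose w hwsupp hwdiff hwrange using hw
  obtain ⟨w₀, hw₀supp, hw₀diff, hw₀range⟩ :
      ∃ f : EuclideanSpace ℝ (Fin n) → ℝ,
      Function.support f = Pᶜ ∧ ContDiff ℝ ((1 : ℕ∞) : WithTop ℕ∞) f ∧
        range f ⊆ Icc 0 1 := hPc.isClosed.isOpen_compl.exists_contDiff_support_eq
  have hw0 : ∀ i x, 0 ≤ w i x := fun i x => (hwrange i (mem_range_self x)).1
  have hw₀0 : ∀ x, 0 ≤ w₀ x := fun x => (hw₀range (mem_range_self x)).1
  have hwne : ∀ i x, w i x ≠ 0 ↔ x ∈ Metric.thickening ε (K i) := fun i x => by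
    rw [← hwsupp i]; rfl
  have hw₀ne : ∀ x, w₀ x ≠ 0 ↔ x ∉ P := fun x => by
    rw [← mem_compl_iff, ← hw₀supp]; rfl
  have hKP : ∀ x ∈ P, ∃ i, w i x ≠ 0 := by
    intro x hx
    obtain ⟨i, hi⟩ := mem_iUnion.1 (hcover hx)
    exact ⟨i, (hwne i x).2 (Metric.self_subset_thickening hε _ ⟨hi, hx⟩)⟩
  let D : EuclideanSpace ℝ (Fin n) → ℝ := fun x => ∑ i, w i x + w₀ x
  have hD : ∀ x, 0 < D x := by
    intro x
    by_cases hx : x ∈ P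
    · obtain ⟨i, hi⟩ := hKP x hx
      have h1 : 0 < ∑ i, w i x := Finset.sum_pos' (fun i _ => hw0 i x)
        ⟨i, Finset.mem_univ i, lt_of_le_of_ne (hw0 i x) hi.symm⟩
      exact add_pos_of_pos_of_nonneg h1 (hw₀0 x)
    · exact add_pos_of_nonneg_of_pos (Finset.sum_nonneg fun i _ => hw0 i x)
        (lt_of_le_of_ne (hw₀0 x) ((hw₀ne x).2 hx).symm)
  let G : EuclideanSpace ℝ (Fin n) → EuclideanSpace ℝ (Fin n) := fun x =>
    (D x)⁻¹ • (∑ i, w i x • p i + w₀ x • x)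
  have hDdiff : ContDiff ℝ 1 D :=
    (ContDiff.sum fun i _ => hwdiff i).add hw₀diff
  have hGdiff : ContDiff ℝ 1 G := by
    refine (hDdiff.inv fun x => (hD x).ne').smul (ContDiff.add ?_ ?_)
    · exact ContDiff.sum fun i _ => (hwdiff i).smul contDiff_const
    · exact hw₀diff.smul contDiff_id
  -- identity far away
  obtain ⟨r, hr⟩ := (hPc.isBounded.thickening (δ := ε)).exists_norm_le
  refine no_miss G hGdiff (r + 1) ?_ y ?_
  · intro x hx
    have hxt : x ∉ Metric.thickening ε P := fun h => by linarith [hr x h]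
    have hwi : ∀ i, w i x = 0 := by
      intro i
      by_contra h
      exact hxt (Metric.thickening_subset_of_subset ε inter_subset_right ((hwne i x).1 h))
    have hD' : D x = w₀ x := by simp [D, hwi]
    simp only [G]
    rw [← hD']
    simp [hwi, smul_smul, (hD x).ne']
  · intro x hxy
    have hsum : ∑ i, w i x • (p i - y) + w₀ x • (x - y) = 0 := by
      have h1 : ∑ i, w i x • p i + w₀ x • x = D x • y := by
        rw [← hxy]; simp only [G]
        rw [smul_smul, mul_inv_cancel₀ (hD x).ne', one_smul]
      simp only [smul_sub, Finset.sum_sub_distrib, ← Finset.sum_smul]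
      have h2 : D x • y = (∑ i, w i x) • y + w₀ x • y := by simp only [D, add_smul]
      rw [h2] at h1
      rw [sub_add_sub_comm, h1, sub_self]
    by_cases hx : x ∈ P
    · have hw₀x : w₀ x = 0 := by
        by_contra h
        exact (hw₀ne x).1 h hx
      rw [hw₀x, zero_smul, add_zero] at hsum
      let A : Finset ι := Finset.univ.filter fun i => w i x ≠ 0
      have hA : A.card ≤ n := by
        by_contra h
        refine hεm A (not_le.1 h) ⟨x, mem_iInter.2 fun i => ?_⟩
        exact (hwne i x).1 (Finset.mem_filter.1 i.2).2
      have hAsum : 0 < ∑ i ∈ A, w i x := by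
        obtain ⟨i, hi⟩ := hKP x hx
        exact Finset.sum_pos' (fun i _ => hw0 i x)
          ⟨i, Finset.mem_filter.2 ⟨Finset.mem_univ i, hi⟩, lt_of_le_of_ne (hw0 i x) hi.symm⟩
      have hsumA : ∑ i ∈ A, w i x • (p i - y) = 0 := by
        rw [← hsum]
        refine Finset.sum_subset (Finset.subset_univ A) fun i _ hi => ?_
        have : w i x = 0 := by
          by_contra h
          exact hi (Finset.mem_filter.2 ⟨Finset.mem_univ i, h⟩)
        rw [this, zero_smul]
      have hyc : A.centerMass (fun i => w i x) p = y := by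
        simp only [smul_sub, Finset.sum_sub_distrib, ← Finset.sum_smul] at hsumA
        rw [Finset.centerMass, sub_eq_zero.1 hsumA, smul_smul, inv_mul_cancel₀ hAsum.ne', one_smul]
      refine hy _ ⟨A, hA, rfl⟩ ?_
      have h5 : A.centerMass (fun i => w i x) p ∈ convexHull ℝ (p '' (A : Set ι)) :=
        Finset.centerMass_mem_convexHull A (fun i _ => hw0 i x) hAsum
          fun i hi => mem_image_of_mem p hi
      rw [hyc] at h5
      exact convexHull_subset_affineSpan _ h5
    · have hw₀x : 0 < w₀ x := lt_of_le_of_ne (hw₀0 x) ((hw₀ne x).2 hx).symm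
      by_cases hall : ∀ i, w i x = 0
      · simp only [hall, zero_smul, Finset.sum_const_zero, zero_add, smul_eq_zero, hw₀x.ne',
          false_or] at hsum
        exact hx (sub_eq_zero.1 hsum ▸ hyP)
      · push Not at hall
        obtain ⟨i₀, hi₀⟩ := hall
        obtain ⟨z, hz, hxz⟩ := Metric.mem_thickening_iff.1 ((hwne i₀ x).1 hi₀)
        obtain ⟨b, hb, hbf⟩ := exists_frontier_segment hPc.isClosed hz.2 hx
        obtain ⟨F, hF, hbF⟩ : ∃ F, IsFacetOf P F ∧ b ∈ F := by
          subst hPS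
          exact frontier_subset_facets hn hS ⟨c, hc⟩ hbf
        have hF' : F ∈ 𝓕 := (h𝓕 F).2 hF
        have hxF : x ∈ Metric.thickening ε F :=
          Metric.mem_thickening_iff.2 ⟨b, hbF, ((dist_le_of_mem_segment hb).2).trans_lt hxz⟩
        have hterm : ∀ i, 0 ≤ w i x * inner ℝ (a F) (p i - y) := by
          intro i
          by_cases hi : w i x = 0
          · simp [hi]
          · refine mul_nonneg (hw0 i x) ?_
            have h1 := hq i F hF' (hεF i F hF' x ((hwne i x).1 hi) hxF)
            have h2 := hy2 F hF'
            have h3 : p i - y = q i - (y - c) := by simp only [p]; abel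
            rw [h3, inner_sub_right, h1]
            linarith
        have h0 := congrArg (fun v => inner ℝ (a F) v) hsum
        simp only [inner_add_right, inner_sum, inner_smul_right, inner_zero_right] at h0
        have h1 : 0 ≤ ∑ i, w i x * inner ℝ (a F) (p i - y) :=
          Finset.sum_nonneg fun i _ => hterm i
        have h2 := mul_pos hw₀x (hεa F hF' x hxF)
        linarith

end
end

section
/- (Joswig) Let P ⊆ ℝ^n be a full-dimensional simple convex polytope with n ≥ 2. Then P admits a proper coloring of its facets by n colors if and only if every 2-dimensional face of P has an even number of vertices. -/
open Set

noncomputable section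


section comb
set_option linter.unusedSectionVars false
variable {V 𝓕 : Type*} [Fintype V] [DecidableEq V] [DecidableEq 𝓕] {n : ℕ}

theorem comb_matching (Φ : V → Finset 𝓕) (hc : ∀ v, (Φ v).card = n)
    (H1 : ∀ v, ∀ F ∈ Φ v, ∃ w, Φ v ∩ Φ w = (Φ v).erase F)
    (H2 : ∀ v u w, ∀ F ∈ Φ v, Φ v ∩ Φ u = (Φ v).erase F → Φ v ∩ Φ w = (Φ v).erase F → u = w)
    (W : Finset V) (c : V → 𝓕 → Fin n) (a : Fin n)
    (hinj : ∀ u ∈ W, Set.InjOn (c u) (Φ u))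
    (hW : ∀ u ∈ W, ∀ F ∈ Φ u, c u F = a → ∀ w, Φ u ∩ Φ w = (Φ u).erase F →
      w ∈ W ∧ ∀ G ∈ Φ u, G ∈ Φ w → c u G = c w G) : Even W.card := by

  have hsurj : ∀ u ∈ W, ∃ F ∈ Φ u, c u F = a := by
    intro u hu
    have := Finset.surj_on_of_inj_on_of_card_le (s := Φ u) (t := (Finset.univ : Finset (Fin n)))
      (fun F _ => c u F) (fun _ _ => Finset.mem_univ _)
      (fun F G hF hG h => hinj u hu hF hG h) (by simp [hc]) a (Finset.mem_univ _)
    obtain ⟨F, hF, h⟩ := this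
    exact ⟨F, hF, h.symm⟩
  have : ∀ u : V, ∃ w, u ∈ W → ∃ F ∈ Φ u, c u F = a ∧ Φ u ∩ Φ w = (Φ u).erase F := by
    intro u
    by_cases hu : u ∈ W
    · obtain ⟨F, hF, h⟩ := hsurj u hu
      obtain ⟨w, hw⟩ := H1 u F hF
      exact ⟨w, fun _ => ⟨F, hF, h, hw⟩⟩
    · exact ⟨u, fun h => absurd h hu⟩
  choose g hg using this
  have hgW : ∀ u ∈ W, g u ∈ W := by
    intro u hu
    obtain ⟨F, hF, h, hw⟩ := hg u hu
    exact (hW u hu F hF h _ hw).1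
  have hne : ∀ u ∈ W, g u ≠ u := by
    intro u hu h
    obtain ⟨F, hF, h1, hw⟩ := hg u hu
    rw [h, Finset.inter_self] at hw
    rw [hw] at hF
    simp at hF
  have hinv : ∀ u ∈ W, g (g u) = u := by
    intro u hu
    obtain ⟨F, hF, h, hw⟩ := hg u hu
    obtain ⟨hm, hag⟩ := hW u hu F hF h _ hw
    obtain ⟨G, hG, h', hw'⟩ := hg (g u) hm
    have hGu : G ∉ Φ u := by
      intro hGu
      have : G = F := hinj u hu hGu hF (by rw [hag G hGu hG, h', h])
      subst this
      have : G ∈ Φ u ∩ Φ (g u) := by simp [hGu, hG]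
      rw [hw] at this; simp at this
    refine H2 (g u) _ _ G hG hw' ?_
    have hsub : Φ (g u) ∩ Φ u ⊆ (Φ (g u)).erase G := by
      intro x hx
      simp only [Finset.mem_inter] at hx
      refine Finset.mem_erase.2 ⟨?_, hx.1⟩
      rintro rfl; exact hGu hx.2
    refine Finset.eq_of_subset_of_card_le hsub ?_
    rw [Finset.inter_comm, hw, Finset.card_erase_of_mem hF, Finset.card_erase_of_mem hG, hc, hc]
  have hs : ∑ u ∈ W, (1 : ZMod 2) = 0 :=
    Finset.sum_involution (fun u _ => g u) (fun u _ => by decide) (fun u hu _ => hne u hu)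
      (fun u hu => hgW u hu) (fun u hu => hinv u hu)
  rw [Finset.sum_const, nsmul_eq_mul, mul_one] at hs
  exact (ZMod.natCast_eq_zero_iff_even).1 hs

theorem comb_const (Φ : V → Finset 𝓕) (ℓ : V → ℝ) (hℓ : Function.Injective ℓ)
    (hA : ∀ v u, ∀ T ⊆ Φ v, T ⊆ Φ u → ℓ u < ℓ v → ∃ F ∈ Φ v, F ∉ T ∧ ∃ w,
      Φ v ∩ Φ w = (Φ v).erase F ∧ ℓ w < ℓ v)
    (D : Finset V) (hD : ∀ x ∈ D, ∀ y, ℓ y < ℓ x → y ∈ D)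
    (c : V → 𝓕 → Fin n)
    (hag : ∀ u ∈ D, ∀ w ∈ D, ∀ F ∈ Φ u, Φ u ∩ Φ w = (Φ u).erase F →
      ∀ G ∈ Φ u, G ∈ Φ w → c u G = c w G)
    (T : Finset 𝓕) (u u' : V) (hu : u ∈ D) (hu' : u' ∈ D) (hT : T ⊆ Φ u) (hT' : T ⊆ Φ u') 
    (G : 𝓕) (hG : G ∈ T) : c u G = c u' G := by

  obtain ⟨m, hm, hmin⟩ := Finset.exists_min_image (Finset.univ.filter fun u => T ⊆ Φ u) ℓ ⟨u, by simpa⟩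
  simp only [Finset.mem_filter, Finset.mem_univ, true_and] at hm hmin
  have key : ∀ k : ℕ, ∀ u ∈ D, T ⊆ Φ u → (D.filter fun x => ℓ x < ℓ u).card = k → c u G = c m G := by
    intro k
    induction k using Nat.strong_induction_on with
    | _ k ih =>
      intro u hu hT hk
      by_cases hum : u = m
      · rw [hum]
      have hlt : ℓ m < ℓ u := lt_of_le_of_ne (hmin u hT) (fun h => hum (hℓ h).symm)
      obtain ⟨F, hF, hFT, w, hw, hlw⟩ := hA u m T hT hm hlt
      have hwD := hD u hu w hlw
      have hTw : T ⊆ Φ w := by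
        intro x hx
        have : x ∈ Φ u ∩ Φ w := by
          rw [hw]; exact Finset.mem_erase.2 ⟨by rintro rfl; exact hFT hx, hT hx⟩
        exact (Finset.mem_inter.1 this).2
      rw [hag u hu w hwD F hF hw G (hT hG) (hTw hG)]
      refine ih _ ?_ w hwD hTw rfl
      rw [← hk]
      apply Finset.card_lt_card
      refine ⟨?_, ?_⟩
      · intro x hx
        simp only [Finset.mem_filter] at hx ⊢
        exact ⟨hx.1, hx.2.trans hlw⟩
      · intro h
        have := h (Finset.mem_filter.2 ⟨hwD, hlw⟩)
        simp at this
  rw [key _ u hu hT rfl, key _ u' hu' hT' rfl]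

/-- the local step: consistency around a 2-face whose top is `v`. -/
theorem comb_step (Φ : V → Finset 𝓕) (hc : ∀ v, (Φ v).card = n)
    (H1 : ∀ v, ∀ F ∈ Φ v, ∃ w, Φ v ∩ Φ w = (Φ v).erase F)
    (H2 : ∀ v u w, ∀ F ∈ Φ v, Φ v ∩ Φ u = (Φ v).erase F → Φ v ∩ Φ w = (Φ v).erase F → u = w)
    (ℓ : V → ℝ) (hℓ : Function.Injective ℓ)
    (hA : ∀ v u, ∀ T ⊆ Φ v, T ⊆ Φ u → ℓ u < ℓ v → ∃ F ∈ Φ v, F ∉ T ∧ ∃ w,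
      Φ v ∩ Φ w = (Φ v).erase F ∧ ℓ w < ℓ v)
    (hB : ∀ v u, ∀ T ⊆ Φ v, T ⊆ Φ u → ℓ v < ℓ u → ∃ F ∈ Φ v, F ∉ T ∧ ∃ w,
      Φ v ∩ Φ w = (Φ v).erase F ∧ ℓ v < ℓ w)
    (D : Finset V) (v : V) (hDv : ∀ x, x ∈ D ↔ ℓ x < ℓ v)
    (c : V → 𝓕 → Fin n)
    (hinj : ∀ u ∈ D, Set.InjOn (c u) (Φ u))
    (hag : ∀ u ∈ D, ∀ w ∈ D, ∀ F ∈ Φ u, Φ u ∩ Φ w = (Φ u).erase F →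
      ∀ G ∈ Φ u, G ∈ Φ w → c u G = c w G)
    (hev : ∀ T ⊆ Φ v, T.card + 2 = n → Even (Finset.univ.filter fun u => T ⊆ Φ u).card)
    (w₀ w₁ : V) (F₀ F₁ G₀ : 𝓕) (hF₀ : F₀ ∈ Φ v) (hF₁ : F₁ ∈ Φ v) (hne : F₀ ≠ F₁)
    (hw₀ : Φ v ∩ Φ w₀ = (Φ v).erase F₀) (hw₁ : Φ v ∩ Φ w₁ = (Φ v).erase F₁)
    (h₀ : w₀ ∈ D) (h₁ : w₁ ∈ D) (hG₀ : G₀ ∈ Φ w₀) (hG₀v : G₀ ∉ Φ v) :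
    (∀ F ∈ Φ v, F ≠ F₀ → F ≠ F₁ → c w₀ F = c w₁ F) ∧ c w₀ G₀ = c w₁ F₀ := by

  have mem₀ : ∀ F, F ∈ Φ v → F ≠ F₀ → F ∈ Φ w₀ := fun F hF h =>
    (Finset.mem_inter.1 (hw₀ ▸ Finset.mem_erase.2 ⟨h, hF⟩ : F ∈ Φ v ∩ Φ w₀)).2
  have mem₁ : ∀ F, F ∈ Φ v → F ≠ F₁ → F ∈ Φ w₁ := fun F hF h =>
    (Finset.mem_inter.1 (hw₁ ▸ Finset.mem_erase.2 ⟨h, hF⟩ : F ∈ Φ v ∩ Φ w₁)).2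
  set T := ((Φ v).erase F₀).erase F₁ with hTdef
  have hTv : T ⊆ Φ v := (Finset.erase_subset _ _).trans (Finset.erase_subset _ _)
  have hT₀ : T ⊆ Φ w₀ := by
    intro x hx; simp only [hTdef, Finset.mem_erase] at hx; exact mem₀ x hx.2.2 hx.2.1
  have hT₁ : T ⊆ Φ w₁ := by
    intro x hx; simp only [hTdef, Finset.mem_erase] at hx; exact mem₁ x hx.2.2 hx.1
  have hTc : T.card + 2 = n := by
    have h1 := Finset.card_erase_add_one hF₀
    have h2 := Finset.card_erase_add_one (Finset.mem_erase.2 ⟨hne.symm, hF₁⟩)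
    have h3 := hc v
    rw [← hTdef] at h2
    omega
  have hDdown : ∀ x ∈ D, ∀ y, ℓ y < ℓ x → y ∈ D := fun x hx y hy =>
    (hDv y).2 (hy.trans ((hDv x).1 hx))
  have hconst := comb_const Φ ℓ hℓ hA D hDdown c hag T
  refine ⟨fun F hF h h' => hconst w₀ w₁ h₀ h₁ hT₀ hT₁ F (by simp [*]), ?_⟩
  -- v is the top
  have htop : ∀ u, T ⊆ Φ u → u ≠ v → u ∈ D := by
    intro u hu huv
    rw [hDv]
    by_contra hlt
    have hlt : ℓ v < ℓ u := lt_of_le_of_ne (not_lt.1 hlt) (fun h => huv (hℓ h).symm)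
    obtain ⟨F, hF, hFT, w, hw, hlw⟩ := hB v u T hTv hu hlt
    have : F = F₀ ∨ F = F₁ := by
      by_contra hh; push Not at hh; exact hFT (by simp [*])
    rcases this with rfl | rfl
    · rw [H2 v w w₀ F hF hw hw₀] at hlw
      exact absurd ((hDv _).1 h₀) (not_lt.2 hlw.le)
    · rw [H2 v w w₁ F hF hw hw₁] at hlw
      exact absurd ((hDv _).1 h₁) (not_lt.2 hlw.le)
  by_contra hcon
  set a := c w₁ F₀ with ha
  have hF₀₁ : F₀ ∈ Φ w₁ := mem₁ F₀ hF₀ hne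
  have hF₁₀ : F₁ ∈ Φ w₀ := mem₀ F₁ hF₁ hne.symm
  have hF₀n : F₀ ∉ T := by simp [hTdef]
  have hF₁n : F₁ ∉ T := by simp [hTdef]
  -- colour a does not occur on T
  have haT : ∀ u ∈ D, T ⊆ Φ u → ∀ F ∈ T, c u F ≠ a := by
    intro u hu hTu F hF h
    rw [hconst u w₁ hu h₁ hTu hT₁ F hF] at h
    exact hF₀n (hinj w₁ h₁ (hT₁ hF) hF₀₁ h ▸ hF)
  have hF₁a : c w₀ F₁ = a := by
    have := Finset.surj_on_of_inj_on_of_card_le (s := Φ w₀) (t := (Finset.univ : Finset (Fin n)))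
      (fun F _ => c w₀ F) (fun _ _ => Finset.mem_univ _)
      (fun F G hF hG h => hinj w₀ h₀ hF hG h) (by simp [hc]) a (Finset.mem_univ _)
    obtain ⟨F, hF, h⟩ := this
    have hFT : F ∉ T := fun hF' => haT w₀ h₀ hT₀ F hF' h.symm
    have hFG : F ≠ G₀ := by rintro rfl; exact hcon h.symm
    have : F = F₁ := by
      by_contra hFF
      have hsub : insert F (insert F₁ (insert G₀ T)) ⊆ Φ w₀ := by
        intro x hx
        simp only [Finset.mem_insert] at hx
        rcases hx with rfl | rfl | rfl | hx
        exacts [hF, hF₁₀, hG₀, hT₀ hx]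
      have := Finset.card_le_card hsub
      have hGT : G₀ ∉ T := fun h => hG₀v (hTv h)
      rw [Finset.card_insert_of_notMem, Finset.card_insert_of_notMem, Finset.card_insert_of_notMem hGT, hc] at this
      · omega
      · simp only [Finset.mem_insert, not_or]
        exact ⟨by rintro rfl; exact hG₀v hF₁, hF₁n⟩
      · simp only [Finset.mem_insert, not_or]
        exact ⟨hFF, hFG, hFT⟩
    rw [← this, ← h]
  have hW := comb_matching Φ hc H1 H2 ((Finset.univ.filter fun u => T ⊆ Φ u).erase v) c a
    (by
      intro u hu
      simp only [Finset.mem_erase, Finset.mem_filter, Finset.mem_univ, true_and] at hu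
      exact hinj u (htop u hu.2 hu.1))
    (by
      intro u hu F hF hFa w hw
      simp only [Finset.mem_erase, Finset.mem_filter, Finset.mem_univ, true_and] at hu ⊢
      have huD := htop u hu.2 hu.1
      have hTw : T ⊆ Φ w := by
        intro x hx
        have : x ∈ Φ u ∩ Φ w := by
          rw [hw]
          exact Finset.mem_erase.2 ⟨by rintro rfl; exact haT u huD hu.2 _ hx hFa, hu.2 hx⟩
        exact (Finset.mem_inter.1 this).2
      have hwv : w ≠ v := by
        rintro rfl
        -- u is a neighbour of v in the 2-face
        have hFv : F ∉ Φ w := by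
          intro h
          have : F ∈ Φ u ∩ Φ w := Finset.mem_inter.2 ⟨hF, h⟩
          rw [hw] at this; simp at this
        have hcard : (Φ w ∩ Φ u).card + 1 = n := by
          rw [Finset.inter_comm, hw, Finset.card_erase_add_one hF, hc]
        have hor : F₀ ∉ Φ u ∨ F₁ ∉ Φ u := by
          by_contra hh
          push Not at hh
          have : Φ w ⊆ Φ w ∩ Φ u := by
            intro x hx
            refine Finset.mem_inter.2 ⟨hx, ?_⟩
            by_cases h0 : x = F₀
            · rw [h0]; exact hh.1
            by_cases h1 : x = F₁
            · rw [h1]; exact hh.2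
            exact hu.2 (by simp [*])
          have := Finset.card_le_card this
          rw [hc] at this
          omega
        have gen : ∀ H ∈ Φ w, H ∉ Φ u → Φ w ∩ Φ u = (Φ w).erase H := by
          intro H hH hHu
          refine Finset.eq_of_subset_of_card_le ?_ ?_
          · intro x hx
            simp only [Finset.mem_inter] at hx
            refine Finset.mem_erase.2 ⟨?_, hx.1⟩
            rintro rfl; exact hHu hx.2
          · rw [Finset.card_erase_of_mem hH, hc]; omega
        rcases hor with h | h
        · have : u = w₀ := H2 w u w₀ F₀ hF₀ (gen _ hF₀ h) hw₀
          subst this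
          exact hFv (hinj u h₀ hF hF₁₀ (hFa.trans hF₁a.symm) ▸ hF₁)
        · have : u = w₁ := H2 w u w₁ F₁ hF₁ (gen _ hF₁ h) hw₁
          subst this
          exact hFv (hinj u h₁ hF hF₀₁ hFa ▸ hF₀)
      exact ⟨⟨hwv, hTw⟩, hag u huD w (htop w hTw hwv) F hF hw⟩)
  have hE := hev T hTv hTc
  have hvm : v ∈ Finset.univ.filter fun u => T ⊆ Φ u := by simpa using hTv
  rw [← Finset.card_erase_add_one hvm] at hE
  rw [Nat.even_add_one] at hE
  exact hE hW

theorem comb_main (hn : 0 < n) (Φ : V → Finset 𝓕) (hc : ∀ v, (Φ v).card = n)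
    (H1 : ∀ v, ∀ F ∈ Φ v, ∃ w, Φ v ∩ Φ w = (Φ v).erase F)
    (H2 : ∀ v u w, ∀ F ∈ Φ v, Φ v ∩ Φ u = (Φ v).erase F → Φ v ∩ Φ w = (Φ v).erase F → u = w)
    (ℓ : V → ℝ) (hℓ : Function.Injective ℓ)
    (hA : ∀ v u, ∀ T ⊆ Φ v, T ⊆ Φ u → ℓ u < ℓ v → ∃ F ∈ Φ v, F ∉ T ∧ ∃ w,
      Φ v ∩ Φ w = (Φ v).erase F ∧ ℓ w < ℓ v)
    (hB : ∀ v u, ∀ T ⊆ Φ v, T ⊆ Φ u → ℓ v < ℓ u → ∃ F ∈ Φ v, F ∉ T ∧ ∃ w,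
      Φ v ∩ Φ w = (Φ v).erase F ∧ ℓ v < ℓ w) :
    (∃ h : 𝓕 → Fin n, ∀ v, Set.InjOn h (Φ v)) ↔
    (∀ v, ∀ T ⊆ Φ v, T.card + 2 = n → Even (Finset.univ.filter fun u => T ⊆ Φ u).card) := by

  constructor
  · rintro ⟨h, hh⟩ v T hTv hT
    obtain ⟨a, ha⟩ : ∃ a : Fin n, a ∉ T.image h := by
      by_contra hcon
      push Not at hcon
      have h1 : (Finset.univ : Finset (Fin n)) ⊆ T.image h := fun a _ => hcon a
      have h2 := Finset.card_le_card h1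
      have h3 := Finset.card_image_le (s := T) (f := h)
      simp at h2
      omega
    refine comb_matching Φ hc H1 H2 _ (fun _ => h) a (fun u _ => hh u) ?_
    intro u hu F hF hFa w hw
    refine ⟨?_, fun _ _ _ => rfl⟩
    simp only [Finset.mem_filter, Finset.mem_univ, true_and] at hu ⊢
    intro x hx
    have : x ∈ Φ u ∩ Φ w := by
      rw [hw]
      exact Finset.mem_erase.2 ⟨by rintro rfl; exact ha (Finset.mem_image.2 ⟨x, hx, hFa⟩), hu hx⟩
    exact (Finset.mem_inter.1 this).2
  · intro hev
    have key : ∀ D : Finset V, (∀ x ∈ D, ∀ y, ℓ y < ℓ x → y ∈ D) → ∃ c : V → 𝓕 → Fin n,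
        (∀ u ∈ D, Set.InjOn (c u) (Φ u)) ∧
        (∀ u ∈ D, ∀ w ∈ D, ∀ F ∈ Φ u, Φ u ∩ Φ w = (Φ u).erase F →
          ∀ G ∈ Φ u, G ∈ Φ w → c u G = c w G) := by
      intro D
      induction D using Finset.induction_on_max_value ℓ with
      | empty => exact fun _ => ⟨fun _ _ => ⟨0, hn⟩, by simp, by simp⟩
      | insert v D hvD hmax ih =>
        intro hdown
        have hDv : ∀ x, x ∈ D ↔ ℓ x < ℓ v := by
          intro x
          constructor
          · intro hx
            exact lt_of_le_of_ne (hmax x hx) (fun h => hvD (hℓ h ▸ hx))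
          · intro hx
            have := hdown v (Finset.mem_insert_self _ _) x hx
            rcases Finset.mem_insert.1 this with rfl | h
            · exact absurd hx (lt_irrefl _)
            · exact h
        obtain ⟨c, hinj, hag⟩ := ih (fun x hx y hy => (hDv y).2 (hy.trans ((hDv x).1 hx)))
        -- it suffices to find the colouring at v
        suffices hs : ∃ d : 𝓕 → Fin n, Set.InjOn d (Φ v) ∧ ∀ w ∈ D, ∀ F ∈ Φ v,
            Φ v ∩ Φ w = (Φ v).erase F → ∀ G ∈ Φ v, G ≠ F → d G = c w G by
          obtain ⟨d, hd, hd'⟩ := hs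
          have hne : ∀ u ∈ D, u ≠ v := fun u hu h => hvD (h ▸ hu)
          refine ⟨Function.update c v d, ?_, ?_⟩
          · intro u hu
            rcases Finset.mem_insert.1 hu with rfl | hu
            · simpa using hd
            · simpa [hne u hu] using hinj u hu
          · intro u hu w hw F hF huw G hGu hGw
            have hGF : G ≠ F := by
              rintro rfl
              have : G ∈ Φ u ∩ Φ w := Finset.mem_inter.2 ⟨hGu, hGw⟩
              rw [huw] at this; simp at this
            rcases Finset.mem_insert.1 hu with rfl | hu2
            · rcases Finset.mem_insert.1 hw with rfl | hw2
              · rfl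
              · simpa [hne w hw2] using hd' w hw2 F hF huw G hGu hGF
            · rcases Finset.mem_insert.1 hw with rfl | hw2
              · simp only [Function.update_self, Function.update_of_ne (hne u hu2)]
                have hcard : (Φ w ∩ Φ u).card + 1 = n := by
                  rw [Finset.inter_comm, huw, Finset.card_erase_add_one hF, hc]
                obtain ⟨H, hH, hHu⟩ : ∃ H ∈ Φ w, H ∉ Φ u := by
                  by_contra hcon
                  push Not at hcon
                  rw [Finset.inter_eq_left.2 hcon, hc] at hcard
                  omega
                refine (hd' u hu2 H hH ?_ G hGw ?_).symm
                · refine Finset.eq_of_subset_of_card_le ?_ ?_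
                  · intro x hx
                    simp only [Finset.mem_inter] at hx
                    refine Finset.mem_erase.2 ⟨?_, hx.1⟩
                    rintro rfl; exact hHu hx.2
                  · rw [Finset.card_erase_of_mem hH, hc]; omega
                · rintro rfl; exact hHu hGu
              · simpa [hne w hw2, hne u hu2] using hag u hu2 w hw2 F hF huw G hGu hGw
        by_cases hlow : ∃ w₀ ∈ D, ∃ F₀ ∈ Φ v, Φ v ∩ Φ w₀ = (Φ v).erase F₀
        · obtain ⟨w₀, hw₀D, F₀, hF₀, hw₀⟩ := hlow
          have hcard : (Φ v ∩ Φ w₀).card + 1 = n := by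
            rw [hw₀, Finset.card_erase_add_one hF₀, hc]
          obtain ⟨G₀, hG₀, hG₀v⟩ : ∃ H ∈ Φ w₀, H ∉ Φ v := by
            by_contra hcon
            push Not at hcon
            rw [Finset.inter_eq_right.2 hcon, hc] at hcard
            omega
          have mem₀ : ∀ F, F ∈ Φ v → F ≠ F₀ → F ∈ Φ w₀ := fun F hF h =>
            (Finset.mem_inter.1 (hw₀ ▸ Finset.mem_erase.2 ⟨h, hF⟩ : F ∈ Φ v ∩ Φ w₀)).2
          refine ⟨fun F => if F = F₀ then c w₀ G₀ else c w₀ F, ?_, ?_⟩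
          · intro x hx y hy hxy
            have hx : x ∈ Φ v := hx
            have hy : y ∈ Φ v := hy
            by_cases hx0 : x = F₀ <;> by_cases hy0 : y = F₀
            · rw [hx0, hy0]
            · simp only [hx0, hy0, if_true, if_false] at hxy
              exact absurd (hinj w₀ hw₀D hG₀ (mem₀ y hy hy0) hxy ▸ hy) hG₀v
            · simp only [hx0, hy0, if_true, if_false] at hxy
              exact absurd (hinj w₀ hw₀D (mem₀ x hx hx0) hG₀ hxy ▸ hx) hG₀v
            · simp only [hx0, hy0, if_false] at hxy
              exact hinj w₀ hw₀D (mem₀ x hx hx0) (mem₀ y hy hy0) hxy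
          · intro w hwD F₁ hF₁ hw₁ G hG hGF
            by_cases hF : F₀ = F₁
            · subst hF
              have : w = w₀ := H2 v w w₀ F₀ hF₀ hw₁ hw₀
              simp [hGF, this]
            · obtain ⟨h1, h2⟩ := comb_step Φ hc H1 H2 ℓ hℓ hA hB D v hDv c hinj hag (hev v)
                w₀ w F₀ F₁ G₀ hF₀ hF₁ hF hw₀ hw₁ hw₀D hwD hG₀ hG₀v
              by_cases hG0 : G = F₀
              · simp [hG0, h2]
              · simp [hG0, h1 G hG hG0 hGF]
        · have e : Φ v ≃ Fin n := Finset.equivFinOfCardEq (hc v)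
          refine ⟨fun F => if h : F ∈ Φ v then e ⟨F, h⟩ else ⟨0, hn⟩, ?_, ?_⟩
          · intro x hx y hy hxy
            have hx : x ∈ Φ v := hx
            have hy : y ∈ Φ v := hy
            simpa [hx, hy] using hxy
          · intro w hw F hF h
            exact absurd ⟨w, hw, F, hF, h⟩ hlow
    obtain ⟨c, hinj, hag⟩ := key Finset.univ (by simp)
    refine ⟨fun F => if h : ∃ v, F ∈ Φ v then c h.choose F else ⟨0, hn⟩, ?_⟩
    have : ∀ v, ∀ F ∈ Φ v, (if h : ∃ v, F ∈ Φ v then c h.choose F else ⟨0, hn⟩) = c v F := by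
      intro v F hF
      have h : ∃ v, F ∈ Φ v := ⟨v, hF⟩
      rw [dif_pos h]
      exact comb_const Φ ℓ hℓ hA Finset.univ (by simp) c hag {F} _ _ (Finset.mem_univ _)
        (Finset.mem_univ _) (by simpa using h.choose_spec) (by simpa using hF) F (by simp)
    intro v x hx y hy hxy
    simp only [this v x hx, this v y hy] at hxy
    exact hinj v (Finset.mem_univ _) hx hy hxy
end comb

section geom
variable {n : ℕ} {P : Set (EuclideanSpace ℝ (Fin n))}

theorem faceDim_empty : faceDim (∅ : Set (EuclideanSpace ℝ (Fin n))) = 0 := by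
  rw [faceDim, direction_affineSpan, vectorSpan_empty, finrank_bot]

theorem face_exposed {P F : Set (EuclideanSpace ℝ (Fin n))} (h : IsFaceOf P F) : IsExposed ℝ P F :=
  fun _ => h

theorem polytope_compact (hP : IsPolytope P) : IsCompact P := by
  obtain ⟨⟨S, rfl⟩, -⟩ := hP
  exact S.finite_toSet.isCompact_convexHull ℝ

theorem polytope_convex (hP : IsPolytope P) : Convex ℝ P := by
  obtain ⟨⟨S, rfl⟩, -⟩ := hP
  exact convex_convexHull ℝ _

theorem face_eq_hull (S : Finset (EuclideanSpace ℝ (Fin n))) (F : Set (EuclideanSpace ℝ (Fin n)))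
    (hF : IsFaceOf (convexHull ℝ (S : Set (EuclideanSpace ℝ (Fin n)))) F) :
    F = convexHull ℝ ((S : Set (EuclideanSpace ℝ (Fin n))) ∩ F) := by
  have hcomp : IsCompact F := (face_exposed hF).isCompact (S.finite_toSet.isCompact_convexHull ℝ)
  have hconv : Convex ℝ F := (face_exposed hF).convex (convex_convexHull ℝ _)
  apply Subset.antisymm
  · have hfin : ((S : Set (EuclideanSpace ℝ (Fin n))) ∩ F).Finite := S.finite_toSet.inter_of_left F
    have h1 : F.extremePoints ℝ ⊆ (S : Set (EuclideanSpace ℝ (Fin n))) ∩ F := by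
      intro x hx
      exact ⟨extremePoints_convexHull_subset
        ((face_exposed hF).isExtreme.extremePoints_subset_extremePoints hx), hx.1⟩
    conv_lhs => rw [← closure_convexHull_extremePoints hcomp hconv]
    exact closure_minimal (convexHull_mono h1) (hfin.isCompact_convexHull ℝ).isClosed
  · exact convexHull_min inter_subset_right hconv

theorem facets_finite (hP : IsPolytope P) : {F | IsFacetOf P F}.Finite := by
  obtain ⟨⟨S, rfl⟩, -⟩ := hP
  refine Set.Finite.subset ((S.finite_toSet.powerset).image (convexHull ℝ)) ?_
  intro F hF
  exact ⟨(S : Set _) ∩ F, inter_subset_left, (face_eq_hull S F hF.1).symm⟩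

theorem vertices_finite (hP : IsPolytope P) : (P.extremePoints ℝ).Finite := by
  obtain ⟨⟨S, rfl⟩, -⟩ := hP
  exact S.finite_toSet.subset extremePoints_convexHull_subset

theorem hrep_aux (hn : 2 ≤ n) (hP : IsPolytope P) (x : EuclideanSpace ℝ (Fin n)) (hx : x ∉ P) :
    ∃ F, IsFacetOf P F ∧ ∃ y ∈ P, y ∉ F ∧ ∃ z ∈ F, z ∈ openSegment ℝ y x := by
  have hcomp := polytope_compact hP
  have hconv := polytope_convex hP
  obtain ⟨⟨S, hS⟩, hPint⟩ := hP
  -- generic y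
  obtain ⟨y, hy, hyg⟩ : ∃ y ∈ interior P, ∀ A ⊆ (S : Set (EuclideanSpace ℝ (Fin n))),
      Module.finrank ℝ (affineSpan ℝ A).direction + 2 ≤ n → y ∉ affineSpan ℝ (insert x A) := by
    by_contra hcon
    push Not at hcon
    have hsub : interior P ⊆ ⋃ A ∈ {A | A ⊆ (S : Set (EuclideanSpace ℝ (Fin n))) ∧
        Module.finrank ℝ (affineSpan ℝ A).direction + 2 ≤ n},
        (affineSpan ℝ (insert x A) : Set (EuclideanSpace ℝ (Fin n))) := by
      intro y hy
      obtain ⟨A, hA, h1, h2⟩ := hcon y hy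
      simp only [mem_iUnion]
      exact ⟨A, ⟨hA, h1⟩, h2⟩
    have hnull : MeasureTheory.volume (⋃ A ∈ {A | A ⊆ (S : Set (EuclideanSpace ℝ (Fin n))) ∧
        Module.finrank ℝ (affineSpan ℝ A).direction + 2 ≤ n},
        (affineSpan ℝ (insert x A) : Set (EuclideanSpace ℝ (Fin n)))) = 0 := by
      rw [MeasureTheory.measure_biUnion_null_iff]
      · rintro A ⟨hA, hd⟩
        apply MeasureTheory.Measure.addHaar_affineSubspace
        intro htop
        have h1 : Module.finrank ℝ (affineSpan ℝ (insert x A)).direction ≤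
            Module.finrank ℝ (affineSpan ℝ A).direction + 1 := by
          rw [direction_affineSpan, direction_affineSpan]
          exact finrank_vectorSpan_insert_le_set ℝ A x
        rw [htop, AffineSubspace.direction_top, finrank_top, finrank_euclideanSpace_fin] at h1
        omega
      · exact (S.finite_toSet.powerset.subset (fun A hA => hA.1)).countable
    have hpos := isOpen_interior.measure_pos (MeasureTheory.volume) hPint
    exact absurd (MeasureTheory.measure_mono_null hsub hnull) hpos.ne'
  have hyP := interior_subset hy
  -- boundary point
  obtain ⟨z, hzs, hzf⟩ : (segment ℝ y x ∩ frontier P).Nonempty := by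
    have hpre := (convex_segment (𝕜 := ℝ) y x).isPreconnected
    by_contra hcon
    have hmid : ∀ z ∈ segment ℝ y x, z ∈ P → z ∈ interior P := by
      intro z hz hzP
      by_contra hzi
      exact hcon ⟨z, hz, subset_closure hzP, hzi⟩
    obtain ⟨z, -, hz1, hz2⟩ := hpre (interior P) Pᶜ isOpen_interior hcomp.isClosed.isOpen_compl
      (fun z hz => by
        by_cases h : z ∈ P
        · exact Or.inl (hmid z hz h)
        · exact Or.inr h)
      ⟨y, left_mem_segment ℝ y x, hy⟩ ⟨x, right_mem_segment ℝ y x, hx⟩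
    exact hz2 (interior_subset hz1)
  have hzP : z ∈ P := hcomp.isClosed.frontier_subset hzf
  have hzi : z ∉ interior P := hzf.2
  have hzo : z ∈ openSegment ℝ y x := by
    refine mem_openSegment_of_ne_left_right ?_ ?_ hzs
    · rintro rfl; exact hzi hy
    · rintro rfl; exact hx hzP
  obtain ⟨f, hf⟩ := geometric_hahn_banach_open_point hconv.interior isOpen_interior hzi
  have hfP : ∀ a ∈ P, f a ≤ f z := by
    intro a ha
    have hcl : P ⊆ closure (interior P) := by
      rw [hconv.closure_interior_eq_closure_of_nonempty_interior hPint]; exact subset_closure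
    have : closure (interior P) ⊆ {a | f a ≤ f z} :=
      closure_minimal (fun a ha => (hf a ha).le) (isClosed_le f.continuous continuous_const)
    exact this (hcl ha)
  set F := {a ∈ P | ∀ b ∈ P, f b ≤ f a} with hFdef
  have hzF : z ∈ F := ⟨hzP, hfP⟩
  have hFface : IsFaceOf P F := ⟨f, rfl⟩
  have hyF : y ∉ F := fun h => absurd (h.2 z hzP) (not_le.2 (hf y hy))
  refine ⟨F, ⟨hFface, ?_⟩, y, hyP, hyF, z, hzF, hzo⟩
  have hFS : F = convexHull ℝ ((S : Set (EuclideanSpace ℝ (Fin n))) ∩ F) := face_eq_hull S F (hS ▸ hFface)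
  have hspan : affineSpan ℝ F = affineSpan ℝ ((S : Set (EuclideanSpace ℝ (Fin n))) ∩ F) := by
    conv_lhs => rw [hFS]
    exact affineSpan_convexHull _
  have hlow : n ≤ faceDim F + 1 := by
    by_contra hcon
    refine hyg ((S : Set (EuclideanSpace ℝ (Fin n))) ∩ F) inter_subset_left ?_ ?_
    · rw [← hspan]
      change faceDim F + 2 ≤ n
      omega
    · have hx' : x ∈ affineSpan ℝ (insert x ((S : Set (EuclideanSpace ℝ (Fin n))) ∩ F)) :=
        subset_affineSpan ℝ _ (mem_insert _ _)
      have hz' : z ∈ affineSpan ℝ (insert x ((S : Set (EuclideanSpace ℝ (Fin n))) ∩ F)) := by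
        refine affineSpan_mono ℝ (subset_insert _ _) ?_
        rw [← hspan]
        exact subset_affineSpan ℝ _ hzF
      rw [openSegment_eq_image_lineMap] at hzo
      obtain ⟨t, ht, rfl⟩ := hzo
      have h2 : y = AffineMap.lineMap x (AffineMap.lineMap y x t) (1 - t)⁻¹ := by
        have : (1 - t) ≠ 0 := by linarith [ht.2]
        simp only [AffineMap.lineMap_apply, vsub_eq_sub, vadd_eq_add]
        have h3 : t • (x - y) + y - x = (1 - t) • (y - x) := by module
        rw [h3, smul_smul, inv_mul_cancel₀ this, one_smul]; abel
      rw [h2]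
      exact AffineMap.lineMap_mem _ hx' hz'
  have hup : faceDim F < n := by
    have hne : (f : EuclideanSpace ℝ (Fin n) →ₗ[ℝ] ℝ) ≠ 0 := by
      intro h0
      have h1 := hf y hy
      have h2 : ∀ a, f a = 0 := fun a => by
        have := congrArg (fun g => g a) h0
        simpa using this
      rw [h2, h2] at h1
      exact lt_irrefl _ h1
    have hle : (affineSpan ℝ F).direction ≤ LinearMap.ker (f : EuclideanSpace ℝ (Fin n) →ₗ[ℝ] ℝ) := by
      rw [direction_affineSpan, vectorSpan_def, Submodule.span_le]
      rintro _ ⟨a, ha, b, hb, rfl⟩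
      have := le_antisymm (ha.2 b hb.1) (hb.2 a ha.1)
      simp [this]
    have hlt : LinearMap.ker (f : EuclideanSpace ℝ (Fin n) →ₗ[ℝ] ℝ) < ⊤ := by
      rw [lt_top_iff_ne_top]; intro h; exact hne (LinearMap.ker_eq_top.1 h)
    have h1 := Submodule.finrank_mono hle
    have h2 := Submodule.finrank_lt hlt.ne
    rw [finrank_euclideanSpace_fin] at h2
    exact lt_of_le_of_lt h1 h2
  omega

/-- H-representation by facets. -/
theorem hrep (hn : 2 ≤ n) (hP : IsPolytope P) :
    ∃ (l : Set (EuclideanSpace ℝ (Fin n)) → (EuclideanSpace ℝ (Fin n) →L[ℝ] ℝ))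
      (b : Set (EuclideanSpace ℝ (Fin n)) → ℝ),
      (∀ F, IsFacetOf P F → F = {x ∈ P | l F x = b F}) ∧
      (∀ F, IsFacetOf P F → ∀ x ∈ P, l F x ≤ b F) ∧
      (∀ x, (∀ F, IsFacetOf P F → l F x ≤ b F) → x ∈ P) := by
  have : ∀ F : Set (EuclideanSpace ℝ (Fin n)), ∃ (l : EuclideanSpace ℝ (Fin n) →L[ℝ] ℝ) (b : ℝ),
      IsFacetOf P F → F = {x ∈ P | l x = b} ∧ ∀ x ∈ P, l x ≤ b := by
    intro F
    by_cases hF : IsFacetOf P F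
    · obtain ⟨⟨l, hl⟩, hd⟩ := hF
      have hne : F.Nonempty := by
        by_contra h
        rw [not_nonempty_iff_eq_empty] at h
        rw [h] at hd
        rw [faceDim_empty] at hd
        omega
      obtain ⟨z, hz⟩ := hne
      have hz' := hz
      rw [hl] at hz'
      refine ⟨l, l z, fun _ => ⟨?_, hz'.2⟩⟩
      rw [hl]
      ext x
      constructor
      · rintro ⟨h1, h2⟩
        exact ⟨h1, le_antisymm (hz'.2 x h1) (h2 z hz'.1)⟩
      · rintro ⟨h1, h2⟩
        exact ⟨h1, fun y hy => h2 ▸ hz'.2 y hy⟩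
    · exact ⟨0, 0, fun h => absurd h hF⟩
  choose l b hlb using this
  refine ⟨l, b, fun F hF => (hlb F hF).1, fun F hF => (hlb F hF).2, ?_⟩
  intro x hx
  by_contra hxP
  obtain ⟨F, hF, y, hyP, hyF, z, hzF, hzo⟩ := hrep_aux hn hP x hxP
  obtain ⟨h1, h2⟩ := hlb F hF
  have hy : l F y < b F := lt_of_le_of_ne (h2 y hyP) (fun h => hyF (by rw [h1]; exact ⟨hyP, h⟩))
  have hz : l F z = b F := by rw [h1] at hzF; exact hzF.2
  obtain ⟨s, t, hs, ht, hst, rfl⟩ := hzo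
  have := hx F hF
  simp only [map_add, map_smul, smul_eq_mul] at hz
  have : s * l F y + t * l F x < s * b F + t * b F := by
    have := mul_lt_mul_of_pos_left hy hs
    have := mul_le_mul_of_nonneg_left (hx F hF) ht.le
    linarith
  rw [← add_mul, hst] at this
  linarith

structure Dat (P : Set (EuclideanSpace ℝ (Fin n)))
    (l : Set (EuclideanSpace ℝ (Fin n)) → (EuclideanSpace ℝ (Fin n) →L[ℝ] ℝ))
    (b : Set (EuclideanSpace ℝ (Fin n)) → ℝ) : Prop where
  eq : ∀ F, IsFacetOf P F → F = {x ∈ P | l F x = b F}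
  le : ∀ F, IsFacetOf P F → ∀ x ∈ P, l F x ≤ b F
  mem : ∀ x, (∀ F, IsFacetOf P F → l F x ≤ b F) → x ∈ P
  fin : {F | IsFacetOf P F}.Finite
  comp : IsCompact P
  conv : Convex ℝ P
  simple : ∀ v, IsVertexOf P v → {F | IsFacetOf P F ∧ v ∈ F}.ncard = n

open Classical in
/-- The finite set of facets at `v`. -/
def Phi (P : Set (EuclideanSpace ℝ (Fin n))) (v : EuclideanSpace ℝ (Fin n)) :
    Finset (Set (EuclideanSpace ℝ (Fin n))) :=
  if h : {F | IsFacetOf P F ∧ v ∈ F}.Finite then h.toFinset else ∅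

variable {l : Set (EuclideanSpace ℝ (Fin n)) → (EuclideanSpace ℝ (Fin n) →L[ℝ] ℝ)}
    {b : Set (EuclideanSpace ℝ (Fin n)) → ℝ}

theorem Dat.mem_facet (D : Dat P l b) {F} (hF : IsFacetOf P F) {x} : x ∈ F ↔ x ∈ P ∧ l F x = b F := by
  constructor
  · intro h; rw [D.eq F hF] at h; exact h
  · intro h; rw [D.eq F hF]; exact h

theorem Dat.mem_Phi (D : Dat P l b) {v F} : F ∈ Phi P v ↔ IsFacetOf P F ∧ v ∈ F := by
  have h : {F | IsFacetOf P F ∧ v ∈ F}.Finite := D.fin.subset fun F hF => hF.1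
  simp [Phi, h]

theorem Dat.card_Phi (D : Dat P l b) {v} (hv : IsVertexOf P v) : (Phi P v).card = n := by
  refine Eq.trans ?_ (D.simple v hv)
  rw [← Set.ncard_coe_finset]
  congr 1
  ext F
  simp [D.mem_Phi]

theorem Dat.tight (D : Dat P l b) {v F} (h : F ∈ Phi P v) : l F v = b F :=
  ((D.mem_facet (D.mem_Phi.1 h).1).1 (D.mem_Phi.1 h).2).2

theorem Dat.move (D : Dat P l b) {v d} (hv : v ∈ P) (hd : ∀ F ∈ Phi P v, l F d ≤ 0) :
    ∀ᶠ t : ℝ in nhdsWithin 0 (Ioi 0), v + t • d ∈ P := by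
  have : ∀ᶠ t : ℝ in nhdsWithin 0 (Ioi 0), ∀ F ∈ {F | IsFacetOf P F}, l F (v + t • d) ≤ b F := by
    rw [Filter.eventually_all_finite D.fin]
    intro F hF
    by_cases hvF : v ∈ F
    · have hm := D.mem_Phi.2 ⟨hF, hvF⟩
      filter_upwards [self_mem_nhdsWithin] with t ht
      have ht : 0 < t := ht
      have := mul_nonpos_of_nonneg_of_nonpos ht.le (hd F hm)
      simp only [map_add, map_smul, smul_eq_mul, D.tight hm]
      linarith
    · have hlt : l F v < b F := lt_of_le_of_ne (D.le F hF v hv) fun h => hvF ((D.mem_facet hF).2 ⟨hv, h⟩)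
      apply Filter.Eventually.filter_mono nhdsWithin_le_nhds
      have hc : Continuous fun t : ℝ => l F (v + t • d) := by fun_prop
      have := hc.tendsto 0
      simp only [zero_smul, add_zero] at this
      exact (this.eventually_lt_const hlt).mono fun t ht => ht.le
  filter_upwards [this] with t ht
  exact D.mem _ ht

theorem Dat.ker_of_extreme (D : Dat P l b) {v} (hv : v ∈ P.extremePoints ℝ) {d}
    (hd : ∀ F ∈ Phi P v, l F d = 0) : d = 0 := by
  have h1 := D.move hv.1 (d := d) (fun F hF => (hd F hF).le)
  have h2 := D.move hv.1 (d := -d) (fun F hF => by simp [hd F hF])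
  obtain ⟨t, ht1, ht2, ht⟩ := (h1.and (h2.and self_mem_nhdsWithin)).exists
  have ht : 0 < t := ht
  have := hv.2 ht1 ht2 ⟨1/2, 1/2, by norm_num, by norm_num, by norm_num, by module⟩
  have h3 : t • d = 0 := by simpa using this
  rcases smul_eq_zero.1 h3 with h | h
  · exact absurd h ht.ne'
  · exact h

/-- intersection of facets as an exposed face -/
def KT (P : Set (EuclideanSpace ℝ (Fin n))) (T : Finset (Set (EuclideanSpace ℝ (Fin n)))) :
    Set (EuclideanSpace ℝ (Fin n)) := {x ∈ P | ∀ F ∈ T, x ∈ F}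

theorem Dat.KT_face (D : Dat P l b) {v} (hv : v ∈ P) {T} (hT : T ⊆ Phi P v) : IsFaceOf P (KT P T) := by
  refine ⟨∑ F ∈ T, l F, ?_⟩
  have hf : ∀ F ∈ T, IsFacetOf P F := fun F hF => (D.mem_Phi.1 (hT hF)).1
  have hval : ∀ y ∈ P, (∑ F ∈ T, l F) y ≤ ∑ F ∈ T, b F := by
    intro y hy
    rw [_root_.sum_apply]
    exact Finset.sum_le_sum fun F hF => D.le F (hf F hF) y hy
  ext x
  constructor
  · rintro ⟨hx, hxT⟩
    refine ⟨hx, fun y hy => (hval y hy).trans ?_⟩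
    rw [_root_.sum_apply]
    exact Finset.sum_le_sum fun F hF => ((D.mem_facet (hf F hF)).1 (hxT F hF)).2.ge
  · rintro ⟨hx, hmax⟩
    refine ⟨hx, fun F hF => (D.mem_facet (hf F hF)).2 ⟨hx, ?_⟩⟩
    have h1 := hmax v hv
    rw [_root_.sum_apply, _root_.sum_apply,
      Finset.sum_congr rfl fun F hF => D.tight (hT hF)] at h1
    have h2 := (Finset.sum_eq_sum_iff_of_le fun F hF => D.le F (hf F hF) x hx).1
      (le_antisymm (Finset.sum_le_sum fun F hF => D.le F (hf F hF) x hx) h1)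
    exact h2 F hF

theorem Dat.vertex_of_ker (D : Dat P l b) {v} (hv : v ∈ P)
    (hk : ∀ d, (∀ F ∈ Phi P v, l F d = 0) → d = 0) : IsVertexOf P v := by
  have := D.KT_face hv (Finset.Subset.refl (Phi P v))
  have h2 : KT P (Phi P v) = {v} := by
    ext x
    simp only [KT, mem_ofPred_eq, mem_singleton_iff]
    constructor
    · rintro ⟨hx, h⟩
      rw [← sub_eq_zero]
      apply hk
      intro F hF
      rw [map_sub, D.tight hF, ((D.mem_facet (D.mem_Phi.1 hF).1).1 (h F hF)).2, sub_self]
    · rintro rfl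
      exact ⟨hv, fun F hF => (D.mem_Phi.1 hF).2⟩
  rw [h2] at this
  exact this

theorem face_extreme {P : Set (EuclideanSpace ℝ (Fin n))} {v} (h : IsFaceOf P {v}) :
    v ∈ P.extremePoints ℝ :=
  isExtreme_singleton.1 (face_exposed h).isExtreme

theorem Dat.vertex_iff (D : Dat P l b) {v} : IsVertexOf P v ↔ v ∈ P.extremePoints ℝ :=
  ⟨face_extreme, fun h => D.vertex_of_ker h.1 fun _ hd => D.ker_of_extreme h hd⟩

theorem Dat.basis (D : Dat P l b) {v} (hv : IsVertexOf P v) :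
    ∃ d : Set (EuclideanSpace ℝ (Fin n)) → EuclideanSpace ℝ (Fin n),
      (∀ F ∈ Phi P v, l F (d F) = -1) ∧
      (∀ F ∈ Phi P v, ∀ G ∈ Phi P v, G ≠ F → l G (d F) = 0) ∧
      (∀ x, x = ∑ F ∈ Phi P v, (-(l F x)) • d F) := by
  classical
  let L : EuclideanSpace ℝ (Fin n) →ₗ[ℝ] (Phi P v → ℝ) :=
    LinearMap.pi fun F => (l F.1 : EuclideanSpace ℝ (Fin n) →ₗ[ℝ] ℝ)
  have hL : ∀ x F, L x F = l F.1 x := fun x F => rfl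
  have hker : ∀ x, (∀ F ∈ Phi P v, l F x = 0) → x = 0 :=
    fun x hx => D.ker_of_extreme (D.vertex_iff.1 hv) hx
  have hinj : Function.Injective L := by
    rw [← LinearMap.ker_eq_bot, LinearMap.ker_eq_bot']
    intro x hx
    apply hker
    intro F hF
    have := congrFun hx ⟨F, hF⟩
    simpa [hL] using this
  have hsurj : Function.Surjective L := by
    refine (LinearMap.injective_iff_surjective_of_finrank_eq_finrank ?_).1 hinj
    rw [finrank_euclideanSpace_fin, Module.finrank_fintype_fun_eq_card, Fintype.card_coe, D.card_Phi hv]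
  choose g hg using hsurj
  let d : Set (EuclideanSpace ℝ (Fin n)) → EuclideanSpace ℝ (Fin n) :=
    fun F => g (fun G => if G.1 = F then -1 else 0)
  have hd : ∀ F, ∀ G ∈ Phi P v, l G (d F) = if G = F then -1 else 0 := by
    intro F G hG
    have := congrFun (hg (fun G => if G.1 = F then -1 else 0)) ⟨G, hG⟩
    simpa [hL] using this
  refine ⟨d, fun F hF => by simp [hd F F hF], fun F hF G hG h => by simp [hd F G hG, h], ?_⟩
  intro x
  rw [← sub_eq_zero]
  apply hker
  intro G hG
  rw [map_sub, map_sum]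
  simp only [map_smul, smul_eq_mul]
  rw [Finset.sum_congr rfl fun F hF => by rw [hd F G hG]]
  simp [hG]

theorem Dat.neighbor (D : Dat P l b) {v} (hv : IsVertexOf P v)
    {d : Set (EuclideanSpace ℝ (Fin n)) → EuclideanSpace ℝ (Fin n)}
    (hd1 : ∀ F ∈ Phi P v, l F (d F) = -1)
    (hd0 : ∀ F ∈ Phi P v, ∀ G ∈ Phi P v, G ≠ F → l G (d F) = 0)
    (hdx : ∀ x, x = ∑ F ∈ Phi P v, (-(l F x)) • d F)
    {F} (hF : F ∈ Phi P v) :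
    ∃ t : ℝ, 0 < t ∧ IsVertexOf P (v + t • d F) ∧ F ∉ Phi P (v + t • d F) ∧
      ∀ G ∈ Phi P v, G ≠ F → G ∈ Phi P (v + t • d F) := by
  have hvP : v ∈ P := (face_extreme hv).1
  have hdne : d F ≠ 0 := by
    intro h; have := hd1 F hF; rw [h] at this; simp at this
  have hle : ∀ G ∈ Phi P v, l G (d F) ≤ 0 := by
    intro G hG
    by_cases h : G = F
    · subst h; rw [hd1 G hG]; norm_num
    · exact (hd0 F hF G hG h).le
  set Q := {t : ℝ | 0 ≤ t ∧ v + t • d F ∈ P} with hQ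
  have hQc : IsCompact Q := by
    refine Metric.isCompact_of_isClosed_isBounded ?_ ?_
    · apply IsClosed.inter isClosed_Ici
      exact D.comp.isClosed.preimage (by fun_prop : Continuous fun t : ℝ => v + t • d F)
    · obtain ⟨C, hC⟩ := D.comp.isBounded.exists_norm_le
      rw [isBounded_iff_forall_norm_le]
      refine ⟨(C + C) / ‖d F‖, fun t ht => ?_⟩
      rw [le_div_iff₀ (norm_pos_iff.2 hdne), ← norm_smul]
      have : t • d F = (v + t • d F) - v := by abel
      rw [this]
      exact (norm_sub_le _ _).trans (add_le_add (hC _ ht.2) (hC _ hvP))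
  obtain ⟨t, htQ, htmax⟩ := hQc.exists_isMaxOn ⟨0, le_refl _, by simpa using hvP⟩ continuousOn_id
  have hmax : ∀ s ∈ Q, s ≤ t := fun s hs => htmax hs
  have htpos : 0 < t := by
    obtain ⟨s, hs, hs0⟩ := ((D.move hvP hle).and self_mem_nhdsWithin).exists
    have hs0 : 0 < s := hs0
    exact hs0.trans_le (hmax s ⟨hs0.le, hs⟩)
  set w := v + t • d F with hw
  have hwP : w ∈ P := htQ.2
  obtain ⟨F', hF', hpos⟩ : ∃ F' ∈ Phi P w, 0 < l F' (d F) := by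
    by_contra hcon
    push Not at hcon
    obtain ⟨s, hs, hs0⟩ := ((D.move hwP hcon).and self_mem_nhdsWithin).exists
    have hs0 : 0 < s := hs0
    have := hmax (t + s) ⟨by linarith, by rw [add_smul, ← add_assoc]; exact hs⟩
    linarith
  have hmem : ∀ G ∈ Phi P v, G ≠ F → G ∈ Phi P w := by
    intro G hG h
    have hGf := (D.mem_Phi.1 hG).1
    refine D.mem_Phi.2 ⟨hGf, (D.mem_facet hGf).2 ⟨hwP, ?_⟩⟩
    simp [hw, D.tight hG, hd0 F hF G hG h]
  refine ⟨t, htpos, ?_, ?_, hmem⟩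
  · apply D.vertex_of_ker hwP
    intro x hx
    have h1 : x = (-(l F x)) • d F := by
      conv_lhs => rw [hdx x]
      refine Finset.sum_eq_single_of_mem F hF fun G hG h => ?_
      rw [hx G (hmem G hG h)]; simp
    have h2 := hx F' hF'
    rw [h1, map_smul, smul_eq_mul] at h2
    rcases mul_eq_zero.1 h2 with h | h
    · rw [h1, h, zero_smul]
    · exact absurd h hpos.ne'
  · intro h
    have h1 := D.tight h
    have h2 := D.tight hF
    simp only [hw, map_add, map_smul, hd1 F hF, smul_eq_mul] at h1
    linarith

theorem Dat.neighbor_unique (D : Dat P l b) {v u w} (hv : IsVertexOf P v) (hu : IsVertexOf P u)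
    (hw : IsVertexOf P w) {F} (hF : F ∈ Phi P v)
    (hu1 : ∀ G ∈ Phi P v, G ≠ F → G ∈ Phi P u) (hu0 : F ∉ Phi P u)
    (hw1 : ∀ G ∈ Phi P v, G ≠ F → G ∈ Phi P w) (hw0 : F ∉ Phi P w) : u = w := by
  obtain ⟨d, hd1, hd0, hdx⟩ := D.basis hv
  have hFf := (D.mem_Phi.1 hF).1
  have key : ∀ u, IsVertexOf P u → (∀ G ∈ Phi P v, G ≠ F → G ∈ Phi P u) → F ∉ Phi P u →
      ∃ t : ℝ, 0 < t ∧ u = v + t • d F := by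
    intro u hu hu1 hu0
    have huP : u ∈ P := (face_extreme hu).1
    refine ⟨-(l F (u - v)), ?_, ?_⟩
    · have h1 := D.le F hFf u huP
      have h2 : l F u ≠ b F := fun h => hu0 (D.mem_Phi.2 ⟨hFf, (D.mem_facet hFf).2 ⟨huP, h⟩⟩)
      have h3 := lt_of_le_of_ne h1 h2
      rw [map_sub, D.tight hF]
      linarith
    · rw [← sub_eq_iff_eq_add']
      conv_lhs => rw [hdx (u - v)]
      refine Finset.sum_eq_single_of_mem F hF fun G hG h => ?_
      rw [map_sub, D.tight (hu1 G hG h), D.tight hG]; simp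
  have main : ∀ s t : ℝ, 0 < s → s < t → IsVertexOf P (v + s • d F) → IsVertexOf P (v + t • d F) →
      False := by
    intro s t hs hst h1 h2
    have ht : 0 < t := hs.trans hst
    have h3 := face_extreme h1
    have := h3.2 (face_extreme hv).1 (face_extreme h2).1
      ⟨1 - s / t, s / t, by rw [sub_pos, div_lt_one ht]; exact hst, by positivity, by ring, by
        rw [smul_add, smul_smul, div_mul_cancel₀ _ ht.ne']; module⟩
    have h4 : s • d F = 0 := by simpa using this
    rcases smul_eq_zero.1 h4 with h | h
    · exact hs.ne' h
    · have h5 := hd1 F hF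
      rw [h] at h5; simp at h5
  obtain ⟨s, hs, rfl⟩ := key u hu hu1 hu0
  obtain ⟨t, ht, rfl⟩ := key w hw hw1 hw0
  rcases lt_trichotomy s t with h | h | h
  · exact (main s t hs h hu hw).elim
  · rw [h]
  · exact (main t s ht h hw hu).elim

theorem Dat.descent (D : Dat P l b) {v u} (hv : IsVertexOf P v) (hu : u ∈ P)
    {T} (hTu : T ⊆ Phi P u) (f : EuclideanSpace ℝ (Fin n) →ₗ[ℝ] ℝ)
    (hf : f u < f v) :
    ∃ F ∈ Phi P v, F ∉ T ∧ ∃ w, IsVertexOf P w ∧ F ∉ Phi P w ∧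
      (∀ G ∈ Phi P v, G ≠ F → G ∈ Phi P w) ∧ f w < f v := by
  obtain ⟨d, hd1, hd0, hdx⟩ := D.basis hv
  have h1 : f (u - v) < 0 := by rw [map_sub]; linarith
  rw [hdx (u - v), map_sum] at h1
  obtain ⟨F, hF, hFlt⟩ := Finset.exists_lt_of_sum_lt (s := Phi P v) (f := fun F => f ((-(l F (u - v))) • d F))
    (g := fun _ => (0 : ℝ)) (by rw [Finset.sum_const_zero]; exact h1)
  have hFf := (D.mem_Phi.1 hF).1
  rw [map_smul, smul_eq_mul, map_sub, D.tight hF] at hFlt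
  have hle := D.le F hFf u hu
  have hdF : f (d F) < 0 := by
    by_contra h
    push Not at h
    have := mul_nonneg (by linarith : 0 ≤ -(l F u - b F)) h
    linarith
  refine ⟨F, hF, ?_, ?_⟩
  · intro hFT
    rw [D.tight (hTu hFT)] at hFlt
    simp at hFlt
  · obtain ⟨t, ht, hw, hw0, hw1⟩ := D.neighbor hv hd1 hd0 hdx hF
    refine ⟨_, hw, hw0, hw1, ?_⟩
    rw [map_add, map_smul, smul_eq_mul]
    nlinarith

theorem Dat.KT_dim (D : Dat P l b) {v} (hv : IsVertexOf P v) {T} (hT : T ⊆ Phi P v) :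
    faceDim (KT P T) + T.card = n := by
  classical
  obtain ⟨d, hd1, hd0, hdx⟩ := D.basis hv
  have hvP : v ∈ P := (face_extreme hv).1
  have hvK : v ∈ KT P T := ⟨hvP, fun F hF => (D.mem_Phi.1 (hT hF)).2⟩
  have hdir : (affineSpan ℝ (KT P T)).direction =
      Submodule.span ℝ (Set.range fun F : (Phi P v \ T : Finset _) => d F.1) := by
    apply le_antisymm
    · rw [direction_affineSpan, vectorSpan_eq_span_vsub_set_right ℝ hvK, Submodule.span_le]
      rintro _ ⟨x, hx, rfl⟩
      simp only [vsub_eq_sub, SetLike.mem_coe]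
      rw [hdx (x - v)]
      refine Submodule.sum_mem _ fun F hF => ?_
      by_cases hFT : F ∈ T
      · have : l F (x - v) = 0 := by
          rw [map_sub, D.tight hF, ((D.mem_facet (D.mem_Phi.1 hF).1).1 (hx.2 F hFT)).2, sub_self]
        rw [this]; simp
      · exact Submodule.smul_mem _ _ (Submodule.subset_span ⟨⟨F, Finset.mem_sdiff.2 ⟨hF, hFT⟩⟩, rfl⟩)
    · rw [Submodule.span_le]
      rintro _ ⟨⟨F, hF⟩, rfl⟩
      obtain ⟨hF, hFT⟩ := Finset.mem_sdiff.1 hF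
      obtain ⟨t, ht, hw, hw0, hw1⟩ := D.neighbor hv hd1 hd0 hdx hF
      have hwK : v + t • d F ∈ KT P T := ⟨(face_extreme hw).1, fun G hG =>
        (D.mem_Phi.1 (hw1 G (hT hG) (by rintro rfl; exact hFT hG))).2⟩
      have h1 := AffineSubspace.vsub_mem_direction (subset_affineSpan ℝ _ hwK) (subset_affineSpan ℝ _ hvK)
      simp only [vsub_eq_sub, add_sub_cancel_left] at h1
      have h2 := Submodule.smul_mem _ t⁻¹ h1
      rwa [smul_smul, inv_mul_cancel₀ ht.ne', one_smul] at h2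
  have hli : LinearIndependent ℝ (fun F : (Phi P v \ T : Finset _) => d F.1) := by
    rw [Fintype.linearIndependent_iff]
    intro g hg F
    have hF := (Finset.mem_sdiff.1 F.2).1
    have h1 := congrArg (l F.1) hg
    rw [map_sum, map_zero, Finset.sum_eq_single_of_mem F (Finset.mem_univ _)] at h1
    · rw [map_smul, hd1 F.1 hF] at h1
      simpa using h1
    · intro G _ hGF
      rw [map_smul, hd0 G.1 (Finset.mem_sdiff.1 G.2).1 F.1 hF (fun h => hGF (Subtype.ext h.symm))]
      simp
  rw [faceDim, hdir, finrank_span_eq_card hli, Fintype.card_coe, Finset.card_sdiff_of_subset hT, D.card_Phi hv]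
  have := Finset.card_le_card hT
  rw [D.card_Phi hv] at this
  omega

theorem Dat.face_eq_KT (D : Dat P l b) {v} (hv : IsVertexOf P v) {K} (hK : IsFaceOf P K) (hvK : v ∈ K) :
    ∃ T ⊆ Phi P v, K = KT P T := by
  classical
  obtain ⟨d, hd1, hd0, hdx⟩ := D.basis hv
  obtain ⟨m, rfl⟩ := hK
  have hvP := hvK.1
  have hmd : ∀ F ∈ Phi P v, m (d F) ≤ 0 := by
    intro F hF
    obtain ⟨t, ht, hw, hw0, hw1⟩ := D.neighbor hv hd1 hd0 hdx hF
    have h1 := hvK.2 _ (face_extreme hw).1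
    rw [map_add, map_smul, smul_eq_mul] at h1
    by_contra h
    push Not at h
    have := mul_pos ht h
    linarith
  have hval : ∀ x, m x = m v + ∑ F ∈ Phi P v, (b F - l F x) * m (d F) := by
    intro x
    have h1 : m (x - v) = ∑ F ∈ Phi P v, (b F - l F x) * m (d F) := by
      conv_lhs => rw [hdx (x - v)]
      rw [map_sum]
      refine Finset.sum_congr rfl fun F hF => ?_
      rw [map_smul, smul_eq_mul, map_sub, D.tight hF]; ring
    rw [← h1, map_sub]; ring
  refine ⟨(Phi P v).filter fun F => m (d F) ≠ 0, Finset.filter_subset _ _, ?_⟩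
  ext x
  constructor
  · rintro ⟨hx, hmax⟩
    refine ⟨hx, fun F hF => ?_⟩
    obtain ⟨hF, hne⟩ := Finset.mem_filter.1 hF
    have hFf := (D.mem_Phi.1 hF).1
    have h1 := hmax v hvP
    rw [hval x] at h1
    have hnp : ∀ F ∈ Phi P v, (b F - l F x) * m (d F) ≤ 0 := fun F hF =>
      mul_nonpos_of_nonneg_of_nonpos (sub_nonneg.2 (D.le F (D.mem_Phi.1 hF).1 x hx)) (hmd F hF)
    have h2 := (Finset.sum_eq_zero_iff_of_nonpos hnp).1
      (le_antisymm (Finset.sum_nonpos hnp) (by linarith)) F hF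
    rcases mul_eq_zero.1 h2 with h | h
    · exact (D.mem_facet hFf).2 ⟨hx, by linarith⟩
    · exact absurd h hne
  · rintro ⟨hx, hT⟩
    refine ⟨hx, fun y hy => ?_⟩
    have : m x = m v := by
      rw [hval x, Finset.sum_eq_zero, add_zero]
      intro F hF
      by_cases h : m (d F) = 0
      · rw [h, mul_zero]
      · rw [((D.mem_facet (D.mem_Phi.1 hF).1).1 (hT F (Finset.mem_filter.2 ⟨hF, h⟩))).2, sub_self, zero_mul]
    rw [this]
    exact hvK.2 y hy

theorem Dat.exists_vertex (D : Dat P l b) {K} (hK : IsExposed ℝ P K) (hne : K.Nonempty) :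
    ∃ v ∈ K, IsVertexOf P v := by
  obtain ⟨v, hv⟩ := (hK.isCompact D.comp).extremePoints_nonempty hne
  exact ⟨v, hv.1, D.vertex_iff.2 (hK.isExtreme.extremePoints_subset_extremePoints hv)⟩

theorem Dat.face_vertices (D : Dat P l b) {K} (hK : IsFaceOf P K) {u} :
    IsFaceOf K {u} ↔ IsVertexOf P u ∧ u ∈ K := by
  constructor
  · intro h
    have h1 := face_extreme h
    exact ⟨D.vertex_iff.2 ((face_exposed hK).isExtreme.extremePoints_subset_extremePoints h1), h1.1⟩
  · rintro ⟨h, hu⟩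
    exact ((face_exposed h).mono (face_exposed hK).subset (by simpa using hu)) ⟨u, rfl⟩

end geom

/-- **Joswig's theorem.** A full-dimensional simple polytope `P ⊆ ℝ^n` (with `n ≥ 2`)
admits a proper coloring of its facets by `n` colors if and only if every
2-dimensional face of `P` has an even number of vertices. -/
theorem joswig {n : ℕ} (hn : 2 ≤ n) (P : Set (EuclideanSpace ℝ (Fin n)))
    (hP : IsSimplePolytope P) :
    (∃ h : Set (EuclideanSpace ℝ (Fin n)) → Fin n, IsProperColoring P h) ↔
      (∀ K, IsFaceOf P K → faceDim K = 2 → Even {v | IsFaceOf K {v}}.ncard) := by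
  classical
  obtain ⟨l, b, h1, h2, h3⟩ := hrep hn hP.1
  have D : Dat P l b := ⟨h1, h2, h3, facets_finite hP.1, polytope_compact hP.1, polytope_convex hP.1, hP.2⟩
  have hVfin : {v | IsVertexOf P v}.Finite :=
    (vertices_finite hP.1).subset fun v hv => D.vertex_iff.1 hv
  let V := {v // IsVertexOf P v}
  have : Fintype V := hVfin.fintype
  let Φ : V → Finset (Set (EuclideanSpace ℝ (Fin n))) := fun v => Phi P v.1
  obtain ⟨f, hf⟩ : ∃ f : Module.Dual ℝ (EuclideanSpace ℝ (Fin n)),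
      ∀ p : {p : V × V // p.1 ≠ p.2}, f (p.1.1.1 - p.1.2.1) ≠ 0 :=
    Module.exists_dual_forall_apply_ne_zero _ fun p h => p.2 (Subtype.ext (sub_eq_zero.1 h))
  have hℓ : Function.Injective fun v : V => f v.1 := by
    intro v w h
    by_contra hne
    apply hf ⟨(v, w), hne⟩
    rw [map_sub]
    exact sub_eq_zero.2 h
  have inter_iff : ∀ (v w : V) (F) (_ : F ∈ Φ v), Φ v ∩ Φ w = (Φ v).erase F ↔
      F ∉ Φ w ∧ ∀ G ∈ Φ v, G ≠ F → G ∈ Φ w := by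
    intro v w F hF
    constructor
    · intro h
      constructor
      · intro hFw
        have : F ∈ Φ v ∩ Φ w := Finset.mem_inter.2 ⟨hF, hFw⟩
        rw [h] at this; simp at this
      · intro G hG hGF
        have : G ∈ Φ v ∩ Φ w := by rw [h]; exact Finset.mem_erase.2 ⟨hGF, hG⟩
        exact (Finset.mem_inter.1 this).2
    · rintro ⟨h0, h1⟩
      ext G
      simp only [Finset.mem_inter, Finset.mem_erase]
      constructor
      · rintro ⟨hG, hGw⟩
        exact ⟨by rintro rfl; exact h0 hGw, hG⟩
      · rintro ⟨hGF, hG⟩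
        exact ⟨hG, h1 G hG hGF⟩
  have hA : ∀ f : Module.Dual ℝ (EuclideanSpace ℝ (Fin n)), ∀ v u : V, ∀ T ⊆ Φ v, T ⊆ Φ u →
      f u.1 < f v.1 → ∃ F ∈ Φ v, F ∉ T ∧ ∃ w : V,
      Φ v ∩ Φ w = (Φ v).erase F ∧ f w.1 < f v.1 := by
    intro f v u T hT hTu hlt
    obtain ⟨F, hF, hFT, w, hw, hw0, hw1, hwf⟩ := D.descent v.2 (face_extreme u.2).1 hTu f hlt
    exact ⟨F, hF, hFT, ⟨w, hw⟩, (inter_iff v ⟨w, hw⟩ F hF).2 ⟨hw0, hw1⟩, hwf⟩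
  have main := comb_main (n := n) (by omega) Φ (fun v => D.card_Phi v.2)
    (by
      intro v F hF
      obtain ⟨d, hd1, hd0, hdx⟩ := D.basis v.2
      obtain ⟨t, ht, hw, hw0, hw1⟩ := D.neighbor v.2 hd1 hd0 hdx hF
      exact ⟨⟨_, hw⟩, (inter_iff v ⟨_, hw⟩ F hF).2 ⟨hw0, hw1⟩⟩)
    (by
      intro v u w F hF hu hw
      obtain ⟨hu0, hu1⟩ := (inter_iff v u F hF).1 hu
      obtain ⟨hw0, hw1⟩ := (inter_iff v w F hF).1 hw
      exact Subtype.ext (D.neighbor_unique v.2 u.2 w.2 hF hu1 hu0 hw1 hw0))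
    (fun v : V => f v.1) hℓ (hA f)
    (by
      intro v u T hT hTu hlt
      obtain ⟨F, hF, hFT, w, hw, hwf⟩ := hA (-f) v u T hT hTu (by simpa using hlt)
      exact ⟨F, hF, hFT, w, hw, by simpa using hwf⟩)
  have hcol : (∃ h : Set (EuclideanSpace ℝ (Fin n)) → Fin n, IsProperColoring P h) ↔
      (∃ h : Set (EuclideanSpace ℝ (Fin n)) → Fin n, ∀ v, Set.InjOn h (Φ v)) := by
    refine exists_congr fun h => ⟨?_, ?_⟩
    · intro hh v F hF G hG hFG
      by_contra hne
      obtain ⟨hF, hvF⟩ := D.mem_Phi.1 hF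
      obtain ⟨hG, hvG⟩ := D.mem_Phi.1 hG
      exact hh F G hF hG hne ⟨v.1, hvF, hvG⟩ hFG
    · intro hh F G hF hG hne hFG heq
      obtain ⟨v, ⟨hvF, hvG⟩, hv⟩ :=
        D.exists_vertex ((face_exposed hF.1).inter (face_exposed hG.1)) hFG
      exact hne (hh ⟨v, hv⟩ (D.mem_Phi.2 ⟨hF, hvF⟩) (D.mem_Phi.2 ⟨hG, hvG⟩) heq)
  have hcount : ∀ (v : V) (T) (_ : T ⊆ Φ v),
      {u | IsFaceOf (KT P T) {u}}.ncard = (Finset.univ.filter fun u => T ⊆ Φ u).card := by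
    intro v T hT
    have hK := D.KT_face (face_extreme v.2).1 hT
    rw [← Finset.card_map (Function.Embedding.subtype _), ← Set.ncard_coe_finset]
    congr 1
    ext u
    simp only [mem_ofPred_eq, D.face_vertices hK, Finset.coe_map, mem_image, Finset.mem_coe,
      Finset.mem_filter, Finset.mem_univ, true_and, Function.Embedding.subtype_apply]
    constructor
    · rintro ⟨hu, hP, hTu⟩
      exact ⟨⟨u, hu⟩, fun F hF => D.mem_Phi.2 ⟨(D.mem_Phi.1 (hT hF)).1, hTu F hF⟩, rfl⟩
    · rintro ⟨w, hw, rfl⟩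
      exact ⟨w.2, (face_extreme w.2).1, fun F hF => (D.mem_Phi.1 (hw hF)).2⟩
  rw [hcol, main]
  constructor
  · intro H K hK hdim
    have hne : K.Nonempty := by
      by_contra h
      rw [not_nonempty_iff_eq_empty] at h
      rw [h] at hdim
      rw [faceDim_empty] at hdim
      omega
    obtain ⟨v, hvK, hv⟩ := D.exists_vertex (face_exposed hK) hne
    obtain ⟨T, hT, rfl⟩ := D.face_eq_KT hv hK hvK
    rw [hcount ⟨v, hv⟩ T hT]
    refine H ⟨v, hv⟩ T hT ?_
    have := D.KT_dim hv hT
    omega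
  · intro H v T hT hc
    rw [← hcount v T hT]
    refine H _ (D.KT_face (face_extreme v.2).1 hT) ?_
    have := D.KT_dim v.2 hT
    omega

end
end
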